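/- arXiv:0801.0394 — 2 statements merged into one kernel-verified Lean document; each statement's English description precedes it below -/
import Mathlib

section
/- (Blow-up Lemma, Csaba's version.) For all numbers Δ, K₁, K₂, K₃ and every positive constant c there exists a number N such that whenever positive constants satisfy 0 < ε ≪ ε' ≪ δ' ≪ d ≪ 1/Δ, 1/K₁, 1/K₂, 1/K₃, c, the following holds. Suppose G' is a graph of order n ≥ N and V₀, …, V_k is a partition of V(G') such that the bipartite graph (V_i,V_j)_{G'} is ε-regular with density either 0 or d for all 1 ≤ i < j ≤ k. Let H be a graph on n vertices with Δ(H) ≤ Δ and let L₀, L₁, …, L_k be a partition of V(H) with |L_i| = |V_i| = m for every i = 1, …, k. Suppose there exists a bijection φ: L₀ → V₀ and a set I ⊆ V(H) of vertices at pairwise distance at least 4 in H such that: (C1) |L₀| = |V₀| ≤ K₁dn; (C2) L₀ ⊆ I; (C3) each L_i (i ≥ 1) is independent in H; (C4) |N_H(L₀) ∩ L_i| ≤ K₂dm for every i ≥ 1; (C5) for each i ≥ 1 there exists D_i ⊆ I ∩ L_i with |D_i| = δ'm such that, with D = ∪ᵢ D_i, one has ||N_H(D) ∩ L_i| − |N_H(D)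 ∩ L_j|| < εm for all 1 ≤ i < j ≤ k; (C6) if xy ∈ E(H) with x ∈ L_i, y ∈ L_j (i,j ≥ 1) then (V_i,V_j)_{G'} is ε-regular with density d; (C7) if xy ∈ E(H) with x ∈ L₀, y ∈ L_j then |N_{G'}(φ(x)) ∩ V_j| ≥ cm; (C8) for each i ≥ 1, given any E_i ⊆ V_i with |E_i| ≤ ε'm there exist F_i ⊆ L_i ∩ (I∖D) and a bijection φ_i: E_i → F_i such that |N_{G'}(v) ∩ V_j| ≥ (d−ε)m whenever N_H(φ_i(v)) ∩ L_j ≠ ∅ (for all v ∈ E_i and all j ≥ 1); (C9) writing F = ∪ᵢ F_i, one has |N_H(F) ∩ L_i| ≤ K₃ε'm for all i. Then G' contains a copy of H such that the image of L_i is V_i for all i = 1, …, k and the image of each x ∈ L₀ is φ(x) ∈ V₀. -/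
open Set

namespace ArxivOG

variable {V : Type*}

/-- An oriented graph: at most one directed edge between any two vertices (and no loops). -/
def IsOriented (G : V → V → Prop) : Prop := ∀ x y : V, G x y → ¬ G y x

/-- Out-neighbourhood of a vertex. -/
def outN (G : V → V → Prop) (x : V) : Set V := {y | G x y}

/-- In-neighbourhood of a vertex. -/
def inN (G : V → V → Prop) (x : V) : Set V := {y | G y x}

/-- Outdegree of a vertex. -/
noncomputable def outDeg (G : V → V → Prop) (x : V) : ℕ := (outN G x).ncard

/-- Indegree of a vertex. -/
noncomputable def inDeg (G : V → V → Prop) (x : V) : ℕ := (inN G x).ncard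

/-- The set of all outneighbours of vertices in `S`. -/
def outNSet (G : V → V → Prop) (S : Set V) : Set V := {y | ∃ x ∈ S, G x y}

/-- Minimum outdegree `δ⁺`. -/
noncomputable def minOutDeg (G : V → V → Prop) : ℕ := sInf (Set.range (outDeg G))

/-- Minimum indegree `δ⁻`. -/
noncomputable def minInDeg (G : V → V → Prop) : ℕ := sInf (Set.range (inDeg G))

/-- Minimum semi-degree `δ⁰ = min (δ⁺, δ⁻)`. -/
noncomputable def minSemiDeg (G : V → V → Prop) : ℕ := min (minOutDeg G) (minInDeg G)

/-- A Hamilton cycle of a digraph, encoded as a permutation `σ` of the vertex set all of whose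
vertices lie on a single cycle and such that every vertex sends an edge to its successor. -/
def IsHamCycle (G : V → V → Prop) (σ : Equiv.Perm V) : Prop :=
  (∀ v, G v (σ v)) ∧ ∀ v w : V, σ.SameCycle v w

/-- The number of edges directed from `A` to `B`. -/
noncomputable def eCnt (G : V → V → Prop) (A B : Set V) : ℕ :=
  {p : V × V | p.1 ∈ A ∧ p.2 ∈ B ∧ G p.1 p.2}.ncard

/-- The density of the bipartite graph of all `A`–`B` edges. -/
noncomputable def dens (G : V → V → Prop) (A B : Set V) : ℝ :=
  (eCnt G A B : ℝ) / ((A.ncard : ℝ) * (B.ncard : ℝ))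

/-- The pair `(A,B)` is `ε`-regular. -/
def EpsRegular (ε : ℝ) (G : V → V → Prop) (A B : Set V) : Prop :=
  ∀ X ⊆ A, ∀ Y ⊆ B, ε * A.ncard < (X.ncard : ℝ) → ε * B.ncard < (Y.ncard : ℝ) →
    |dens G X Y - dens G A B| < ε

/-- The pair `(A,B)` is `(ε,d)`-super-regular. -/
def SuperRegular (ε d : ℝ) (G : V → V → Prop) (A B : Set V) : Prop :=
  EpsRegular ε G A B ∧
  (∀ a ∈ A, (d - ε) * B.ncard ≤ ((outN G a ∩ B).ncard : ℝ)) ∧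
  (∀ b ∈ B, (d - ε) * A.ncard ≤ ((inN G b ∩ A).ncard : ℝ))

/-- The cluster `V_i` of a partition encoded by `P : V → Option (Fin k)`. -/
def cluster {k : ℕ} (P : V → Option (Fin k)) (i : Fin k) : Set V := {x | P x = some i}

/-- The exceptional set `V₀` of a partition encoded by `P : V → Option (Fin k)`. -/
def cluster0 {k : ℕ} (P : V → Option (Fin k)) : Set V := {x | P x = none}

end ArxivOG

namespace BlowUp

open scoped Finset Classical

variable {α β ι : Type*} [Fintype α] [Fintype β] [DecidableEq α] [DecidableEq β] [DecidableEq ι]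

/-- The data of a blow-up problem: a host graph `G` and a guest graph `H`, clusters of size `m`
given by `p` and `q`, and a reserved set `R` meeting every cluster in `r` vertices. The pairs of
host clusters that have to carry guest edges satisfy one-sided degree forms of `ε`-regularity. -/
structure Frame (α β ι : Type*) [Fintype α] [Fintype β] [DecidableEq α] [DecidableEq β]
    [DecidableEq ι] where
  /-- host graph -/
  G : SimpleGraph β
  /-- guest graph -/
  H : SimpleGraph α
  /-- cluster of a host vertex -/
  p : β → Option ι
  /-- cluster of a guest vertex -/
  q : α → Option ι
  /-- cluster size -/
  m : ℕ
  /-- degree bound of the guest graph -/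
  Δ : ℕ
  /-- density -/
  d : ℝ
  /-- regularity parameter -/
  ε : ℝ
  /-- error parameter for codegrees -/
  σ : ℝ
  /-- reserved host vertices -/
  R : Finset β
  /-- number of reserved vertices in a cluster -/
  r : ℕ
  m_pos : 0 < m
  d_pos : 0 < d
  d_le_one : d ≤ 1
  ε_pos : 0 < ε
  σ_pos : 0 < σ
  ε_le : ε ≤ σ ^ 2
  card_L : ∀ o, o ≠ none → #{z | q z = o} = m
  card_V : ∀ o, o ≠ none → #{v | p v = o} = m
  card_R : ∀ o, o ≠ none → #{v | p v = o ∧ v ∈ R} = r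
  deg_le : ∀ z, #{y | H.Adj z y} ≤ Δ
  reg_low : ∀ w z, H.Adj w z → q w ≠ none → q z ≠ none → ∀ X : Finset β,
    (∀ v ∈ X, p v = q z) →
    (#{u | p u = q w ∧ (#{v ∈ X | G.Adj u v} : ℝ) < d * #X - ε * m} : ℝ) ≤ ε * m
  reg_high : ∀ w z, H.Adj w z → q w ≠ none → q z ≠ none → ∀ X : Finset β,
    (∀ v ∈ X, p v = q z) →
    (#{u | p u = q w ∧ d * #X + ε * m < (#{v ∈ X | G.Adj u v} : ℝ)} : ℝ) ≤ ε * m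

namespace Frame

variable (S : Frame α β ι)

/-- Host vertices in the cluster of `z` that are adjacent to the images of all neighbours of `z`
in `T`. -/
noncomputable def cand (T : Finset α) (f : α → β) (z : α) : Finset β :=
  {v | S.p v = S.q z ∧ ∀ y ∈ T, S.H.Adj z y → S.G.Adj (f y) v}

/-- The number of neighbours of `z` in `T`. -/
noncomputable def deg (T : Finset α) (z : α) : ℕ := #{y ∈ T | S.H.Adj z y}

/-- Ordered pairs of guest vertices in cluster `o` without a common neighbour whose candidate
sets intersect in too many vertices. -/
noncomputable def viol (T : Finset α) (f : α → β) (o : Option ι) : Finset (α × α) :=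
  {ab | S.q ab.1 = o ∧ S.q ab.2 = o ∧ (∀ w, S.H.Adj ab.1 w → ¬ S.H.Adj ab.2 w) ∧
    S.d ^ (S.deg T ab.1 + S.deg T ab.2) * S.m +
      ((S.deg T ab.1 + S.deg T ab.2 : ℕ) : ℝ) * (S.ε * S.m) <
      #(S.cand T f ab.1 ∩ S.cand T f ab.2)}

/-- The candidate sets determined by the images of `T` behave pseudo-randomly. -/
structure Inv (T : Finset α) (f : α → β) : Prop where
  size : ∀ z, S.q z ≠ none →
    S.d ^ S.deg T z * S.m - S.deg T z * (S.ε * S.m) ≤ #(S.cand T f z)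
  sizeR : ∀ z, S.q z ≠ none →
    S.d ^ S.deg T z * S.r - S.deg T z * (S.ε * S.m) ≤ #(S.cand T f z ∩ S.R)
  pairs : ∀ o, o ≠ none →
    (#(S.viol T f o) : ℝ) ≤ 2 * (S.σ * S.m) * ∑ z with S.q z = o, (S.deg T z : ℝ)

variable {S}

lemma mem_cand {T : Finset α} {f : α → β} {z : α} {v : β} :
    v ∈ S.cand T f z ↔ S.p v = S.q z ∧ ∀ y ∈ T, S.H.Adj z y → S.G.Adj (f y) v := by
  simp [cand]

lemma deg_le_max (T : Finset α) (z : α) : S.deg T z ≤ S.Δ :=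
  (Finset.card_le_card (Finset.filter_subset_filter _ (Finset.subset_univ T))).trans (S.deg_le z)

lemma deg_insert {T : Finset α} {w : α} (hw : w ∉ T) (z : α) :
    S.deg (insert w T) z = S.deg T z + if S.H.Adj z w then 1 else 0 := by
  unfold deg
  rw [Finset.filter_insert]
  split_ifs with h
  · rw [Finset.card_insert_of_notMem (by simp [hw])]
  · simp

lemma cand_insert {T : Finset α} {f : α → β} {w : α} (hw : w ∉ T) (u : β) (z : α) :
    S.cand (insert w T) (Function.update f w u) z =
      if S.H.Adj z w then {v ∈ S.cand T f z | S.G.Adj u v} else S.cand T f z := by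
  have key : ∀ y ∈ T, Function.update f w u y = f y := fun y hy =>
    Function.update_of_ne (by rintro rfl; exact hw hy) _ _
  ext v
  split_ifs with h
  · simp only [mem_cand, Finset.mem_insert, forall_eq_or_imp, Function.update_self,
      Finset.mem_filter]
    constructor
    · rintro ⟨h1, h2, h3⟩
      exact ⟨⟨h1, fun y hy hz => key y hy ▸ h3 y hy hz⟩, h2 h⟩
    · rintro ⟨⟨h1, h2⟩, h3⟩
      exact ⟨h1, fun _ => h3, fun y hy hz => (key y hy).symm ▸ h2 y hy hz⟩
  · simp only [mem_cand, Finset.mem_insert, forall_eq_or_imp]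
    constructor
    · rintro ⟨h1, h2, h3⟩
      exact ⟨h1, fun y hy hz => key y hy ▸ h3 y hy hz⟩
    · rintro ⟨h1, h2⟩
      exact ⟨h1, fun h' => absurd h' h, fun y hy hz => (key y hy).symm ▸ h2 y hy hz⟩

lemma inv_empty (f : α → β) : S.Inv ∅ f := by
  have hc : ∀ z, S.cand ∅ f z = Finset.univ.filter (fun v => S.p v = S.q z) := fun z => by
    ext v; simp [mem_cand]
  have hd : ∀ z, S.deg ∅ z = 0 := fun z => by simp [deg]
  refine ⟨fun z hz => ?_, fun z hz => ?_, fun o ho => ?_⟩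
  · simp [hc, hd, S.card_V _ hz]
  · have := S.card_R _ hz
    simp only [hc, hd]
    rw [← this]
    simp only [pow_zero, one_mul, CharP.cast_eq_zero, zero_mul, sub_zero, Nat.cast_le]
    refine Finset.card_le_card fun v => by simp
  · have : S.viol ∅ f o = ∅ := by
      refine Finset.eq_empty_of_forall_notMem fun ab hab => ?_
      simp only [viol, Finset.mem_filter, Finset.mem_univ, true_and, hc, hd] at hab
      obtain ⟨h1, h2, -, h3⟩ := hab
      rw [h1, h2, Finset.inter_self, S.card_V _ ho] at h3
      simp at h3
    simp [this, hd]

/-- Host vertices `u` such that, for few `z'` in the cluster of `z`, the common candidates of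
`z` and `z'` have too many neighbours of `u`. -/
noncomputable def heavy (S : Frame α β ι) (T : Finset α) (f : α → β) (u : β) (z : α) :
    Finset α :=
  {z' | S.q z' = S.q z ∧ S.d * #(S.cand T f z ∩ S.cand T f z') + S.ε * S.m <
    (#{v ∈ S.cand T f z ∩ S.cand T f z' | S.G.Adj u v} : ℝ)}

lemma card_heavy_large (T : Finset α) (f : α → β) {w z : α} (hwz : S.H.Adj w z)
    (hw : S.q w ≠ none) (hz : S.q z ≠ none) :
    (#{u | S.p u = S.q w ∧ S.σ * S.m < #(S.heavy T f u z)} : ℝ) ≤ S.σ * S.m := by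
  set B : Finset β :=
    Finset.univ.filter fun u => S.p u = S.q w ∧ S.σ * S.m < #(S.heavy T f u z) with hB
  have hm : (0 : ℝ) < S.m := by exact_mod_cast S.m_pos
  have hσ := S.σ_pos
  have h1 : (#B : ℝ) * (S.σ * S.m) ≤ ∑ u ∈ B, (#(S.heavy T f u z) : ℝ) := by
    rw [← nsmul_eq_mul]
    refine Finset.card_nsmul_le_sum _ _ _ fun u hu => ?_
    simp only [hB, Finset.mem_filter] at hu
    exact hu.2.2.le
  have h2 : (∑ u ∈ B, (#(S.heavy T f u z) : ℝ)) ≤ ∑ z' with S.q z' = S.q z, S.ε * S.m := by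
    have : (∑ u ∈ B, (#(S.heavy T f u z) : ℝ)) =
        ∑ z' with S.q z' = S.q z, (#{u ∈ B | z' ∈ S.heavy T f u z} : ℝ) := by
      simp only [Finset.card_eq_sum_ones, Nat.cast_sum, Finset.sum_filter, heavy]
      push_cast
      rw [Finset.sum_comm]
      refine Finset.sum_congr rfl fun z' _ => ?_
      by_cases h : S.q z' = S.q z <;> simp [h]
    rw [this]
    refine Finset.sum_le_sum fun z' hz' => ?_
    simp only [Finset.mem_filter, Finset.mem_univ, true_and] at hz'
    refine le_trans ?_ (S.reg_high w z hwz hw hz (S.cand T f z ∩ S.cand T f z') ?_)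
    · norm_cast
      refine Finset.card_le_card fun u hu => ?_
      obtain ⟨hu1, hu2⟩ := Finset.mem_filter.1 hu
      simp only [heavy, Finset.mem_filter, Finset.mem_univ, true_and] at hu2 ⊢
      exact ⟨(Finset.mem_filter.1 hu1).2.1, hu2.2⟩
    · intro v hv
      exact (mem_cand.1 (Finset.mem_inter.1 hv).1).1
  rw [Finset.sum_const, S.card_L _ hz, nsmul_eq_mul] at h2
  have h3 : (#B : ℝ) * (S.σ * S.m) ≤ (S.σ * S.m) * (S.σ * S.m) := by
    have := mul_le_mul_of_nonneg_right S.ε_le (by positivity : (0 : ℝ) ≤ S.m * S.m)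
    nlinarith
  exact le_of_mul_le_mul_right h3 (by positivity)

lemma exists_bad_neighbor (T : Finset α) (f : α → β) {w z : α} (hwz : S.H.Adj w z)
    (hw : S.q w ≠ none) (hz : S.q z ≠ none) :
    ∃ B : Finset β, (#B : ℝ) ≤ (2 * S.ε + S.σ) * S.m ∧ ∀ u ∉ B, S.p u = S.q w →
      S.d * #(S.cand T f z) - S.ε * S.m ≤ (#{v ∈ S.cand T f z | S.G.Adj u v} : ℝ) ∧
      S.d * #(S.cand T f z ∩ S.R) - S.ε * S.m ≤
        (#{v ∈ S.cand T f z ∩ S.R | S.G.Adj u v} : ℝ) ∧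
      (#(S.heavy T f u z) : ℝ) ≤ S.σ * S.m := by
  let B₁ : Finset β := {u | S.p u = S.q w ∧ (#{v ∈ S.cand T f z | S.G.Adj u v} : ℝ) <
      S.d * #(S.cand T f z) - S.ε * S.m}
  let B₂ : Finset β := {u | S.p u = S.q w ∧ (#{v ∈ S.cand T f z ∩ S.R | S.G.Adj u v} : ℝ) <
      S.d * #(S.cand T f z ∩ S.R) - S.ε * S.m}
  let B₃ : Finset β := {u | S.p u = S.q w ∧ S.σ * S.m < #(S.heavy T f u z)}
  refine ⟨B₁ ∪ B₂ ∪ B₃, ?_, ?_⟩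
  · refine (Nat.cast_le.2 ((Finset.card_union_le _ _).trans
      (Nat.add_le_add_right (Finset.card_union_le _ _) _))).trans ?_
    push_cast
    have h1 := S.reg_low w z hwz hw hz (S.cand T f z) fun v hv => (mem_cand.1 hv).1
    have h2 := S.reg_low w z hwz hw hz (S.cand T f z ∩ S.R) fun v hv =>
      (mem_cand.1 (Finset.mem_inter.1 hv).1).1
    have h3 := card_heavy_large T f hwz hw hz
    linarith
  · intro u hu hp
    simp only [B₁, B₂, B₃, Finset.mem_union, Finset.mem_filter, Finset.mem_univ, true_and, hp,
      not_or, not_lt] at hu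
    exact ⟨hu.1.1, hu.1.2, hu.2⟩

lemma exists_bad (T : Finset α) (f : α → β) {w : α} (hw : S.q w ≠ none) :
    ∃ B : Finset β, (#B : ℝ) ≤ S.Δ * ((2 * S.ε + S.σ) * S.m) ∧ ∀ u ∉ B, S.p u = S.q w →
      ∀ z, S.H.Adj z w → S.q z ≠ none →
      S.d * #(S.cand T f z) - S.ε * S.m ≤ (#{v ∈ S.cand T f z | S.G.Adj u v} : ℝ) ∧
      S.d * #(S.cand T f z ∩ S.R) - S.ε * S.m ≤
        (#{v ∈ S.cand T f z ∩ S.R | S.G.Adj u v} : ℝ) ∧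
      (#(S.heavy T f u z) : ℝ) ≤ S.σ * S.m := by
  have h0 : (0 : ℝ) ≤ (2 * S.ε + S.σ) * S.m := by
    have := S.ε_pos; have := S.σ_pos; positivity
  have : ∀ z, ∃ B : Finset β, (#B : ℝ) ≤ (2 * S.ε + S.σ) * S.m ∧
      (S.H.Adj z w → S.q z ≠ none → ∀ u ∉ B, S.p u = S.q w →
      S.d * #(S.cand T f z) - S.ε * S.m ≤ (#{v ∈ S.cand T f z | S.G.Adj u v} : ℝ) ∧
      S.d * #(S.cand T f z ∩ S.R) - S.ε * S.m ≤
        (#{v ∈ S.cand T f z ∩ S.R | S.G.Adj u v} : ℝ) ∧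
      (#(S.heavy T f u z) : ℝ) ≤ S.σ * S.m) := by
    intro z
    by_cases h : S.H.Adj z w ∧ S.q z ≠ none
    · obtain ⟨B, hB, hB'⟩ := exists_bad_neighbor T f h.1.symm hw h.2
      exact ⟨B, hB, fun _ _ => hB'⟩
    · exact ⟨∅, by simpa using h0, fun h1 h2 => absurd ⟨h1, h2⟩ h⟩
  choose B hB hB' using this
  refine ⟨({z | S.H.Adj w z} : Finset α).biUnion B, ?_, ?_⟩
  · calc (#(({z | S.H.Adj w z} : Finset α).biUnion B) : ℝ)
        ≤ ∑ z with S.H.Adj w z, (#(B z) : ℝ) := by exact_mod_cast Finset.card_biUnion_le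
      _ ≤ ∑ z with S.H.Adj w z, (2 * S.ε + S.σ) * S.m := Finset.sum_le_sum fun z _ => hB z
      _ = #{z | S.H.Adj w z} * ((2 * S.ε + S.σ) * S.m) := by rw [Finset.sum_const, nsmul_eq_mul]
      _ ≤ _ := by
        refine mul_le_mul_of_nonneg_right ?_ h0
        exact_mod_cast S.deg_le w
  · intro u hu hp z hz hqz
    refine hB' z hz hqz u (fun h => hu ?_) hp
    exact Finset.mem_biUnion.2 ⟨z, by simpa using hz.symm, h⟩

lemma Inv.insert {T : Finset α} {f : α → β} (hI : S.Inv T f) {w : α} (hw : w ∉ T) {u : β}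
    (hu : ∀ z, S.H.Adj z w → S.q z ≠ none →
      S.d * #(S.cand T f z) - S.ε * S.m ≤ (#{v ∈ S.cand T f z | S.G.Adj u v} : ℝ) ∧
      S.d * #(S.cand T f z ∩ S.R) - S.ε * S.m ≤
        (#{v ∈ S.cand T f z ∩ S.R | S.G.Adj u v} : ℝ) ∧
      (#(S.heavy T f u z) : ℝ) ≤ S.σ * S.m) :
    S.Inv (insert w T) (Function.update f w u) := by
  have hm : (0 : ℝ) < S.m := by exact_mod_cast S.m_pos
  have hd0 := S.d_pos
  have hd1 := S.d_le_one
  have hεm : 0 < S.ε * S.m := mul_pos S.ε_pos hm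
  have hσ := S.σ_pos
  refine ⟨fun z hz => ?_, fun z hz => ?_, fun o ho => ?_⟩
  · rw [deg_insert hw, cand_insert hw]
    split_ifs with h
    · have h1 := (hu z h hz).1
      have h2 := mul_le_mul_of_nonneg_left (hI.size z hz) hd0.le
      push_cast
      rw [pow_succ]
      have : S.d * (S.deg T z * (S.ε * S.m)) ≤ S.deg T z * (S.ε * S.m) :=
        mul_le_of_le_one_left (by positivity) hd1
      linarith
    · simpa using hI.size z hz
  · rw [deg_insert hw, cand_insert hw]
    split_ifs with h
    · have h1 := (hu z h hz).2.1
      have h2 := mul_le_mul_of_nonneg_left (hI.sizeR z hz) hd0.le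
      push_cast
      rw [pow_succ]
      have : S.d * (S.deg T z * (S.ε * S.m)) ≤ S.deg T z * (S.ε * S.m) :=
        mul_le_of_le_one_left (by positivity) hd1
      rw [Finset.filter_inter]
      linarith
    · simpa using hI.sizeR z hz
  · have hsub : S.viol (Insert.insert w T) (Function.update f w u) o ⊆ S.viol T f o ∪
        ({z | S.H.Adj z w ∧ S.q z = o} : Finset α).biUnion fun z =>
          ({z} ×ˢ S.heavy T f u z) ∪ (S.heavy T f u z ×ˢ {z}) := by
      rintro ⟨a, b⟩ hab
      simp only [viol, Finset.mem_filter, Finset.mem_univ, true_and] at hab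
      obtain ⟨ha, hb, hn, hlt⟩ := hab
      by_contra hcon
      simp only [viol, Finset.mem_union, Finset.mem_filter, Finset.mem_univ, true_and,
        Finset.mem_biUnion, Finset.mem_product, Finset.mem_singleton, not_or, not_exists,
        not_and, ha, hb, not_lt] at hcon
      obtain ⟨hc1, hc2⟩ := hcon
      have hc1' := hc1 hn
      rw [deg_insert hw, deg_insert hw, cand_insert hw, cand_insert hw] at hlt
      have hbound : S.d * ((S.deg T a + S.deg T b : ℕ) * (S.ε * S.m)) ≤
          (S.deg T a + S.deg T b : ℕ) * (S.ε * S.m) :=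
        mul_le_of_le_one_left (by positivity) hd1
      have h3 := mul_le_mul_of_nonneg_left hc1' hd0.le
      by_cases h1 : S.H.Adj a w
      · have h2 : ¬ S.H.Adj b w := hn w h1
        have h4 := (hc2 a ⟨h1, ha⟩).1 rfl
        simp only [heavy, Finset.mem_filter, Finset.mem_univ, true_and, ha, hb, not_lt] at h4
        rw [if_pos h1, if_pos h1, if_neg h2, if_neg h2, Finset.filter_inter] at hlt
        have : S.d ^ (S.deg T a + 1 + (S.deg T b + 0)) =
          S.d * S.d ^ (S.deg T a + S.deg T b) := by ring
        rw [this] at hlt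
        push_cast at hlt hbound h3
        linarith
      · by_cases h2 : S.H.Adj b w
        · have h5 : a ∉ S.heavy T f u b := fun h => (hc2 b ⟨h2, hb⟩).2 h rfl
          simp only [heavy, Finset.mem_filter, Finset.mem_univ, true_and, ha, hb, not_lt] at h5
          rw [if_neg h1, if_neg h1, if_pos h2, if_pos h2, Finset.inter_comm,
            Finset.filter_inter] at hlt
          have : S.d ^ (S.deg T a + 0 + (S.deg T b + 1)) =
            S.d * S.d ^ (S.deg T a + S.deg T b) := by ring
          rw [this] at hlt
          rw [Finset.inter_comm (S.cand T f a)] at h3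
          push_cast at hlt hbound h3
          linarith
        · rw [if_neg h1, if_neg h1, if_neg h2, if_neg h2] at hlt
          simp only [add_zero] at hlt
          exact absurd hlt (not_lt.2 hc1')
    have hcard : (#(({z | S.H.Adj z w ∧ S.q z = o} : Finset α).biUnion fun z =>
          ({z} ×ˢ S.heavy T f u z) ∪ (S.heavy T f u z ×ˢ {z})) : ℝ) ≤
        ∑ z with S.H.Adj z w ∧ S.q z = o, 2 * (S.σ * S.m) := by
      refine (Nat.cast_le.2 Finset.card_biUnion_le).trans ?_
      push_cast
      refine Finset.sum_le_sum fun z hz => ?_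
      simp only [Finset.mem_filter, Finset.mem_univ, true_and] at hz
      refine (Nat.cast_le.2 (Finset.card_union_le _ _)).trans ?_
      have := (hu z hz.1 (hz.2 ▸ ho)).2.2
      rw [Finset.card_product, Finset.card_product, Finset.card_singleton]
      push_cast
      linarith
    have hsum : ∑ z with S.q z = o, (S.deg (Insert.insert w T) z : ℝ) =
        ∑ z with S.q z = o, (S.deg T z : ℝ) + #{z | S.H.Adj z w ∧ S.q z = o} := by
      simp only [deg_insert hw]
      push_cast
      rw [Finset.sum_add_distrib, ← Finset.sum_filter, Finset.filter_filter]
      simp [and_comm]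
    have h1 := (Nat.cast_le (α := ℝ)).2
      ((Finset.card_le_card hsub).trans (Finset.card_union_le _ _))
    rw [Finset.sum_const, nsmul_eq_mul] at hcard
    push_cast at h1
    rw [hsum]
    have := hI.pairs o ho
    nlinarith

end Frame

/-- Second moment bound for how far the sets `C y` deviate from expected densities `p y`
on a set `W`. -/
lemma sq_sum_deficit_le {α β : Type*} [DecidableEq β] {V W : Finset β} (hW : W ⊆ V)
    (Y : Finset α) (C : α → Finset β) (hC : ∀ y ∈ Y, C y ⊆ V) (p : α → ℝ) :
    (∑ y ∈ Y, (p y * #W - #(C y ∩ W))) ^ 2 ≤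
      #W * ∑ y ∈ Y, ∑ y' ∈ Y,
        (p y * p y' * #V - p y * #(C y') - p y' * #(C y) + #(C y ∩ C y')) := by
  let g : β → ℝ := fun v => ∑ y ∈ Y, (p y - if v ∈ C y then 1 else 0)
  have h1 : ∑ y ∈ Y, (p y * #W - #(C y ∩ W)) = ∑ v ∈ W, g v := by
    simp only [g]
    rw [Finset.sum_comm]
    refine Finset.sum_congr rfl fun y _ => ?_
    rw [Finset.sum_sub_distrib, Finset.sum_const, nsmul_eq_mul, Finset.sum_boole, mul_comm,
      Finset.inter_comm, Finset.filter_mem_eq_inter]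
  have h2 : ∑ v ∈ V, g v ^ 2 = ∑ y ∈ Y, ∑ y' ∈ Y,
        (p y * p y' * #V - p y * #(C y') - p y' * #(C y) + #(C y ∩ C y')) := by
    simp only [g, sq, Finset.sum_mul_sum]
    rw [Finset.sum_comm]
    refine Finset.sum_congr rfl fun y hy => ?_
    rw [Finset.sum_comm]
    refine Finset.sum_congr rfl fun y' hy' => ?_
    have e : ∀ v, (p y - if v ∈ C y then 1 else 0) * (p y' - if v ∈ C y' then 1 else 0) =
        p y * p y' - p y * (if v ∈ C y' then 1 else 0) - p y' * (if v ∈ C y then 1 else 0) +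
          if v ∈ C y ∩ C y' then 1 else 0 := by
      intro v
      by_cases h : v ∈ C y <;> by_cases h' : v ∈ C y' <;> simp [h, h'] <;> ring
    simp only [e, Finset.sum_add_distrib, Finset.sum_sub_distrib, ← Finset.mul_sum,
      Finset.sum_boole, Finset.sum_const, nsmul_eq_mul, Finset.filter_mem_eq_inter]
    rw [Finset.inter_eq_right.2 (hC y hy), Finset.inter_eq_right.2 (hC y' hy'),
      Finset.inter_eq_right.2 (Finset.inter_subset_left.trans (hC y hy))]
    ring
  rw [h1, ← h2]
  refine (sq_sum_le_card_mul_sum_sq (s := W) (f := g)).trans ?_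
  gcongr

namespace Frame

variable {S : Frame α β ι}

lemma card_common_le {o : Option ι} (ho : o ≠ none) :
    #({ab : α × α | S.q ab.1 = o ∧ ∃ w, S.H.Adj ab.1 w ∧ S.H.Adj ab.2 w} : Finset (α × α)) ≤
      S.m * (S.Δ * S.Δ) := by
  have hsub : ({ab : α × α | S.q ab.1 = o ∧ ∃ w, S.H.Adj ab.1 w ∧ S.H.Adj ab.2 w} :
      Finset (α × α)) ⊆ ({a | S.q a = o} : Finset α).biUnion fun a =>
        ({w | S.H.Adj a w} : Finset α).biUnion fun w =>
          {a} ×ˢ ({b | S.H.Adj w b} : Finset α) := by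
    rintro ⟨a, b⟩ h
    simp only [Finset.mem_filter, Finset.mem_univ, true_and] at h
    obtain ⟨h1, w, h2, h3⟩ := h
    simp only [Finset.mem_biUnion, Finset.mem_filter, Finset.mem_univ, true_and,
      Finset.mem_product, Finset.mem_singleton]
    exact ⟨a, h1, w, h2, rfl, h3.symm⟩
  refine (Finset.card_le_card hsub).trans ?_
  rw [← S.card_L o ho]
  refine Finset.card_biUnion_le_card_mul _ _ _ fun a _ => ?_
  refine (Finset.card_biUnion_le_card_mul _ _ S.Δ fun w _ => ?_).trans
    (Nat.mul_le_mul_right _ (S.deg_le a))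
  rw [Finset.card_product, Finset.card_singleton, one_mul]
  exact S.deg_le w

lemma Inv.card_le_of_poor {T : Finset α} {f : α → β} (hI : S.Inv T f) {o : Option ι}
    (ho : o ≠ none) {ω κ τ : ℝ} (hω0 : 0 < ω) (hτ : 0 < τ) {W : Finset β}
    (hW : ∀ v ∈ W, S.p v = o) (hω : ω * S.m ≤ #W) (hκ : κ ≤ S.d ^ S.Δ * ω / 4)
    (hmom : 4 * S.Δ * S.ε + 4 * S.Δ * S.σ + 2 * S.Δ ^ 2 / S.m <
      (τ * (3 / 4 * (S.d ^ S.Δ * ω))) ^ 2)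
    {Y : Finset α} (hY : ∀ z ∈ Y, S.q z = o ∧ (#(S.cand T f z ∩ W) : ℝ) ≤ κ * S.m) :
    (#Y : ℝ) ≤ τ * S.m := by
  have hm : (0 : ℝ) < S.m := by exact_mod_cast S.m_pos
  have hd0 := S.d_pos
  have hd1 := S.d_le_one
  have hε := S.ε_pos
  have hσ := S.σ_pos
  by_contra! hlt
  set V : Finset β := Finset.univ.filter fun v => S.p v = o with hV
  have hVm : #V = S.m := S.card_V o ho
  have hWV : W ⊆ V := fun v hv => by simp [hV, hW v hv]
  have hWm : #W ≤ S.m := hVm ▸ Finset.card_le_card hWV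
  have hCV : ∀ y ∈ Y, S.cand T f y ⊆ V := fun y hy v hv => by
    simp [hV, (mem_cand.1 hv).1, (hY y hy).1]
  have hYm : #Y ≤ S.m := by
    rw [← S.card_L o ho]
    exact Finset.card_le_card fun z hz => by simp [(hY z hz).1]
  have key := sq_sum_deficit_le hWV Y (S.cand T f) hCV fun y => S.d ^ S.deg T y
  have hpow : ∀ y, S.d ^ S.Δ ≤ S.d ^ S.deg T y := fun y =>
    pow_le_pow_of_le_one hd0.le hd1 (deg_le_max T y)
  have hpow1 : ∀ y, S.d ^ S.deg T y ≤ 1 := fun y => pow_le_one₀ hd0.le hd1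
  have hdeg : ∀ y, (S.deg T y : ℝ) ≤ S.Δ := fun y => by exact_mod_cast deg_le_max T y
  set A : ℝ := 3 / 4 * (S.d ^ S.Δ * ω) with hA
  have hA0 : 0 < A := by positivity
  have hlow : #Y * (A * S.m) ≤ ∑ y ∈ Y, (S.d ^ S.deg T y * #W - #(S.cand T f y ∩ W)) := by
    rw [← nsmul_eq_mul]
    refine Finset.card_nsmul_le_sum _ _ _ fun y hy => ?_
    have h1 := (hY y hy).2
    have h2 : S.d ^ S.Δ * (ω * S.m) ≤ S.d ^ S.deg T y * #W := by
      have := hpow y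
      gcongr
    have h3 := mul_le_mul_of_nonneg_right hκ hm.le
    rw [hA]
    linarith
  let Bad : Finset (α × α) := S.viol T f o ∪
    ({ab : α × α | S.q ab.1 = o ∧ ∃ w, S.H.Adj ab.1 w ∧ S.H.Adj ab.2 w} : Finset (α × α))
  have hBad : (#Bad : ℝ) ≤ 2 * (S.σ * S.m) * (S.m * S.Δ) + S.m * (S.Δ * S.Δ) := by
    refine (Nat.cast_le.2 (Finset.card_union_le _ _)).trans ?_
    push_cast
    refine add_le_add ((hI.pairs o ho).trans ?_) (by exact_mod_cast card_common_le ho)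
    refine mul_le_mul_of_nonneg_left ?_ (by positivity)
    rw [← S.card_L o ho, ← nsmul_eq_mul]
    exact Finset.sum_le_card_nsmul _ _ _ fun z _ => hdeg z
  have hterm : ∀ y ∈ Y, ∀ y' ∈ Y,
      (S.d ^ S.deg T y * S.d ^ S.deg T y' * #V - S.d ^ S.deg T y * #(S.cand T f y') -
        S.d ^ S.deg T y' * #(S.cand T f y) + #(S.cand T f y ∩ S.cand T f y')) ≤
      4 * S.Δ * (S.ε * S.m) + 2 * S.m * (if (y, y') ∈ Bad then 1 else 0) := by
    intro y hy y' hy'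
    have hp := pow_pos hd0 (S.deg T y)
    have hp' := pow_pos hd0 (S.deg T y')
    have hεm := mul_pos hε hm
    rw [hVm]
    split_ifs with hb
    · have h1 : (#(S.cand T f y ∩ S.cand T f y') : ℝ) ≤ S.m := by
        rw [← hVm]
        exact_mod_cast Finset.card_le_card (Finset.inter_subset_left.trans (hCV y hy))
      have h2 : S.d ^ S.deg T y * S.d ^ S.deg T y' * S.m ≤ S.m :=
        mul_le_of_le_one_left hm.le (mul_le_one₀ (hpow1 y) hp'.le (hpow1 y'))
      have h3 : (0 : ℝ) ≤ S.d ^ S.deg T y * #(S.cand T f y') := by positivity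
      have h4 : (0 : ℝ) ≤ S.d ^ S.deg T y' * #(S.cand T f y) := by positivity
      have h5 : 0 ≤ 4 * S.Δ * (S.ε * S.m) := by positivity
      linarith
    · simp only [Bad, viol, Finset.mem_union, Finset.mem_filter, Finset.mem_univ, true_and,
        (hY y hy).1, (hY y' hy').1, not_or, not_and, not_exists, not_lt] at hb
      have h1 := hb.1 fun w hw => hb.2 w hw
      have h2 := mul_le_mul_of_nonneg_left (hI.size y ((hY y hy).1 ▸ ho)) hp'.le
      have h3 := mul_le_mul_of_nonneg_left (hI.size y' ((hY y' hy').1 ▸ ho)) hp.le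
      have h4 : S.d ^ S.deg T y' * (S.deg T y * (S.ε * S.m)) ≤ S.Δ * (S.ε * S.m) :=
        (mul_le_of_le_one_left (by positivity) (hpow1 y')).trans (by
          have := hdeg y; gcongr)
      have h5 : S.d ^ S.deg T y * (S.deg T y' * (S.ε * S.m)) ≤ S.Δ * (S.ε * S.m) :=
        (mul_le_of_le_one_left (by positivity) (hpow1 y)).trans (by
          have := hdeg y'; gcongr)
      have h6 : S.deg T y * (S.ε * S.m) ≤ S.Δ * (S.ε * S.m) := by
        have := hdeg y; gcongr
      have h7 : S.deg T y' * (S.ε * S.m) ≤ S.Δ * (S.ε * S.m) := by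
        have := hdeg y'; gcongr
      rw [pow_add] at h1
      push_cast at h1
      linarith
  have hsum : ∑ y ∈ Y, ∑ y' ∈ Y,
      (S.d ^ S.deg T y * S.d ^ S.deg T y' * #V - S.d ^ S.deg T y * #(S.cand T f y') -
        S.d ^ S.deg T y' * #(S.cand T f y) + #(S.cand T f y ∩ S.cand T f y')) ≤
      S.m * S.m * (4 * S.Δ * (S.ε * S.m)) + 2 * S.m * #Bad := by
    refine (Finset.sum_le_sum fun y hy => Finset.sum_le_sum fun y' hy' =>
      hterm y hy y' hy').trans ?_
    simp only [Finset.sum_add_distrib, ← Finset.mul_sum, Finset.sum_const, nsmul_eq_mul]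
    refine add_le_add ?_ ?_
    · have : (#Y : ℝ) ≤ S.m := by exact_mod_cast hYm
      have h0 : 0 ≤ 4 * S.Δ * (S.ε * S.m) := by positivity
      have := mul_le_mul_of_nonneg_right (mul_le_mul this this (by positivity) hm.le) h0
      linarith
    · rw [← Finset.sum_product' (f := fun y y' => if (y, y') ∈ Bad then (1 : ℝ) else 0),
        Finset.sum_boole]
      refine mul_le_mul_of_nonneg_left ?_ (by positivity)
      exact_mod_cast Finset.card_le_card fun ab hab => (Finset.mem_filter.1 hab).2
  have h1 : (#Y * (A * S.m)) ^ 2 ≤ S.m * (S.m * S.m * (4 * S.Δ * (S.ε * S.m)) +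
      2 * S.m * (2 * (S.σ * S.m) * (S.m * S.Δ) + S.m * (S.Δ * S.Δ))) := by
    refine (pow_le_pow_left₀ (by positivity) hlow 2).trans (key.trans ?_)
    refine (mul_le_mul_of_nonneg_left hsum (Nat.cast_nonneg _)).trans ?_
    have : (#W : ℝ) ≤ S.m := by exact_mod_cast hWm
    gcongr
  have h2 : (τ * S.m * (A * S.m)) ^ 2 ≤ (#Y * (A * S.m)) ^ 2 := by gcongr
  have h3 : (τ * S.m * (A * S.m)) ^ 2 = (τ * A) ^ 2 * (S.m : ℝ) ^ 4 := by ring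
  have h4 : S.m * (S.m * S.m * (4 * S.Δ * (S.ε * S.m)) +
      2 * S.m * (2 * (S.σ * S.m) * (S.m * S.Δ) + S.m * (S.Δ * S.Δ))) =
      (4 * S.Δ * S.ε + 4 * S.Δ * S.σ + 2 * S.Δ ^ 2 / S.m) * (S.m : ℝ) ^ 4 := by
    field_simp
    ring
  have h5 := (mul_lt_mul_iff_left₀ (pow_pos hm 4)).2 hmom
  linarith

/-- Numerical conditions under which single vertices can be embedded greedily. -/
structure Fine (S : Frame α β ι) (δ ω κ τ : ℝ) : Prop where
  ω_pos : 0 < ω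
  κ_pos : 0 < κ
  τ_pos : 0 < τ
  ω_le : ω ≤ δ / 2
  κ_le : κ ≤ S.d ^ S.Δ * ω / 4
  κ_add_le : κ + τ + S.Δ * S.ε ≤ S.d ^ S.Δ * (δ / 4)
  τ_add_le : τ + τ + S.Δ * S.ε ≤ S.d ^ S.Δ * (δ / 4)
  le_r : δ / 4 * S.m ≤ S.r
  r_le : S.r ≤ δ / 2 * S.m
  bad_lt : S.Δ * (2 * S.ε + S.σ) < κ
  moment : 4 * S.Δ * S.ε + 4 * S.Δ * S.σ + 2 * S.Δ ^ 2 / S.m <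
    (τ * (3 / 4 * (S.d ^ S.Δ * ω))) ^ 2

/-- `f` embeds the part of the guest graph induced by `T ∪ X`; a vertex of `T` goes to a reserved
vertex only if it has few other candidates. -/
structure Valid (S : Frame α β ι) (X : Finset α) (κ : ℝ) (T : Finset α) (f : α → β) : Prop where
  disj : Disjoint T X
  inj : Set.InjOn f ↑(T ∪ X)
  ne_none : ∀ w ∈ T, S.q w ≠ none
  cluster : ∀ w ∈ T ∪ X, S.p (f w) = S.q w
  edge : ∀ y ∈ T ∪ X, ∀ z ∈ T ∪ X, S.H.Adj y z → S.G.Adj (f y) (f z)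
  not_mem_R : ∀ x ∈ X, f x ∉ S.R
  poor : ∀ w ∈ T, f w ∈ S.R →
    (#(S.cand T f w \ ((T ∪ X).image f ∪ S.R)) : ℝ) ≤ κ * S.m

variable {X T : Finset α} {f : α → β} {δ ω κ τ : ℝ}

lemma Valid.insert (hV : S.Valid X κ T f) {w : α} (hw : w ∉ T ∪ X) (hqw : S.q w ≠ none)
    {u : β} (hp : S.p u = S.q w) (hu : u ∉ (T ∪ X).image f)
    (hadj : ∀ y ∈ T ∪ X, S.H.Adj w y → S.G.Adj (f y) u)
    (hpoor : u ∈ S.R → (#(S.cand T f w \ ((T ∪ X).image f ∪ S.R)) : ℝ) ≤ κ * S.m) :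
    S.Valid X κ (insert w T) (Function.update f w u) := by
  have hwT : w ∉ T := fun h => hw (Finset.mem_union_left _ h)
  have hwX : w ∉ X := fun h => hw (Finset.mem_union_right _ h)
  have key : ∀ y ∈ T ∪ X, Function.update f w u y = f y := fun y hy =>
    Function.update_of_ne (by rintro rfl; exact hw hy) _ _
  have himg : ((Insert.insert w T) ∪ X).image (Function.update f w u) =
      Insert.insert u ((T ∪ X).image f) := by
    rw [Finset.insert_union, Finset.image_insert, Function.update_self,
      Finset.image_congr (g := f) fun y hy => key y hy]
  refine ⟨?_, ?_, ?_, ?_, ?_, ?_, ?_⟩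
  · rw [Finset.disjoint_insert_left]
    exact ⟨hwX, hV.disj⟩
  · rw [Finset.insert_union, Finset.coe_insert, Set.injOn_insert (by exact_mod_cast hw)]
    refine ⟨hV.inj.congr fun y hy => (key y hy).symm, ?_⟩
    rw [Function.update_self, Set.image_congr (g := f) fun y hy => key y hy]
    exact_mod_cast hu
  · intro y hy
    rcases Finset.mem_insert.1 hy with rfl | hy
    · exact hqw
    · exact hV.ne_none y hy
  · intro y hy
    rw [Finset.insert_union] at hy
    rcases Finset.mem_insert.1 hy with rfl | hy
    · rwa [Function.update_self]
    · rw [key y hy]; exact hV.cluster y hy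
  · intro y hy z hz hyz
    rw [Finset.insert_union] at hy hz
    rcases Finset.mem_insert.1 hy with hyw | hy
    · rcases Finset.mem_insert.1 hz with hzw | hz
      · rw [hyw, hzw] at hyz
        exact absurd hyz (S.H.loopless.irrefl _)
      · rw [hyw] at hyz
        rw [hyw, Function.update_self, key z hz]
        exact (hadj z hz hyz).symm
    · rcases Finset.mem_insert.1 hz with hzw | hz
      · rw [hzw] at hyz
        rw [hzw, Function.update_self, key y hy]
        exact hadj y hy hyz.symm
      · rw [key y hy, key z hz]
        exact hV.edge y hy z hz hyz
  · intro x hx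
    rw [key x (Finset.mem_union_right _ hx)]
    exact hV.not_mem_R x hx
  · intro y hy hyR
    rw [himg, cand_insert hwT]
    rcases Finset.mem_insert.1 hy with rfl | hy
    · rw [Function.update_self] at hyR
      rw [if_neg (S.H.loopless.irrefl _)]
      refine le_trans ?_ (hpoor hyR)
      norm_cast
      gcongr
      exact Finset.subset_insert _ _
    · rw [key y (Finset.mem_union_left _ hy)] at hyR
      refine le_trans ?_ (hV.poor y hy hyR)
      norm_cast
      refine Finset.card_le_card (Finset.sdiff_subset_sdiff ?_ ?_)
      · split_ifs
        · exact Finset.filter_subset _ _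
        · exact subset_rfl
      · gcongr
        exact Finset.subset_insert _ _

lemma Valid.card_used_le (hV : S.Valid X κ T f) (o : Option ι) :
    #{u ∈ (T ∪ X).image f | S.p u = o} ≤ #{y ∈ T ∪ X | S.q y = o} := by
  refine le_trans (Finset.card_le_card ?_) (Finset.card_image_le (f := f))
  intro u hu
  simp only [Finset.mem_filter, Finset.mem_image] at hu ⊢
  obtain ⟨⟨y, hy, rfl⟩, hu⟩ := hu
  exact ⟨y, ⟨hy, (hV.cluster y hy).symm.trans hu⟩, rfl⟩

lemma Valid.card_used_R_le (hV : S.Valid X κ T f) (hI : S.Inv T f) (hF : S.Fine δ ω κ τ)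
    {o : Option ι} (ho : o ≠ none)
    (hfree : ω * S.m ≤ #{v | S.p v = o ∧ v ∉ (T ∪ X).image f ∪ S.R}) :
    (#{u ∈ (T ∪ X).image f | S.p u = o ∧ u ∈ S.R} : ℝ) ≤ τ * S.m := by
  have h1 : #{u ∈ (T ∪ X).image f | S.p u = o ∧ u ∈ S.R} ≤
      #{w ∈ T | S.q w = o ∧ f w ∈ S.R} := by
    refine le_trans (Finset.card_le_card ?_) (Finset.card_image_le (f := f))
    intro u hu
    simp only [Finset.mem_filter, Finset.mem_image] at hu ⊢
    obtain ⟨⟨y, hy, rfl⟩, hu, huR⟩ := hu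
    refine ⟨y, ⟨?_, (hV.cluster y hy).symm.trans hu, huR⟩, rfl⟩
    rcases Finset.mem_union.1 hy with h | h
    · exact h
    · exact absurd huR (hV.not_mem_R y h)
  refine (Nat.cast_le.2 h1).trans ?_
  refine hI.card_le_of_poor ho hF.ω_pos hF.τ_pos (fun v hv => ?_) hfree hF.κ_le hF.moment ?_
  · exact (Finset.mem_filter.1 hv).2.1
  · intro z hz
    simp only [Finset.mem_filter] at hz
    refine ⟨hz.2.1, le_trans ?_ (hV.poor z hz.1 hz.2.2)⟩
    norm_cast
    refine Finset.card_le_card fun v hv => ?_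
    simp only [Finset.mem_inter, Finset.mem_filter] at hv
    exact Finset.mem_sdiff.2 ⟨hv.1, hv.2.2.2⟩

lemma Valid.le_card_free (hV : S.Valid X κ T f) (hF : S.Fine δ ω κ τ) {D : Finset α}
    (hD : Disjoint (T ∪ X) D) {o : Option ι} (ho : o ≠ none)
    (hDo : δ * S.m ≤ #{x ∈ D | S.q x = o}) :
    ω * S.m ≤ #{v | S.p v = o ∧ v ∉ (T ∪ X).image f ∪ S.R} := by
  have hm : (0 : ℝ) < S.m := by exact_mod_cast S.m_pos
  have h1 : S.m ≤ #{v | S.p v = o ∧ v ∉ (T ∪ X).image f ∪ S.R} +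
      #{u ∈ (T ∪ X).image f | S.p u = o} + S.r := by
    rw [← S.card_R o ho]
    nth_rewrite 1 [← S.card_V o ho]
    refine le_trans (Finset.card_le_card ?_) ((Finset.card_union_le _ _).trans
      (Nat.add_le_add_right (Finset.card_union_le _ _) _))
    intro v hv
    simp only [Finset.mem_filter, Finset.mem_union, Finset.mem_univ, true_and] at hv ⊢
    tauto
  have h2 := hV.card_used_le o
  have h3 : #{y ∈ T ∪ X | S.q y = o} + #{x ∈ D | S.q x = o} ≤ S.m := by
    rw [← S.card_L o ho, ← Finset.card_union_of_disjoint
      (Finset.disjoint_filter_filter hD)]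
    refine Finset.card_le_card fun v hv => ?_
    simp only [Finset.mem_filter, Finset.mem_union, Finset.mem_univ, true_and] at hv ⊢
    tauto
  have h4 : (S.m : ℝ) ≤ #{v | S.p v = o ∧ v ∉ (T ∪ X).image f ∪ S.R} +
    #{u ∈ (T ∪ X).image f | S.p u = o} + S.r := by exact_mod_cast h1
  have h5 : (#{u ∈ (T ∪ X).image f | S.p u = o} : ℝ) + #{x ∈ D | S.q x = o} ≤ S.m := by
    exact_mod_cast (Nat.add_le_add_right h2 _).trans h3
  have h6 := hF.r_le
  have h7 := mul_le_mul_of_nonneg_right hF.ω_le hm.le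
  linarith

/-- Every vertex keeps many reserved free candidates. -/
lemma Valid.le_card_cand_R (hV : S.Valid X κ T f) (hI : S.Inv T f) (hF : S.Fine δ ω κ τ)
    {D : Finset α} (hD : Disjoint (T ∪ X) D) {z : α} (hz : S.q z ≠ none)
    (hDo : δ * S.m ≤ #{x ∈ D | S.q x = S.q z}) :
    S.d ^ S.Δ * (δ / 4) * S.m - S.Δ * S.ε * S.m - τ * S.m ≤
      #((S.cand T f z ∩ S.R) \ (T ∪ X).image f) := by
  have hm : (0 : ℝ) < S.m := by exact_mod_cast S.m_pos
  have hεm := mul_pos S.ε_pos hm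
  have h1 := hV.card_used_R_le hI hF hz (hV.le_card_free hF hD hz hDo)
  have h2 := hI.sizeR z hz
  have h3 : #(S.cand T f z ∩ S.R) ≤ #((S.cand T f z ∩ S.R) \ (T ∪ X).image f) +
      #{u ∈ (T ∪ X).image f | S.p u = S.q z ∧ u ∈ S.R} := by
    refine le_trans (Finset.card_le_card ?_) (Finset.card_union_le _ _)
    intro v hv
    simp only [Finset.mem_filter, Finset.mem_union, Finset.mem_inter, Finset.mem_sdiff] at hv ⊢
    have := (mem_cand.1 hv.1).1
    tauto
  have h3' : (#(S.cand T f z ∩ S.R) : ℝ) ≤ #((S.cand T f z ∩ S.R) \ (T ∪ X).image f) +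
      #{u ∈ (T ∪ X).image f | S.p u = S.q z ∧ u ∈ S.R} := by exact_mod_cast h3
  have h4 : S.d ^ S.Δ * (δ / 4 * S.m) ≤ S.d ^ S.deg T z * S.r := by
    have := pow_le_pow_of_le_one S.d_pos.le S.d_le_one (deg_le_max (S := S) T z)
    have h0 := S.d_pos
    have := hF.le_r
    exact mul_le_mul ‹_› this
      (mul_nonneg (by linarith [hF.ω_pos, hF.ω_le]) hm.le) (by positivity)
  have h5 : (S.deg T z : ℝ) * (S.ε * S.m) ≤ S.Δ * (S.ε * S.m) := by
    have : (S.deg T z : ℝ) ≤ S.Δ := by exact_mod_cast deg_le_max T z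
    gcongr
  linarith

lemma Valid.exists_insert (hV : S.Valid X κ T f) (hI : S.Inv T f) (hF : S.Fine δ ω κ τ)
    {D : Finset α} (hD : Disjoint (T ∪ X) D)
    (hDo : ∀ o, o ≠ none → δ * S.m ≤ #{x ∈ D | S.q x = o}) {w : α} (hw : w ∉ T ∪ X)
    (hqw : S.q w ≠ none) (hwX : ∀ x ∈ X, ¬ S.H.Adj w x) :
    ∃ u, S.Valid X κ (Insert.insert w T) (Function.update f w u) ∧
      S.Inv (Insert.insert w T) (Function.update f w u) := by
  have hm : (0 : ℝ) < S.m := by exact_mod_cast S.m_pos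
  have hwT : w ∉ T := fun h => hw (Finset.mem_union_left _ h)
  obtain ⟨B, hB, hB'⟩ := exists_bad T f hqw
  have hBκ : (#B : ℝ) < κ * S.m := by
    have := mul_lt_mul_of_pos_right hF.bad_lt hm
    linarith
  obtain ⟨P, hP, hPκ, hPR⟩ : ∃ P : Finset β, P ⊆ S.cand T f w \ (T ∪ X).image f ∧
      κ * S.m ≤ #P ∧ ∀ u ∈ P, u ∈ S.R →
        (#(S.cand T f w \ ((T ∪ X).image f ∪ S.R)) : ℝ) ≤ κ * S.m := by
    by_cases h : (#(S.cand T f w \ ((T ∪ X).image f ∪ S.R)) : ℝ) ≤ κ * S.m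
    · refine ⟨(S.cand T f w ∩ S.R) \ (T ∪ X).image f, ?_, ?_, fun _ _ _ => h⟩
      · exact Finset.sdiff_subset_sdiff Finset.inter_subset_left subset_rfl
      · have h1 := hV.le_card_cand_R hI hF hD hqw (hDo _ hqw)
        have h2 := mul_le_mul_of_nonneg_right hF.κ_add_le hm.le
        linarith
    · refine ⟨S.cand T f w \ ((T ∪ X).image f ∪ S.R), ?_, (not_le.1 h).le, ?_⟩
      · exact Finset.sdiff_subset_sdiff subset_rfl Finset.subset_union_left
      · intro u hu huR
        exact absurd (Finset.mem_union_right _ huR) (Finset.mem_sdiff.1 hu).2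
  obtain ⟨u, huP, huB⟩ : ∃ u ∈ P, u ∉ B := by
    have : #B < #P := by exact_mod_cast hBκ.trans_le hPκ
    exact Finset.exists_mem_notMem_of_card_lt_card this
  have hu := Finset.mem_sdiff.1 (hP huP)
  have huc := mem_cand.1 hu.1
  refine ⟨u, hV.insert hw hqw huc.1 hu.2 ?_ (hPR u huP), hI.insert hwT (hB' u huB huc.1)⟩
  intro y hy hwy
  rcases Finset.mem_union.1 hy with h | h
  · exact huc.2 y h hwy
  · exact absurd hwy (hwX y h)

/-- Once all neighbours of `X` are embedded, everything outside a set `D` can be embedded. -/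
lemma Valid.exists_extend (hV : S.Valid X κ T f) (hI : S.Inv T f) (hF : S.Fine δ ω κ τ)
    {D : Finset α} (hD : Disjoint (T ∪ X) D)
    (hDo : ∀ o, o ≠ none → δ * S.m ≤ #{x ∈ D | S.q x = o})
    (hnone : ∀ w, S.q w = none → w ∈ X) (hX : ∀ x ∈ X, ∀ y, S.H.Adj x y → y ∈ T) :
    ∃ g, S.Valid X κ (Finset.univ \ (X ∪ D)) g ∧ S.Inv (Finset.univ \ (X ∪ D)) g ∧
      ∀ y ∈ T ∪ X, g y = f y := by
  induction h : #(Finset.univ \ (X ∪ D ∪ T)) generalizing T f with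
  | zero =>
    have hT : T = Finset.univ \ (X ∪ D) := by
      rw [Finset.card_eq_zero, Finset.sdiff_eq_empty_iff_subset] at h
      ext y
      have h1 := h (Finset.mem_univ y)
      have h2 : y ∈ T → y ∉ X := fun a b => Finset.disjoint_left.1 hV.disj a b
      have h3 : y ∈ T → y ∉ D := fun a b =>
        Finset.disjoint_left.1 hD (Finset.mem_union_left _ a) b
      simp only [Finset.mem_union, Finset.mem_sdiff, Finset.mem_univ, true_and] at h1 ⊢
      tauto
    exact ⟨f, hT ▸ hV, hT ▸ hI, fun _ _ => rfl⟩
  | succ n ih =>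
    obtain ⟨w, hw⟩ := Finset.card_pos.1 (h.symm ▸ Nat.succ_pos n :
      0 < #(Finset.univ \ (X ∪ D ∪ T)))
    simp only [Finset.mem_union, Finset.mem_sdiff, Finset.mem_univ, true_and, not_or] at hw
    obtain ⟨⟨hwX, hwD⟩, hwT⟩ := hw
    have hwTX : w ∉ T ∪ X := by simp [hwX, hwT]
    obtain ⟨u, hV', hI'⟩ := hV.exists_insert hI hF hD hDo hwTX
      (fun hq => hwX (hnone w hq)) fun x hx hwx => hwT (hX x hx w hwx.symm)
    have hD' : Disjoint (Insert.insert w T ∪ X) D := by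
      rw [Finset.insert_union, Finset.disjoint_insert_left]
      exact ⟨hwD, hD⟩
    obtain ⟨g, hg1, hg2, hg3⟩ := ih hV' hI' hD'
      (fun x hx y hxy => Finset.mem_insert_of_mem (hX x hx y hxy)) (by
        rw [Finset.union_insert, ← Finset.erase_eq_of_notMem
          (a := w) (s := Finset.univ \ Insert.insert w (X ∪ D ∪ T)) (by simp),
          Finset.sdiff_insert, Finset.erase_idem, Finset.card_erase_of_mem (by
            simp [hwX, hwD, hwT]), h]
        rfl)
    refine ⟨g, hg1, hg2, fun y hy => ?_⟩
    rw [hg3 y (by rw [Finset.insert_union]; exact Finset.mem_insert_of_mem hy),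
      Function.update_of_ne (by rintro rfl; exact hwTX hy)]

end Frame

namespace Frame

variable {S : Frame α β ι} {X T : Finset α} {f : α → β} {κ : ℝ}

/-- For a small set `A` of forbidden vertices, most neighbours of `v` that are candidates of `y`
are typical towards the further vertices in `B`. -/
lemma le_card_good {y : α} (hy : S.q y ≠ none) {B : Finset α} (hB : ∀ z ∈ B, S.q z ≠ none)
    (C : α → Finset β) (hC : ∀ z ∈ B, ∀ v ∈ C z, S.p v = S.q z) (A P : Finset β)
    (hP : ∀ u ∈ P, S.p u = S.q y) :
    (#P : ℝ) - #A - S.Δ * (S.ε * S.m) ≤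
      #{u ∈ P \ A | ∀ z ∈ B, S.H.Adj y z →
        S.d * #(C z) - S.ε * S.m ≤ (#{v ∈ C z | S.G.Adj u v} : ℝ)} := by
  set Q : Finset β := {u ∈ P \ A | ∀ z ∈ B, S.H.Adj y z →
        S.d * #(C z) - S.ε * S.m ≤ (#{v ∈ C z | S.G.Adj u v} : ℝ)} with hQ
  have hεm : 0 ≤ S.ε * S.m := mul_nonneg S.ε_pos.le (Nat.cast_nonneg _)
  let N : Finset α := B.filter fun z => S.H.Adj y z
  have hN : #N ≤ S.Δ := (Finset.card_le_card (Finset.filter_subset_filter _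
    (Finset.subset_univ B))).trans (S.deg_le y)
  let E : α → Finset β := fun z => Finset.univ.filter fun u => S.p u = S.q y ∧
    (#{v ∈ C z | S.G.Adj u v} : ℝ) < S.d * #(C z) - S.ε * S.m
  have hsub : P ⊆ (Q ∪ A) ∪ N.biUnion E := by
    intro u hu
    by_contra hcon
    simp only [hQ, N, E, Finset.mem_union, Finset.mem_filter, Finset.mem_sdiff,
      Finset.mem_biUnion, Finset.mem_univ, true_and, not_or, not_exists, not_and, hu, hP u hu,
      not_lt] at hcon
    exact hcon.1.1 hcon.1.2 fun z hz hyz => hcon.2 z ⟨hz, hyz⟩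
  have h1 : #P ≤ #Q + #A + ∑ z ∈ N, #(E z) :=
    (Finset.card_le_card hsub).trans ((Finset.card_union_le _ _).trans
      (Nat.add_le_add (Finset.card_union_le _ _) Finset.card_biUnion_le))
  have h2 : (∑ z ∈ N, (#(E z) : ℝ)) ≤ S.Δ * (S.ε * S.m) := by
    refine (Finset.sum_le_card_nsmul N _ (S.ε * S.m) fun z hz => ?_).trans ?_
    · obtain ⟨hz, hyz⟩ := Finset.mem_filter.1 hz
      exact S.reg_low y z hyz hy (hB z hz) (C z) (hC z hz)
    · rw [nsmul_eq_mul]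
      exact mul_le_mul_of_nonneg_right (by exact_mod_cast hN) hεm
  have h3 : (#P : ℝ) ≤ #Q + #A + ∑ z ∈ N, (#(E z) : ℝ) := by exact_mod_cast h1
  linarith

/-- Embedding the vertices of `B` one after the other such that a constant proportion of the
weight of `Y` remains adjacent to all their images. -/
lemma Valid.exists_union_of_alive {x : α} {U : Finset β} (hUR : Disjoint U S.R) {ζ : ℝ}
    (hζ0 : 0 < ζ)
    (hζ : ζ + S.Δ * (4 * S.ε + S.σ) + S.Δ / S.m ≤ S.d ^ S.Δ * (S.d / 2)) {wt : β → ℝ}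
    (hwt : ∀ v, 0 ≤ wt v) (B : Finset α) :
    ∀ (T : Finset α) (f : α → β) (Y : Finset β), S.Valid X κ T f → S.Inv T f →
    Disjoint (T ∪ X) B → (∀ y ∈ B, S.q y ≠ none) →
    (∀ y ∈ B, ∀ z ∈ X, S.H.Adj y z → z = x) → (x ∈ X → ∀ v ∈ Y, v = f x) →
    #(U ∩ (T ∪ X).image f) + #B ≤ S.Δ →
    (∀ v ∈ Y, ∀ y ∈ B, S.d ^ S.deg T y * (S.d / 2 * S.m) - S.deg T y * (S.ε * S.m) ≤
      (#{u ∈ U ∩ S.cand T f y | S.G.Adj v u} : ℝ)) → 0 < ∑ v ∈ Y, wt v →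
    ∃ g, S.Valid X κ (T ∪ B) g ∧ S.Inv (T ∪ B) g ∧ (∀ z ∈ T ∪ X, g z = f z) ∧
      ζ ^ #B * ∑ v ∈ Y, wt v ≤ ∑ v ∈ Y with ∀ y ∈ B, S.G.Adj v (g y), wt v := by
  induction B using Finset.induction_on with
  | empty =>
    intro T f Y hV hI _ _ _ _ _ _ _
    exact ⟨f, by simpa using hV, by simpa using hI, fun _ _ => rfl, by simp⟩
  | insert y B hyB ih =>
    intro T f Y hV hI hdisj hq hX hx hused halive hpos
    have hm : (0 : ℝ) < S.m := by exact_mod_cast S.m_pos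
    have hεm := mul_pos S.ε_pos hm
    have hd0 := S.d_pos
    rw [Finset.disjoint_insert_right] at hdisj
    obtain ⟨hyTX, hdisj⟩ := hdisj
    have hyT : y ∉ T := fun h => hyTX (Finset.mem_union_left _ h)
    have hyX : y ∉ X := fun h => hyTX (Finset.mem_union_right _ h)
    have hqy := hq y (Finset.mem_insert_self _ _)
    obtain ⟨Bd, hBd, hBd'⟩ := exists_bad T f hqy
    rw [Finset.card_insert_of_notMem hyB] at hused
    let A : Finset β := (U ∩ (T ∪ X).image f) ∪ Bd
    have hA : (#A : ℝ) ≤ S.Δ + S.Δ * ((2 * S.ε + S.σ) * S.m) := by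
      refine (Nat.cast_le.2 (Finset.card_union_le _ _)).trans ?_
      push_cast
      refine add_le_add ?_ hBd
      exact_mod_cast (by omega : #(U ∩ (T ∪ X).image f) ≤ S.Δ)
    let C : β → α → Finset β := fun v z => {u ∈ U ∩ S.cand T f z | S.G.Adj v u}
    have hC : ∀ v z, ∀ u ∈ C v z, S.p u = S.q z := fun v z u hu =>
      (mem_cand.1 (Finset.mem_inter.1 (Finset.mem_filter.1 hu).1).2).1
    let good : β → Finset β := fun v => {u ∈ C v y \ A | ∀ z ∈ B, S.H.Adj y z →
        S.d * #(C v z) - S.ε * S.m ≤ (#{v' ∈ C v z | S.G.Adj u v'} : ℝ)}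
    have hgood : ∀ v ∈ Y, ζ * S.m ≤ #(good v) := by
      intro v hv
      have h1 := le_card_good hqy (fun z hz => hq z (Finset.mem_insert_of_mem hz)) (C v)
        (fun z _ => hC v z) A (C v y) (hC v y)
      have h2 := halive v hv y (Finset.mem_insert_self _ _)
      have h3 : S.d ^ S.Δ * (S.d / 2 * S.m) ≤ S.d ^ S.deg T y * (S.d / 2 * S.m) :=
        mul_le_mul_of_nonneg_right
          (pow_le_pow_of_le_one hd0.le S.d_le_one (deg_le_max T y)) (by positivity)
      have h4 : (S.deg T y : ℝ) * (S.ε * S.m) ≤ S.Δ * (S.ε * S.m) :=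
        mul_le_mul_of_nonneg_right (by exact_mod_cast deg_le_max T y) hεm.le
      have h5 := mul_le_mul_of_nonneg_right hζ hm.le
      have h6 : (S.Δ / S.m : ℝ) * S.m = S.Δ := div_mul_cancel₀ _ hm.ne'
      change (_ : ℝ) ≤ #(C v y) at h2
      rw [add_mul, h6] at h5
      linarith
    let Vy : Finset β := Finset.univ.filter fun u => S.p u = S.q y
    have hVy : #Vy = S.m := S.card_V _ hqy
    have hgV : ∀ v, good v ⊆ Vy := fun v u hu => by
      have := hC v y u (Finset.mem_sdiff.1 (Finset.mem_filter.1 hu).1).1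
      simp [Vy, this]
    obtain ⟨u, huV, hu⟩ : ∃ u ∈ Vy, ζ * ∑ v ∈ Y, wt v ≤ ∑ v ∈ Y with u ∈ good v, wt v := by
      refine Finset.exists_le_of_sum_le (Finset.card_pos.1 (hVy ▸ S.m_pos)) ?_
      rw [Finset.sum_const, hVy, nsmul_eq_mul]
      simp only [Finset.sum_filter]
      rw [Finset.sum_comm, Finset.mul_sum, Finset.mul_sum]
      refine Finset.sum_le_sum fun v hv => ?_
      rw [← Finset.sum_filter, Finset.filter_mem_eq_inter, Finset.inter_eq_right.2 (hgV v),
        Finset.sum_const, nsmul_eq_mul]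
      have := mul_le_mul_of_nonneg_right (hgood v hv) (hwt v)
      linarith
    have hpos' : 0 < ∑ v ∈ Y with u ∈ good v, wt v := (mul_pos hζ0 hpos).trans_le hu
    obtain ⟨v₀, hv₀, -⟩ := Finset.exists_ne_zero_of_sum_ne_zero hpos'.ne'
    have key : ∀ v, u ∈ good v → (u ∈ U ∧ u ∈ S.cand T f y) ∧ S.G.Adj v u ∧ u ∉ A ∧
        ∀ z ∈ B, S.H.Adj y z →
        S.d * #(C v z) - S.ε * S.m ≤ (#{v' ∈ C v z | S.G.Adj u v'} : ℝ) := by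
      intro v hv
      obtain ⟨h1, h2⟩ := Finset.mem_filter.1 hv
      obtain ⟨h3, h4⟩ := Finset.mem_sdiff.1 h1
      obtain ⟨h5, h6⟩ := Finset.mem_filter.1 h3
      exact ⟨Finset.mem_inter.1 h5, h6, h4, h2⟩
    obtain ⟨hv₀Y, hv₀⟩ := Finset.mem_filter.1 hv₀
    obtain ⟨⟨huU, huc⟩, hv₀u, huA, -⟩ := key v₀ hv₀
    have hup := (mem_cand.1 huc).1
    have huBd : u ∉ Bd := fun h => huA (Finset.mem_union_right _ h)
    have huimg : u ∉ (T ∪ X).image f := fun h =>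
      huA (Finset.mem_union_left _ (Finset.mem_inter.2 ⟨huU, h⟩))
    have hV' : S.Valid X κ (Insert.insert y T) (Function.update f y u) := by
      refine hV.insert hyTX hqy hup huimg ?_ fun h =>
        absurd h (Finset.disjoint_left.1 hUR huU)
      intro z hz hyz
      rcases Finset.mem_union.1 hz with h | h
      · exact (mem_cand.1 huc).2 z h hyz
      · have hzx := hX y (Finset.mem_insert_self _ _) z h hyz
        rw [hzx, ← hx (hzx ▸ h) v₀ hv₀Y]
        exact hv₀u
    have hI' := hI.insert hyT (hBd' u huBd hup)
    have hupd : ∀ z ∈ T ∪ X, Function.update f y u z = f z := fun z hz =>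
      Function.update_of_ne (by rintro rfl; exact hyTX hz) _ _
    obtain ⟨g, hg1, hg2, hg3, hg4⟩ := ih (Insert.insert y T) (Function.update f y u)
      (Y.filter fun v => u ∈ good v) hV' hI' (by
        rw [Finset.insert_union, Finset.disjoint_insert_left]
        exact ⟨hyB, hdisj⟩)
      (fun z hz => hq z (Finset.mem_insert_of_mem hz))
      (fun z hz => hX z (Finset.mem_insert_of_mem hz))
      (fun hxX v hv => by
        rw [hupd x (Finset.mem_union_right _ hxX)]
        exact hx hxX v (Finset.mem_filter.1 hv).1)
      (by
        have : U ∩ ((Insert.insert y T) ∪ X).image (Function.update f y u) ⊆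
            Insert.insert u (U ∩ (T ∪ X).image f) := by
          rw [Finset.insert_union, Finset.image_insert, Function.update_self,
            Finset.image_congr (g := f) fun z hz => hupd z hz]
          intro z hz
          simp only [Finset.mem_inter, Finset.mem_insert] at hz ⊢
          tauto
        have := (Finset.card_le_card this).trans (Finset.card_insert_le _ _)
        omega)
      (by
        intro v hv z hz
        obtain ⟨hvY, hvg⟩ := Finset.mem_filter.1 hv
        have h1 := halive v hvY z (Finset.mem_insert_of_mem hz)
        rw [deg_insert hyT, cand_insert hyT]
        split_ifs with h
        · have h2 := (key v hvg).2.2.2 z hz h.symm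
          have h3 := mul_le_mul_of_nonneg_left h1 hd0.le
          have h4 : S.d * (S.deg T z * (S.ε * S.m)) ≤ S.deg T z * (S.ε * S.m) :=
            mul_le_of_le_one_left (by positivity) S.d_le_one
          have h5 : ({u' ∈ U ∩ Finset.filter (fun v => S.G.Adj u v) (S.cand T f z) |
              S.G.Adj v u'} : Finset β) = {v' ∈ C v z | S.G.Adj u v'} := by
            ext w
            simp only [C, Finset.mem_filter, Finset.mem_inter]
            tauto
          rw [h5]
          change _ ≤ S.d * (#(C v z) : ℝ) at h3
          push_cast
          rw [pow_succ]
          linarith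
        · simpa using h1)
      hpos'
    refine ⟨g, ?_, ?_, ?_, ?_⟩
    · rwa [Finset.union_insert, ← Finset.insert_union]
    · rwa [Finset.union_insert, ← Finset.insert_union]
    · intro z hz
      rw [hg3 z (by rw [Finset.insert_union]; exact Finset.mem_insert_of_mem hz), hupd z hz]
    · have hgy : g y = u := by
        rw [hg3 y (Finset.mem_union_left _ (Finset.mem_insert_self _ _)), Function.update_self]
      calc ζ ^ #(Insert.insert y B) * ∑ v ∈ Y, wt v = ζ ^ #B * (ζ * ∑ v ∈ Y, wt v) := by
            rw [Finset.card_insert_of_notMem hyB]; ring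
        _ ≤ ζ ^ #B * ∑ v ∈ Y with u ∈ good v, wt v := by gcongr
        _ ≤ _ := hg4
        _ ≤ _ := by
          refine Finset.sum_le_sum_of_subset_of_nonneg ?_ fun v _ _ => hwt v
          intro v hv
          simp only [Finset.mem_filter] at hv ⊢
          refine ⟨hv.1.1, fun z hz => ?_⟩
          rcases Finset.mem_insert.1 hz with rfl | hz
          · rw [hgy]
            exact (key v hv.1.2).2.1
          · exact hv.2 z hz

/-- The neighbourhood of a vertex. -/
noncomputable def nbr (S : Frame α β ι) (x : α) : Finset α := {y | S.H.Adj x y}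

lemma mem_nbr {x y : α} : y ∈ S.nbr x ↔ S.H.Adj x y := by simp [nbr]

/-- Embedding the neighbourhood of `x` such that many of the vertices in `Y`, counted with
weights, are adjacent to the whole image. -/
lemma Valid.exists_union_nbr (hV : S.Valid X κ T f) (hI : S.Inv T f) {ζ : ℝ} (hζ0 : 0 < ζ)
    (hζ1 : ζ ≤ 1)
    (hζ : ζ + S.Δ * (4 * S.ε + S.σ) + S.Δ / S.m ≤ S.d ^ S.Δ * (S.d / 2)) {wt : β → ℝ}
    (hwt : ∀ v, 0 ≤ wt v) {x : α} (hdisj : Disjoint (T ∪ X) (S.nbr x))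
    (hq : ∀ y ∈ S.nbr x, S.q y ≠ none)
    (hx : ∀ y ∈ S.nbr x, ∀ z ∈ T ∪ X, S.H.Adj y z → z = x) (hxT : x ∉ T)
    {Y : Finset β} (hxX : x ∈ X → ∀ v ∈ Y, v = f x)
    (hY : ∀ v ∈ Y, ∀ y ∈ S.nbr x, S.d / 2 * S.m ≤
      #{u | S.p u = S.q y ∧ S.G.Adj v u ∧ u ∉ (T ∪ X).image f ∪ S.R})
    (hpos : 0 < ∑ v ∈ Y, wt v) :
    ∃ g, S.Valid X κ (T ∪ S.nbr x) g ∧ S.Inv (T ∪ S.nbr x) g ∧ (∀ z ∈ T ∪ X, g z = f z) ∧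
      ζ ^ S.Δ * ∑ v ∈ Y, wt v ≤ ∑ v ∈ Y with ∀ y ∈ S.nbr x, S.G.Adj v (g y), wt v := by
  have hc : #(S.nbr x) ≤ S.Δ := S.deg_le x
  obtain ⟨g, h1, h2, h3, h4⟩ := Valid.exists_union_of_alive (S := S) (X := X) (κ := κ) (x := x)
    (U := Finset.univ \ ((T ∪ X).image f ∪ S.R))
    (Finset.disjoint_left.2 fun u hu huR =>
      (Finset.mem_sdiff.1 hu).2 (Finset.mem_union_right _ huR))
    hζ0 hζ hwt (S.nbr x) T f Y hV hI hdisj hq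
    (fun y hy z hz => hx y hy z (Finset.mem_union_right _ hz)) hxX
    (by
      have : (Finset.univ \ ((T ∪ X).image f ∪ S.R)) ∩ (T ∪ X).image f = ∅ := by
        ext u; simp only [Finset.mem_inter, Finset.mem_sdiff, Finset.mem_union]; tauto
      rw [this, Finset.card_empty, zero_add]
      exact hc)
    (by
      intro v hv y hy
      have hnT : ∀ z ∈ T, ¬ S.H.Adj y z := fun z hz hyz =>
        hxT (hx y hy z (Finset.mem_union_left _ hz) hyz ▸ hz)
      have hdeg : S.deg T y = 0 := by
        rw [deg, Finset.card_eq_zero, Finset.filter_eq_empty_iff]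
        exact fun {z} hz => hnT z hz
      rw [hdeg]
      simp only [pow_zero, one_mul, CharP.cast_eq_zero, zero_mul, sub_zero]
      refine (hY v hv y hy).trans (Nat.cast_le.2 (Finset.card_le_card fun u hu => ?_))
      simp only [Finset.mem_filter, Finset.mem_univ, true_and, Finset.mem_inter,
        Finset.mem_sdiff, mem_cand] at hu ⊢
      exact ⟨⟨hu.2.2, hu.1, fun z hz hyz => absurd hyz (hnT z hz)⟩, hu.2.1⟩)
    hpos
  refine ⟨g, h1, h2, h3, le_trans ?_ h4⟩
  exact mul_le_mul_of_nonneg_right (pow_le_pow_of_le_one hζ0.le hζ1 hc) hpos.le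

end Frame

namespace Frame

variable {S : Frame α β ι} {X : Finset α} {f : α → β} {κ : ℝ}

/-- Vertices of `W` are at pairwise distance at least four, and their neighbours lie in clusters. -/
structure Sparse (S : Frame α β ι) (W : Finset α) : Prop where
  not_adj : ∀ x ∈ W, ∀ y ∈ W, ¬ S.H.Adj x y
  eq_of_common : ∀ x ∈ W, ∀ x' ∈ W, ∀ y, S.H.Adj x y → S.H.Adj x' y → x = x'
  eq_of_adj : ∀ x ∈ W, ∀ x' ∈ W, ∀ y z, S.H.Adj x y → S.H.Adj x' z → S.H.Adj y z → x = x'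
  ne_none : ∀ x ∈ W, ∀ y, S.H.Adj x y → S.q y ≠ none

/-- Numerical conditions under which neighbourhoods of vertices can be embedded. -/
structure Dense (S : Frame α β ι) (ζ : ℝ) : Prop where
  pos : 0 < ζ
  le_one : ζ ≤ 1
  le : ζ + S.Δ * (4 * S.ε + S.σ) + S.Δ / S.m ≤ S.d ^ S.Δ * (S.d / 2)

lemma Valid.card_nbr_le {T : Finset α} (hV : S.Valid X κ T f) {o : Option ι} (ho : o ≠ none)
    (v : β) :
    #{u | S.p u = o ∧ S.G.Adj v u} ≤
      #{u | S.p u = o ∧ S.G.Adj v u ∧ u ∉ (T ∪ X).image f ∪ S.R} +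
        (#{z ∈ T | S.q z = o} + #{z ∈ X | S.q z = o} + S.r) := by
  have h1 : #{z ∈ T ∪ X | S.q z = o} ≤ #{z ∈ T | S.q z = o} + #{z ∈ X | S.q z = o} := by
    rw [Finset.filter_union]
    exact Finset.card_union_le _ _
  have h2 := hV.card_used_le o
  have h3 := S.card_R o ho
  have h4 : #{u | S.p u = o ∧ S.G.Adj v u} ≤
      #{u | S.p u = o ∧ S.G.Adj v u ∧ u ∉ (T ∪ X).image f ∪ S.R} +
        #{u ∈ (T ∪ X).image f | S.p u = o} + #{u | S.p u = o ∧ u ∈ S.R} := by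
    refine le_trans (Finset.card_le_card ?_) ((Finset.card_union_le _ _).trans
      (Nat.add_le_add_right (Finset.card_union_le _ _) _))
    intro u hu
    simp only [Finset.mem_filter, Finset.mem_union, Finset.mem_univ, true_and] at hu ⊢
    tauto
  omega

lemma Valid.exists_process {W P : Finset α} (hW : S.Sparse W) (hXW : X ⊆ W) (hPW : P ⊆ W)
    (hV : S.Valid X κ (P.biUnion S.nbr) f) (hI : S.Inv (P.biUnion S.nbr) f) {ζ : ℝ}
    (hζ : S.Dense ζ) {wt : β → ℝ} (hwt : ∀ v, 0 ≤ wt v) {x : α} (hx : x ∈ W) (hxP : x ∉ P)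
    {Y : Finset β} (hxX : x ∈ X → ∀ v ∈ Y, v = f x)
    (hY : ∀ v ∈ Y, ∀ y, S.H.Adj x y →
      S.d / 2 * S.m + (#{z ∈ P.biUnion S.nbr | S.q z = S.q y} + #{z ∈ X | S.q z = S.q y} + S.r) ≤
        (#{u | S.p u = S.q y ∧ S.G.Adj v u} : ℝ)) (hpos : 0 < ∑ v ∈ Y, wt v) :
    ∃ g, S.Valid X κ ((Insert.insert x P).biUnion S.nbr) g ∧
      S.Inv ((Insert.insert x P).biUnion S.nbr) g ∧
      (∀ z ∈ P.biUnion S.nbr ∪ X, g z = f z) ∧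
      ζ ^ S.Δ * ∑ v ∈ Y, wt v ≤ ∑ v ∈ Y with ∀ y ∈ S.nbr x, S.G.Adj v (g y), wt v := by
  rw [Finset.biUnion_insert, Finset.union_comm (S.nbr x)]
  have hne : ∀ x' ∈ P, x' ≠ x := fun x' h h' => hxP (h' ▸ h)
  refine hV.exists_union_nbr hI hζ.pos hζ.le_one hζ.le hwt ?_ ?_ ?_ ?_ hxX ?_ hpos
  · rw [Finset.disjoint_left]
    intro y hy hyx
    rw [mem_nbr] at hyx
    rcases Finset.mem_union.1 hy with h | h
    · obtain ⟨x', hx', hyx'⟩ := Finset.mem_biUnion.1 h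
      exact hne x' hx' (hW.eq_of_common x' (hPW hx') x hx y (mem_nbr.1 hyx') hyx)
    · exact hW.not_adj x hx y (hXW h) hyx
  · exact fun y hy => hW.ne_none x hx y (mem_nbr.1 hy)
  · intro y hy z hz hyz
    rw [mem_nbr] at hy
    rcases Finset.mem_union.1 hz with h | h
    · obtain ⟨x', hx', hzx'⟩ := Finset.mem_biUnion.1 h
      exact absurd (hW.eq_of_adj x' (hPW hx') x hx z y (mem_nbr.1 hzx') hy hyz.symm) (hne x' hx')
    · exact hW.eq_of_common z (hXW h) x hx y hyz.symm hy
  · intro h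
    obtain ⟨x', hx', hxx'⟩ := Finset.mem_biUnion.1 h
    exact hW.not_adj x' (hPW hx') x hx (mem_nbr.1 hxx')
  · intro v hv y hy
    have h1 := hY v hv y (mem_nbr.1 hy)
    have h2 := hV.card_nbr_le (hW.ne_none x hx y (mem_nbr.1 hy)) v
    have h3 : (#{u | S.p u = S.q y ∧ S.G.Adj v u} : ℝ) ≤
      #{u | S.p u = S.q y ∧ S.G.Adj v u ∧ u ∉ (P.biUnion S.nbr ∪ X).image f ∪ S.R} +
        (#{z ∈ P.biUnion S.nbr | S.q z = S.q y} + #{z ∈ X | S.q z = S.q y} + S.r) := by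
      exact_mod_cast h2
    linarith

/-- The neighbourhoods of embedded vertices whose images have large degrees can be embedded. -/
lemma Valid.exists_process_embedded {W P : Finset α} (hW : S.Sparse W) (hXW : X ⊆ W)
    (hPW : P ⊆ W) (hV : S.Valid X κ (P.biUnion S.nbr) f) (hI : S.Inv (P.biUnion S.nbr) f) {ζ : ℝ}
    (hζ : S.Dense ζ) (A : Finset α) (hAX : A ⊆ X) (hAP : Disjoint A P)
    (hA : ∀ x ∈ A, ∀ y, S.H.Adj x y →
      S.d / 2 * S.m + (#{z ∈ (A ∪ P).biUnion S.nbr | S.q z = S.q y} +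
        #{z ∈ X | S.q z = S.q y} + S.r) ≤
        (#{u | S.p u = S.q y ∧ S.G.Adj (f x) u} : ℝ)) :
    ∃ g, S.Valid X κ ((A ∪ P).biUnion S.nbr) g ∧ S.Inv ((A ∪ P).biUnion S.nbr) g ∧
      ∀ z ∈ P.biUnion S.nbr ∪ X, g z = f z := by
  induction A using Finset.induction_on with
  | empty => exact ⟨f, by simpa using hV, by simpa using hI, fun _ _ => rfl⟩
  | insert x A hxA ih =>
    rw [Finset.disjoint_insert_left] at hAP
    have hsub : (A ∪ P).biUnion S.nbr ⊆ (Insert.insert x A ∪ P).biUnion S.nbr :=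
      Finset.biUnion_subset_biUnion_of_subset_left _
        (Finset.union_subset_union_left (Finset.subset_insert _ _))
    have hA' : ∀ x' ∈ Insert.insert x A, ∀ y, S.H.Adj x' y →
        S.d / 2 * S.m + (#{z ∈ (A ∪ P).biUnion S.nbr | S.q z = S.q y} +
          #{z ∈ X | S.q z = S.q y} + S.r) ≤
          (#{u | S.p u = S.q y ∧ S.G.Adj (f x') u} : ℝ) := by
      intro x' hx' y hy
      refine le_trans ?_ (hA x' hx' y hy)
      have := Finset.card_le_card (Finset.filter_subset_filter (fun z => S.q z = S.q y) hsub)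
      have : (#{z ∈ (A ∪ P).biUnion S.nbr | S.q z = S.q y} : ℝ) ≤
        #{z ∈ (Insert.insert x A ∪ P).biUnion S.nbr | S.q z = S.q y} := by exact_mod_cast this
      linarith
    obtain ⟨g, hg1, hg2, hg3⟩ := ih ((Finset.subset_insert _ _).trans hAX) hAP.2
      fun x' hx' => hA' x' (Finset.mem_insert_of_mem hx')
    have hxX : x ∈ X := hAX (Finset.mem_insert_self _ _)
    have hgx : g x = f x := hg3 x (Finset.mem_union_right _ hxX)
    obtain ⟨g', hg1', hg2', hg3', -⟩ := hg1.exists_process hW hXW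
      (Finset.union_subset (((Finset.subset_insert _ _).trans hAX).trans hXW) hPW) hg2 hζ
      (wt := fun _ => 1) (fun _ => zero_le_one) (hXW hxX)
      (by rw [Finset.mem_union, not_or]; exact ⟨hxA, hAP.1⟩) (Y := {f x})
      (fun _ v hv => by rw [Finset.mem_singleton.1 hv, hgx])
      (fun v hv y hy => by
        rw [Finset.mem_singleton.1 hv]
        exact hA' x (Finset.mem_insert_self _ _) y hy) (by simp)
    refine ⟨g', ?_, ?_, fun z hz => ?_⟩
    · rwa [Finset.insert_union]
    · rwa [Finset.insert_union]
    · rw [← hg3 z hz]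
      refine hg3' z (Finset.union_subset_union_left ?_ hz)
      exact Finset.biUnion_subset_biUnion_of_subset_left _ Finset.subset_union_right

/-- The host vertex `v` has few neighbours in some cluster meeting the neighbourhood of `x`. -/
def Atyp (S : Frame α β ι) (v : β) (x : α) : Prop :=
  ∃ y, S.H.Adj x y ∧ (#{u | S.p u = S.q y ∧ S.G.Adj v u} : ℝ) < S.d * S.m - S.ε * S.m

/-- All images of neighbours of `x` are adjacent to `v`, or `v` is atypical for `x`. -/
def Hit (S : Frame α β ι) (f : α → β) (x : α) (v : β) : Prop :=
  (∀ y, S.H.Adj x y → S.G.Adj v (f y)) ∨ S.Atyp v x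

/-- Halving the weights of a subset of proportion at least `θ`. -/
lemma sum_half_pow_le {β : Type*} [DecidableEq β] {Y Z : Finset β} {h h' : β → ℕ} {θ : ℝ}
    (hZ : Z ⊆ Y) (hh : ∀ v ∈ Y, h' v = h v + if v ∈ Z then 1 else 0)
    (hθ : θ * ∑ v ∈ Y, (1 / 2 : ℝ) ^ h v ≤ ∑ v ∈ Z, (1 / 2 : ℝ) ^ h v) :
    ∑ v ∈ Y, (1 / 2 : ℝ) ^ h' v ≤ (1 - θ / 2) * ∑ v ∈ Y, (1 / 2 : ℝ) ^ h v := by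
  have h1 : ∑ v ∈ Y, (1 / 2 : ℝ) ^ h' v =
      ∑ v ∈ Y, (1 / 2 : ℝ) ^ h v - 1 / 2 * ∑ v ∈ Z, (1 / 2 : ℝ) ^ h v := by
    have : ∑ v ∈ Z, (1 / 2 : ℝ) ^ h v = ∑ v ∈ Y, if v ∈ Z then (1 / 2 : ℝ) ^ h v else 0 := by
      rw [← Finset.sum_filter, Finset.filter_mem_eq_inter, Finset.inter_eq_right.2 hZ]
    rw [this, Finset.mul_sum, ← Finset.sum_sub_distrib]
    refine Finset.sum_congr rfl fun v hv => ?_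
    rw [hh v hv]
    split_ifs
    · ring
    · simp
  rw [h1]
  linarith

/-- The neighbourhoods of the vertices of `D` can be embedded such that the candidate sets of
these vertices are spread over the clusters. -/
lemma Valid.exists_spread {W D : Finset α} (hW : S.Sparse W) (hXW : X ⊆ W) (hDW : D ⊆ W)
    (hXD : Disjoint X D) (hV : S.Valid X κ ∅ f) {ζ : ℝ} (hζ : S.Dense ζ) {E : Finset β}
    (hε : S.ε ≤ S.d / 4) (hE : ∀ x ∈ D, ∃ v, S.p v = S.q x ∧ v ∉ E ∧ ¬ S.Atyp v x)
    (hD : ∀ o, o ≠ none → (#{z ∈ D.biUnion S.nbr | S.q z = o} + #{z ∈ X | S.q z = o} + S.r : ℝ) ≤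
      S.d / 4 * S.m) (P : Finset α) (hPD : P ⊆ D) :
    ∃ g, S.Valid X κ (P.biUnion S.nbr) g ∧ S.Inv (P.biUnion S.nbr) g ∧ (∀ z ∈ X, g z = f z) ∧
      ∀ o, o ≠ none → ∑ v with S.p v = o ∧ v ∉ E, (1 / 2 : ℝ) ^ #{x ∈ P | S.q x = o ∧ S.Hit g x v} ≤
        S.m * (1 - ζ ^ S.Δ / 2) ^ #{x ∈ P | S.q x = o} := by
  induction P using Finset.induction_on with
  | empty =>
    refine ⟨f, by simpa using hV, by simpa using inv_empty f, fun _ _ => rfl, fun o ho => ?_⟩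
    simp only [Finset.filter_empty, Finset.card_empty, pow_zero, Finset.sum_const, nsmul_eq_mul,
      mul_one]
    rw [← S.card_V o ho]
    exact_mod_cast Finset.card_le_card fun v hv => by
      simp only [Finset.mem_filter, Finset.mem_univ, true_and] at hv ⊢
      exact hv.1
  | insert x P hxP ih =>
    obtain ⟨g, hg1, hg2, hg3, hg4⟩ := ih ((Finset.subset_insert _ _).trans hPD)
    have hm : (0 : ℝ) < S.m := by exact_mod_cast S.m_pos
    have hxD : x ∈ D := hPD (Finset.mem_insert_self _ _)
    have hxX : x ∉ X := Finset.disjoint_right.1 hXD hxD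
    have hPD' : P ⊆ D := (Finset.subset_insert _ _).trans hPD
    set θ := ζ ^ S.Δ with hθ
    have hθ1 : θ ≤ 1 := pow_le_one₀ hζ.pos.le hζ.le_one
    set V : Finset β := Finset.univ.filter fun v => S.p v = S.q x ∧ v ∉ E with hVdef
    set Y : Finset β := V.filter fun v => ¬ S.Atyp v x with hY
    let h : β → ℕ := fun v => #{x' ∈ P | S.q x' = S.q x ∧ S.Hit g x' v}
    obtain ⟨g', hg1', hg2', hg3', hg4'⟩ := hg1.exists_process hW hXW (hPD'.trans hDW) hg2 hζ
      (wt := fun v => (1 / 2 : ℝ) ^ h v) (fun v => by positivity) (hDW hxD) hxP (Y := Y)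
      (fun h => absurd h hxX)
      (fun v hv y hy => by
        have h1 : ¬ S.Atyp v x := (Finset.mem_filter.1 hv).2
        have h2 := not_lt.1 (not_exists.1 h1 y |> not_and.1 <| hy)
        have h3 := hD (S.q y) (hW.ne_none x (hDW hxD) y hy)
        have h4 := Finset.card_le_card (Finset.filter_subset_filter (fun z => S.q z = S.q y)
          (Finset.biUnion_subset_biUnion_of_subset_left S.nbr hPD'))
        have h5 : (#{z ∈ P.biUnion S.nbr | S.q z = S.q y} : ℝ) ≤
          #{z ∈ D.biUnion S.nbr | S.q z = S.q y} := by exact_mod_cast h4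
        have h6 := mul_le_mul_of_nonneg_right hε hm.le
        linarith)
      (by
        obtain ⟨v, hv1, hv2, hv3⟩ := hE x hxD
        exact Finset.sum_pos (fun _ _ => by positivity) ⟨v, by simp [hY, hVdef, hv1, hv2, hv3]⟩)
    have hHit : ∀ x' ∈ P, ∀ v, S.Hit g' x' v ↔ S.Hit g x' v := by
      intro x' hx' v
      have : ∀ y, S.H.Adj x' y → g' y = g y := fun y hy => hg3' y
        (Finset.mem_union_left _ (Finset.mem_biUnion.2 ⟨x', hx', mem_nbr.2 hy⟩))
      simp only [Hit]
      refine or_congr_left (forall_congr' fun y => ?_)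
      constructor
      · intro h1 hy; rw [← this y hy]; exact h1 hy
      · intro h1 hy; rw [this y hy]; exact h1 hy
    refine ⟨g', hg1', hg2', fun z hz => ?_, fun o ho => ?_⟩
    · rw [hg3' z (Finset.mem_union_right _ hz), hg3 z hz]
    · have hfilt : ∀ v, #{x' ∈ P | S.q x' = o ∧ S.Hit g' x' v} =
          #{x' ∈ P | S.q x' = o ∧ S.Hit g x' v} := fun v => by
        congr 1
        exact Finset.filter_congr fun x' hx' => by rw [hHit x' hx' v]
      by_cases hox : S.q x = o
      · subst hox
        have h1 : #{x' ∈ Insert.insert x P | S.q x' = S.q x} = #{x' ∈ P | S.q x' = S.q x} + 1 := by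
          rw [Finset.filter_insert, if_pos rfl, Finset.card_insert_of_notMem (by simp [hxP])]
        have h2 := sum_half_pow_le (Y := V) (Z := V.filter fun v => S.Hit g' x v) (h := h)
          (h' := fun v => #{x' ∈ Insert.insert x P | S.q x' = S.q x ∧ S.Hit g' x' v}) (θ := θ)
          (Finset.filter_subset _ _)
          (fun v hv => by
            simp only [Finset.mem_filter, hv, true_and, h]
            rw [Finset.filter_insert, ← hfilt v]
            by_cases hh : S.Hit g' x v
            · rw [if_pos ⟨rfl, hh⟩, if_pos hh, Finset.card_insert_of_notMem (by simp [hxP])]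
            · rw [if_neg (fun h => hh h.2), if_neg hh, add_zero])
          (by
            have e1 := Finset.sum_filter_add_sum_filter_not V (fun v => S.Atyp v x)
              (fun v => (1 / 2 : ℝ) ^ h v)
            have e2 : ∑ v ∈ V.filter (fun v => S.Atyp v x), (1 / 2 : ℝ) ^ h v +
                ∑ v ∈ Y with ∀ y ∈ S.nbr x, S.G.Adj v (g' y), (1 / 2 : ℝ) ^ h v ≤
                ∑ v ∈ V.filter (fun v => S.Hit g' x v), (1 / 2 : ℝ) ^ h v := by
              rw [← Finset.sum_union]
              · refine Finset.sum_le_sum_of_subset_of_nonneg ?_ fun _ _ _ => by positivity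
                intro v hv
                simp only [Finset.mem_union, Finset.mem_filter, hY, mem_nbr] at hv
                rw [Finset.mem_filter]
                rcases hv with hv | hv
                · exact ⟨hv.1, Or.inr hv.2⟩
                · exact ⟨hv.1.1, Or.inl hv.2⟩
              · rw [Finset.disjoint_left]
                intro v hv hv'
                simp only [Finset.mem_filter, hY] at hv hv'
                exact hv'.1.2 hv.2
            have e3 : 0 ≤ ∑ v ∈ V.filter (fun v => S.Atyp v x), (1 / 2 : ℝ) ^ h v :=
              Finset.sum_nonneg fun _ _ => by positivity
            have e4 := mul_le_mul_of_nonneg_right hθ1 e3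
            rw [← e1, mul_add]
            linarith)
        refine h2.trans ?_
        rw [h1, pow_succ]
        have h3 := hg4 _ ho
        have h4 := mul_le_mul_of_nonneg_left h3 (by linarith : 0 ≤ 1 - θ / 2)
        refine h4.trans (le_of_eq ?_)
        ring
      · have h1 : #{x' ∈ Insert.insert x P | S.q x' = o} = #{x' ∈ P | S.q x' = o} := by
          rw [Finset.filter_insert, if_neg hox]
        have h2 : ∀ v, #{x' ∈ Insert.insert x P | S.q x' = o ∧ S.Hit g' x' v} =
            #{x' ∈ P | S.q x' = o ∧ S.Hit g x' v} := fun v => by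
          rw [Finset.filter_insert, if_neg (fun h => hox h.1), hfilt]
        simp only [h1, h2]
        exact hg4 o ho

end Frame

/-- Hall's theorem for the vertices of a finite set, with a prescribed map outside this set. -/
lemma exists_injOn_of_hall {α β : Type*} [DecidableEq β] (f : α → β) (A : Finset α)
    (t : α → Finset β) (h : ∀ s ⊆ A, #s ≤ #(s.biUnion t)) :
    ∃ g : α → β, Set.InjOn g A ∧ (∀ x ∈ A, g x ∈ t x) ∧ ∀ x ∉ A, g x = f x := by
  classical
  obtain ⟨g, hg, hgt⟩ := (Finset.all_card_le_biUnion_card_iff_exists_injective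
    (fun x : {x // x ∈ A} => t x)).1 fun s => by
      have := h (s.map (Function.Embedding.subtype _)) fun x hx => by
        obtain ⟨y, -, rfl⟩ := Finset.mem_map.1 hx
        exact y.2
      rwa [Finset.card_map, Finset.map_eq_image, Finset.image_biUnion] at this
  refine ⟨fun x => if hx : x ∈ A then g ⟨x, hx⟩ else f x, ?_, ?_, ?_⟩
  · intro x hx y hy hxy
    have hx' : x ∈ A := hx
    have hy' : y ∈ A := hy
    simp only [hx', hy', dif_pos] at hxy
    exact congrArg Subtype.val (hg hxy)
  · intro x hx
    simp only [hx, dif_pos]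
    exact hgt ⟨x, hx⟩
  · intro x hx
    simp only [hx, dif_neg, not_false_eq_true]

/-- Hall's theorem when the guest and host vertices are partitioned into matching classes. -/
lemma exists_injOn_of_hall_fiberwise {α β ι : Type*} [DecidableEq β] [DecidableEq ι] (f : α → β)
    (A : Finset α) (t : α → Finset β) (q : α → ι) (p : β → ι)
    (hpq : ∀ x ∈ A, ∀ v ∈ t x, p v = q x)
    (h : ∀ o, ∀ s ⊆ A, (∀ x ∈ s, q x = o) → #s ≤ #(s.biUnion t)) :
    ∃ g : α → β, Set.InjOn g A ∧ (∀ x ∈ A, g x ∈ t x) ∧ ∀ x ∉ A, g x = f x := by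
  refine exists_injOn_of_hall f A t fun s hs => ?_
  have h1 : #s = ∑ o ∈ s.image q, #{x ∈ s | q x = o} :=
    Finset.card_eq_sum_card_fiberwise fun x hx => Finset.mem_coe.2 (Finset.mem_image_of_mem q hx)
  have h2 : #(s.biUnion t) = ∑ o ∈ s.image q, #{v ∈ s.biUnion t | p v = o} := by
    refine Finset.card_eq_sum_card_fiberwise fun v hv => ?_
    obtain ⟨x, hx, hvx⟩ := Finset.mem_biUnion.1 (Finset.mem_coe.1 hv)
    rw [hpq x (hs hx) v hvx]
    exact Finset.mem_coe.2 (Finset.mem_image_of_mem q hx)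
  rw [h1, h2]
  refine Finset.sum_le_sum fun o _ => ?_
  refine (h o _ ((Finset.filter_subset _ _).trans hs) fun x hx => (Finset.mem_filter.1 hx).2).trans
    (Finset.card_le_card fun v hv => ?_)
  obtain ⟨x, hx, hvx⟩ := Finset.mem_biUnion.1 hv
  obtain ⟨hx, hxo⟩ := Finset.mem_filter.1 hx
  exact Finset.mem_filter.2 ⟨Finset.mem_biUnion.2 ⟨x, hx, hvx⟩, (hpq x (hs hx) v hvx).trans hxo⟩

namespace Frame

variable {S : Frame α β ι} {X T : Finset α} {f : α → β} {δ ω κ τ : ℝ}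

/-- The candidate sets of the vertices in `D` satisfy Hall's condition. -/
lemma Valid.exists_complete {D : Finset α} (hV : S.Valid X κ (Finset.univ \ (X ∪ D)) f)
    (hI : S.Inv (Finset.univ \ (X ∪ D)) f) (hF : S.Fine δ ω κ τ) (hXD : Disjoint X D)
    (hDD : ∀ x ∈ D, ∀ y ∈ D, ¬ S.H.Adj x y) (hDX : ∀ x ∈ D, ∀ y ∈ X, ¬ S.H.Adj x y)
    (hDo : ∀ o, o ≠ none → δ * S.m ≤ #{x ∈ D | S.q x = o}) (hDq : ∀ x ∈ D, S.q x ≠ none)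
    (hspread : ∀ v, S.p v ≠ none → v ∉ X.image f →
      ω * S.m ≤ #{x ∈ D | S.q x = S.p v ∧ ∀ y, S.H.Adj x y → S.G.Adj v (f y)}) :
    ∃ g : α → β, Function.Injective g ∧ (∀ x y, S.H.Adj x y → S.G.Adj (g x) (g y)) ∧
      (∀ x, S.p (g x) = S.q x) ∧ ∀ x ∉ D, g x = f x := by
  set T := Finset.univ \ (X ∪ D) with hT
  have hm : (0 : ℝ) < S.m := by exact_mod_cast S.m_pos
  have hTX : T ∪ X = Finset.univ \ D := by
    ext x
    have : x ∈ X → x ∉ D := fun a b => Finset.disjoint_left.1 hXD a b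
    simp only [hT, Finset.mem_union, Finset.mem_sdiff, Finset.mem_univ, true_and]
    tauto
  have hTD : Disjoint (T ∪ X) D := hTX ▸ Finset.sdiff_disjoint
  have hmem : ∀ x, x ∉ D → x ∈ T ∪ X := fun x hx => by simp [hTX, hx]
  set U := (T ∪ X).image f with hU
  let t : α → Finset β := fun x => S.cand T f x \ U
  have ht : ∀ x, ∀ v ∈ t x, S.p v = S.q x := fun x v hv =>
    (mem_cand.1 (Finset.mem_sdiff.1 hv).1).1
  obtain ⟨g, hg1, hg2, hg3⟩ := exists_injOn_of_hall_fiberwise f D t S.q S.p (fun x _ => ht x) (by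
    intro o s hs hso
    rcases s.eq_empty_or_nonempty with rfl | ⟨x₀, hx₀⟩
    · simp
    have ho : o ≠ none := hso x₀ hx₀ ▸ hDq x₀ (hs hx₀)
    let Free : Finset β := Finset.univ.filter fun v => S.p v = o ∧ v ∉ U
    let Do : Finset α := D.filter fun x => S.q x = o
    have hsDo : s ⊆ Do := fun x hx => Finset.mem_filter.2 ⟨hs hx, hso x hx⟩
    have hcard : #Do ≤ #Free := by
      have h1 : #{u ∈ U | S.p u = o} ≤ #{y ∈ T ∪ X | S.q y = o} := hV.card_used_le o
      have h2 : S.m = #Free + #{u ∈ U | S.p u = o} := by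
        rw [← S.card_V o ho, ← Finset.card_filter_add_card_filter_not (fun v => v ∉ U)]
        congr 2 <;> ext v <;> simp [Free, and_comm]
      have h3 : S.m = #Do + #{y ∈ T ∪ X | S.q y = o} := by
        rw [← S.card_L o ho, ← Finset.card_filter_add_card_filter_not (fun x => x ∈ D)]
        congr 2 <;> ext v <;> simp [Do, hTX, and_comm]
      omega
    let Γ := s.biUnion t
    have hΓF : Γ ⊆ Free := by
      intro v hv
      obtain ⟨x, hx, hvx⟩ := Finset.mem_biUnion.1 hv
      simp only [Free, Finset.mem_filter, Finset.mem_univ, true_and]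
      exact ⟨(ht x v hvx).trans (hso x hx), (Finset.mem_sdiff.1 hvx).2⟩
    have hsplit : #(Free \ Γ) + #Γ = #Free := Finset.card_sdiff_add_card_eq_card hΓF
    have hΓτ : τ * S.m ≤ #Γ := by
      have h1 := hV.le_card_cand_R hI hF hTD (hDq x₀ (hs hx₀)) (hDo _ (hDq x₀ (hs hx₀)))
      have h2 : #((S.cand T f x₀ ∩ S.R) \ (T ∪ X).image f) ≤ #Γ := by
        refine Finset.card_le_card fun v hv => Finset.mem_biUnion.2 ⟨x₀, hx₀, ?_⟩
        exact Finset.sdiff_subset_sdiff Finset.inter_subset_left subset_rfl hv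
      have h3 := mul_le_mul_of_nonneg_right hF.τ_add_le hm.le
      have h4 : (#((S.cand T f x₀ ∩ S.R) \ (T ∪ X).image f) : ℝ) ≤ #Γ := by exact_mod_cast h2
      linarith
    by_contra! hlt
    change #Γ < #s at hlt
    have hsDo' := Finset.card_le_card hsDo
    obtain ⟨v, hv⟩ : (Free \ Γ).Nonempty := by
      rw [← Finset.card_pos]; omega
    have hempty : ∀ x ∈ s, S.cand T f x ∩ (Free \ Γ) = ∅ := by
      intro x hx
      refine Finset.eq_empty_of_forall_notMem fun u hu => ?_
      obtain ⟨hu1, hu2⟩ := Finset.mem_inter.1 hu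
      obtain ⟨hu3, hu4⟩ := Finset.mem_sdiff.1 hu2
      refine hu4 (Finset.mem_biUnion.2 ⟨x, hx, Finset.mem_sdiff.2 ⟨hu1, ?_⟩⟩)
      exact (Finset.mem_filter.1 hu3).2.2
    have hmiss : ω * S.m ≤ #(Do \ s) := by
      obtain ⟨hv1, hv2⟩ := Finset.mem_sdiff.1 hv
      obtain ⟨-, hvo, hvU⟩ := Finset.mem_filter.1 hv1
      refine (hspread v (hvo ▸ ho) fun h => hvU
        (Finset.image_subset_image Finset.subset_union_right h)).trans ?_
      refine Nat.cast_le.2 (Finset.card_le_card fun x hx => ?_)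
      obtain ⟨hxD, hxo, hxv⟩ := Finset.mem_filter.1 hx
      refine Finset.mem_sdiff.2 ⟨Finset.mem_filter.2 ⟨hxD, hxo.trans hvo⟩, fun hxs => ?_⟩
      have : v ∈ S.cand T f x ∩ (Free \ Γ) := Finset.mem_inter.2
        ⟨mem_cand.2 ⟨hxo.symm, fun y _ hxy => (hxv y hxy).symm⟩, hv⟩
      rw [hempty x hxs] at this
      exact absurd this (Finset.notMem_empty _)
    have hsplit' : #(Do \ s) + #s = #Do := Finset.card_sdiff_add_card_eq_card hsDo
    have hW : (#(Free \ Γ) : ℝ) < ω * S.m ∨ ω * S.m ≤ #(Free \ Γ) := lt_or_ge _ _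
    rcases hW with hW | hW
    · have : #(Free \ Γ) < #(Do \ s) := by exact_mod_cast hW.trans_le hmiss
      omega
    · have := hI.card_le_of_poor ho hF.ω_pos hF.τ_pos (W := Free \ Γ)
        (fun u hu => (Finset.mem_filter.1 (Finset.mem_sdiff.1 hu).1).2.1) hW hF.κ_le hF.moment
        (Y := s) fun x hx => ⟨hso x hx, by
          rw [hempty x hx]
          simpa using mul_nonneg hF.κ_pos.le hm.le⟩
      have : #s ≤ #Γ := by exact_mod_cast this.trans hΓτ
      omega)
  refine ⟨g, ?_, ?_, ?_, hg3⟩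
  · intro x y hxy
    by_cases hx : x ∈ D <;> by_cases hy : y ∈ D
    · exact hg1 hx hy hxy
    · refine absurd (Finset.mem_image_of_mem f (hmem y hy)) ?_
      rw [← hg3 y hy, ← hxy]
      exact (Finset.mem_sdiff.1 (hg2 x hx)).2
    · refine absurd (Finset.mem_image_of_mem f (hmem x hx)) ?_
      rw [← hg3 x hx, hxy]
      exact (Finset.mem_sdiff.1 (hg2 y hy)).2
    · rw [hg3 x hx, hg3 y hy] at hxy
      exact hV.inj (hmem x hx) (hmem y hy) hxy
  · have key : ∀ x y, S.H.Adj x y → x ∈ D → S.G.Adj (g x) (g y) := by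
      intro x y hxy hx
      have hyD : y ∉ D := fun hy => hDD x hx y hy hxy
      have hyX : y ∉ X := fun hy => hDX x hx y hy hxy
      rw [hg3 y hyD]
      refine ((mem_cand.1 (Finset.mem_sdiff.1 (hg2 x hx)).1).2 y ?_ hxy).symm
      simp [hT, hyX, hyD]
    intro x y hxy
    by_cases hx : x ∈ D
    · exact key x y hxy hx
    · by_cases hy : y ∈ D
      · exact (key y x hxy.symm hy).symm
      · rw [hg3 x hx, hg3 y hy]
        exact hV.edge x (hmem x hx) y (hmem y hy) hxy
  · intro x
    by_cases hx : x ∈ D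
    · exact ht x _ (hg2 x hx)
    · rw [hg3 x hx]
      exact hV.cluster x (hmem x hx)

/-- A numerical estimate turning weights into frequencies. -/
lemma le_of_half_pow_le {h N m : ℕ} {θ : ℝ} (hm : 0 < m) (hθ : θ ≤ 1)
    (hle : (1 / 2 : ℝ) ^ h ≤ m * (1 - θ / 2) ^ N) : θ / 2 * N - Real.log m ≤ h := by
  have hm' : (0 : ℝ) < m := by exact_mod_cast hm
  have h1 : Real.exp (-(h : ℝ)) ≤ (1 / 2 : ℝ) ^ h := by
    have : Real.exp (-(h : ℝ)) = Real.exp (-1) ^ h := by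
      rw [← Real.exp_nat_mul]; ring_nf
    rw [this]
    refine pow_le_pow_left₀ (Real.exp_pos _).le ?_ h
    rw [Real.exp_neg, one_div]
    refine inv_anti₀ (by norm_num) ?_
    linarith [Real.add_one_le_exp (1 : ℝ)]
  have h2 : (1 - θ / 2) ^ N ≤ Real.exp (-(θ / 2 * N)) := by
    have : Real.exp (-(θ / 2 * N)) = Real.exp (-(θ / 2)) ^ N := by
      rw [← Real.exp_nat_mul]; ring_nf
    rw [this]
    refine pow_le_pow_left₀ (by linarith) ?_ N
    linarith [Real.add_one_le_exp (-(θ / 2))]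
  have h3 : Real.exp (-(h : ℝ)) ≤ Real.exp (Real.log m + -(θ / 2 * N)) := by
    rw [Real.exp_add, Real.exp_log hm']
    exact h1.trans (hle.trans (mul_le_mul_of_nonneg_left h2 hm'.le))
  have := Real.exp_le_exp.1 h3
  linarith

/-- An abstract blow-up lemma: a suitable partial embedding `f` of `F ∪ L` extends to the whole
guest graph. The set `E` of exceptional host vertices is covered by the partial embedding. -/
theorem Valid.exists_embedding {F L D : Finset α} {E : Finset β} {ζ : ℝ}
    (hV : S.Valid (F ∪ L) κ ∅ f) (hW : S.Sparse (F ∪ L ∪ D)) (hF : S.Fine δ ω κ τ)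
    (hζ : S.Dense ζ) (hFL : Disjoint F L) (hXD : Disjoint (F ∪ L) D)
    (hnone : ∀ x, S.q x = none → x ∈ F ∪ L)
    (hDo : ∀ o, o ≠ none → δ * S.m ≤ #{x ∈ D | S.q x = o}) (hDq : ∀ x ∈ D, S.q x ≠ none)
    (hε : S.ε ≤ S.d / 4) (hω : ω ≤ ζ ^ S.Δ / 8 * δ) (hlog : Real.log S.m ≤ ζ ^ S.Δ / 4 * δ * S.m)
    (hEf : ∀ v ∈ E, v ∈ (F ∪ L).image f)
    (hE : ∀ v ∉ E, S.p v ≠ none →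
      (#{x ∈ D | S.q x = S.p v ∧ S.Atyp v x} : ℝ) ≤ ζ ^ S.Δ / 8 * #{x ∈ D | S.q x = S.p v})
    (htyp : ∀ x ∈ D, ∃ v, S.p v = S.q x ∧ v ∉ E ∧ ¬ S.Atyp v x)
    (hFD : ∀ o, o ≠ none → (#{z ∈ (F ∪ D).biUnion S.nbr | S.q z = o} +
      #{z ∈ F ∪ L | S.q z = o} + S.r : ℝ) ≤ S.d / 4 * S.m)
    (hFdeg : ∀ x ∈ F, ∀ y, S.H.Adj x y →
      3 / 4 * S.d * S.m ≤ (#{u | S.p u = S.q y ∧ S.G.Adj (f x) u} : ℝ))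
    (hLdeg : ∀ x ∈ L, ∀ y, S.H.Adj x y →
      S.d / 2 * S.m + (#{z ∈ (L ∪ (F ∪ D)).biUnion S.nbr | S.q z = S.q y} +
        #{z ∈ F ∪ L | S.q z = S.q y} + S.r) ≤ (#{u | S.p u = S.q y ∧ S.G.Adj (f x) u} : ℝ)) :
    ∃ g : α → β, Function.Injective g ∧ (∀ x y, S.H.Adj x y → S.G.Adj (g x) (g y)) ∧
      (∀ x, S.p (g x) = S.q x) ∧ ∀ x ∈ F ∪ L, g x = f x := by
  have hm : (0 : ℝ) < S.m := by exact_mod_cast S.m_pos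
  have hXW : F ∪ L ⊆ F ∪ L ∪ D := Finset.subset_union_left
  have hDW : D ⊆ F ∪ L ∪ D := Finset.subset_union_right
  have hFW : F ⊆ F ∪ L ∪ D := Finset.subset_union_left.trans hXW
  have hFDs : Disjoint F D := hXD.mono_left Finset.subset_union_left
  have hLDs : Disjoint L D := hXD.mono_left Finset.subset_union_right
  set θ := ζ ^ S.Δ with hθ
  have hθ0 : 0 < θ := pow_pos hζ.pos _
  have hθ1 : θ ≤ 1 := pow_le_one₀ hζ.pos.le hζ.le_one
  obtain ⟨g₁, hV₁, hI₁, hf₁, hw₁⟩ := hV.exists_spread hW hXW hDW hXD hζ hε htyp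
    (fun o ho => by
      refine le_trans ?_ (hFD o ho)
      have : #{z ∈ D.biUnion S.nbr | S.q z = o} ≤ #{z ∈ (F ∪ D).biUnion S.nbr | S.q z = o} :=
        Finset.card_le_card (Finset.filter_subset_filter _
          (Finset.biUnion_subset_biUnion_of_subset_left _ Finset.subset_union_right))
      have : (#{z ∈ D.biUnion S.nbr | S.q z = o} : ℝ) ≤
        #{z ∈ (F ∪ D).biUnion S.nbr | S.q z = o} := by exact_mod_cast this
      linarith) D subset_rfl
  have hFX : ∀ x ∈ F, x ∈ F ∪ L := fun x hx => Finset.mem_union_left _ hx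
  have hLX : ∀ x ∈ L, x ∈ F ∪ L := fun x hx => Finset.mem_union_right _ hx
  obtain ⟨g₂, hV₂, hI₂, hf₂⟩ := hV₁.exists_process_embedded hW hXW hDW hI₁ hζ F
    Finset.subset_union_left hFDs (fun x hx y hy => by
      rw [hf₁ x (hFX x hx)]
      have h1 := hFD (S.q y) (hW.ne_none x (hFW hx) y hy)
      have h2 := hFdeg x hx y hy
      linarith)
  obtain ⟨g₃, hV₃, hI₃, hf₃⟩ := hV₂.exists_process_embedded hW hXW
    (Finset.union_subset hFW hDW) hI₂ hζ L Finset.subset_union_right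
    (Finset.disjoint_union_right.2 ⟨hFL.symm, hLDs⟩) (fun x hx y hy => by
      rw [hf₂ x (Finset.mem_union_right _ (hLX x hx)), hf₁ x (hLX x hx)]
      exact hLdeg x hx y hy)
  set T := (L ∪ (F ∪ D)).biUnion S.nbr with hT
  have hTW : L ∪ (F ∪ D) ⊆ F ∪ L ∪ D := fun x hx => by
    simp only [Finset.mem_union] at hx ⊢; tauto
  have hTXD : Disjoint (T ∪ (F ∪ L)) D := by
    rw [Finset.disjoint_union_left]
    refine ⟨Finset.disjoint_left.2 fun y hy hyD => ?_, hXD⟩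
    obtain ⟨x, hx, hxy⟩ := Finset.mem_biUnion.1 hy
    exact hW.not_adj x (hTW hx) y (hDW hyD) (mem_nbr.1 hxy)
  obtain ⟨g₄, hV₄, hI₄, hf₄⟩ := hV₃.exists_extend hI₃ hF hTXD hDo hnone fun x hx y hxy =>
    Finset.mem_biUnion.2 ⟨x, by simp only [Finset.mem_union] at hx ⊢; tauto, mem_nbr.2 hxy⟩
  have hX₄ : ∀ x ∈ F ∪ L, g₄ x = f x := fun x hx => by
    rw [hf₄ x (Finset.mem_union_right _ hx), hf₃ x (Finset.mem_union_right _ hx),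
      hf₂ x (Finset.mem_union_right _ hx), hf₁ x hx]
  have hD₄ : ∀ x ∈ D, ∀ y, S.H.Adj x y → g₄ y = g₁ y := fun x hx y hxy => by
    have h1 : ∀ P, D ⊆ P → y ∈ P.biUnion S.nbr := fun P hP =>
      Finset.mem_biUnion.2 ⟨x, hP hx, mem_nbr.2 hxy⟩
    rw [hf₄ y (Finset.mem_union_left _ (h1 _ (Finset.subset_union_right.trans
        Finset.subset_union_right))),
      hf₃ y (Finset.mem_union_left _ (h1 _ Finset.subset_union_right)),
      hf₂ y (Finset.mem_union_left _ (h1 _ subset_rfl))]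
  obtain ⟨g, hg1, hg2, hg3, hg4⟩ := hV₄.exists_complete hI₄ hF hXD
    (fun x hx y hy => hW.not_adj x (hDW hx) y (hDW hy))
    (fun x hx y hy => hW.not_adj x (hDW hx) y (hXW hy)) hDo hDq (by
      intro v hpv hv
      have hvE : v ∉ E := fun h => hv (by
        rw [Finset.image_congr (g := f) fun x hx => hX₄ x hx]
        exact hEf v h)
      have h1 : (1 / 2 : ℝ) ^ #{x ∈ D | S.q x = S.p v ∧ S.Hit g₁ x v} ≤
          S.m * (1 - θ / 2) ^ #{x ∈ D | S.q x = S.p v} :=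
        (Finset.single_le_sum (f := fun u =>
          (1 / 2 : ℝ) ^ #{x ∈ D | S.q x = S.p v ∧ S.Hit g₁ x u}) (fun _ _ => by positivity)
          (by simp [hvE] : v ∈ Finset.univ.filter fun u => S.p u = S.p v ∧ u ∉ E)).trans
          (hw₁ _ hpv)
      have h2 := le_of_half_pow_le S.m_pos hθ1 h1
      have h3 := hE v hvE hpv
      have h4 := hDo _ hpv
      have h5 : #{x ∈ D | S.q x = S.p v ∧ S.Hit g₁ x v} ≤
          #{x ∈ D | S.q x = S.p v ∧ ∀ y, S.H.Adj x y → S.G.Adj v (g₄ y)} +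
          #{x ∈ D | S.q x = S.p v ∧ S.Atyp v x} := by
        refine le_trans (Finset.card_le_card fun x hx => ?_) (Finset.card_union_le _ _)
        obtain ⟨hxD, hxo, hx⟩ := Finset.mem_filter.1 hx
        rw [Finset.mem_union, Finset.mem_filter, Finset.mem_filter]
        rcases hx with hx | hx
        · exact Or.inl ⟨hxD, hxo, fun y hy => by rw [hD₄ x hxD y hy]; exact hx y hy⟩
        · exact Or.inr ⟨hxD, hxo, hx⟩
      have h6 : (#{x ∈ D | S.q x = S.p v ∧ S.Hit g₁ x v} : ℝ) ≤
          #{x ∈ D | S.q x = S.p v ∧ ∀ y, S.H.Adj x y → S.G.Adj v (g₄ y)} +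
          #{x ∈ D | S.q x = S.p v ∧ S.Atyp v x} := by exact_mod_cast h5
      have h7 := mul_le_mul_of_nonneg_right hω hm.le
      have h8 := mul_le_mul_of_nonneg_left h4 hθ0.le
      linarith)
  refine ⟨g, hg1, hg2, hg3, fun x hx => ?_⟩
  rw [hg4 x (Finset.disjoint_left.1 hXD hx), hX₄ x hx]

end Frame

namespace Frame

variable {S : Frame α β ι}

lemma Sparse.mono {W W' : Finset α} (hW : S.Sparse W') (h : W ⊆ W') : S.Sparse W where
  not_adj x hx y hy := hW.not_adj x (h hx) y (h hy)
  eq_of_common x hx y hy := hW.eq_of_common x (h hx) y (h hy)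
  eq_of_adj x hx y hy := hW.eq_of_adj x (h hx) y (h hy)
  ne_none x hx := hW.ne_none x (h hx)

lemma card_atyp_le {x : α} (hx : S.q x ≠ none) (hy : ∀ y, S.H.Adj x y → S.q y ≠ none) :
    (#{v | S.p v = S.q x ∧ S.Atyp v x} : ℝ) ≤ S.Δ * (S.ε * S.m) := by
  have h0 : 0 ≤ S.ε * S.m := mul_nonneg S.ε_pos.le (Nat.cast_nonneg _)
  let B : α → Finset β := fun y => Finset.univ.filter fun u => S.p u = S.q x ∧
    (#{v ∈ (Finset.univ.filter fun v => S.p v = S.q y) | S.G.Adj u v} : ℝ) <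
      S.d * #(Finset.univ.filter fun v => S.p v = S.q y) - S.ε * S.m
  have h1 : #{v | S.p v = S.q x ∧ S.Atyp v x} ≤ ∑ y ∈ S.nbr x, #(B y) := by
    refine le_trans (Finset.card_le_card fun v hv => ?_) Finset.card_biUnion_le
    obtain ⟨-, hv, y, hxy, hvy⟩ := Finset.mem_filter.1 hv
    refine Finset.mem_biUnion.2 ⟨y, mem_nbr.2 hxy, Finset.mem_filter.2 ⟨Finset.mem_univ _, hv, ?_⟩⟩
    rw [Finset.filter_filter, S.card_V _ (hy y hxy)]
    exact hvy
  calc (#{v | S.p v = S.q x ∧ S.Atyp v x} : ℝ) ≤ ∑ y ∈ S.nbr x, (#(B y) : ℝ) := by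
        exact_mod_cast h1
    _ ≤ ∑ y ∈ S.nbr x, S.ε * S.m := Finset.sum_le_sum fun y hxy =>
        S.reg_low x y (mem_nbr.1 hxy) hx (hy y (mem_nbr.1 hxy)) _
          fun v hv => (Finset.mem_filter.1 hv).2
    _ ≤ S.Δ * (S.ε * S.m) := by
        rw [Finset.sum_const, nsmul_eq_mul]
        exact mul_le_mul_of_nonneg_right (by exact_mod_cast S.deg_le x) h0

/-- Few host vertices are atypical for many of the vertices of `D`. -/
lemma card_exceptional_le {D : Finset α} (hD : ∀ x ∈ D, ∀ y, S.H.Adj x y → S.q y ≠ none) (θ : ℝ)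
    {o : Option ι} (ho : o ≠ none) :
    θ * #{v | S.p v = o ∧
      θ * #{x ∈ D | S.q x = o} < (#{x ∈ D | S.q x = o ∧ S.Atyp v x} : ℝ)} ≤
      S.Δ * (S.ε * S.m) := by
  have h0 : 0 ≤ S.Δ * (S.ε * S.m) :=
    mul_nonneg (Nat.cast_nonneg _) (mul_nonneg S.ε_pos.le (Nat.cast_nonneg _))
  set Do : Finset α := {x ∈ D | S.q x = o} with hDo
  set E : Finset β := Finset.univ.filter fun v => S.p v = o ∧
    θ * #Do < (#{x ∈ D | S.q x = o ∧ S.Atyp v x} : ℝ) with hE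
  rcases Do.eq_empty_or_nonempty with h | h
  · have : E = ∅ := by
      refine Finset.eq_empty_of_forall_notMem fun v hv => ?_
      obtain ⟨-, -, hv⟩ := Finset.mem_filter.1 hv
      rw [← Finset.filter_filter, ← hDo, h] at hv
      simp at hv
    simpa [this] using h0
  · have hpos : (0 : ℝ) < #Do := by exact_mod_cast h.card_pos
    have h1 : (#E : ℝ) * (θ * #Do) ≤ ∑ v ∈ E, (#{x ∈ Do | S.Atyp v x} : ℝ) := by
      rw [← nsmul_eq_mul]
      refine Finset.card_nsmul_le_sum _ _ _ fun v hv => ?_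
      obtain ⟨-, -, hv⟩ := Finset.mem_filter.1 hv
      rw [← Finset.filter_filter] at hv
      exact hv.le
    have h2 : ∑ v ∈ E, #{x ∈ Do | S.Atyp v x} = ∑ x ∈ Do, #{v ∈ E | S.Atyp v x} :=
      Finset.sum_card_bipartiteAbove_eq_sum_card_bipartiteBelow _
    have h3 : ∑ x ∈ Do, (#{v ∈ E | S.Atyp v x} : ℝ) ≤ #Do * (S.Δ * (S.ε * S.m)) := by
      rw [← nsmul_eq_mul]
      refine Finset.sum_le_card_nsmul _ _ _ fun x hx => ?_
      obtain ⟨hx, hxo⟩ := Finset.mem_filter.1 hx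
      refine le_trans ?_ (S.card_atyp_le (x := x) (hxo ▸ ho) (hD x hx))
      refine Nat.cast_le.2 (Finset.card_le_card fun v hv => ?_)
      obtain ⟨hv, hvx⟩ := Finset.mem_filter.1 hv
      obtain ⟨-, hv, -⟩ := Finset.mem_filter.1 hv
      exact Finset.mem_filter.2 ⟨Finset.mem_univ _, hv.trans hxo.symm, hvx⟩
    have h4 : ∑ v ∈ E, (#{x ∈ Do | S.Atyp v x} : ℝ) = ∑ x ∈ Do, (#{v ∈ E | S.Atyp v x} : ℝ) := by
      exact_mod_cast h2
    refine le_of_mul_le_mul_left ?_ hpos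
    linarith

/-- A set of host vertices avoiding `E` with `r` elements in every cluster. -/
lemma exists_reserved (S : Frame α β ι) {E : Finset β} {r : ℕ}
    (h : ∀ o, o ≠ none → #{v ∈ E | S.p v = o} + r ≤ S.m) :
    ∃ R : Finset β, (∀ v ∈ R, S.p v ≠ none ∧ v ∉ E) ∧
      ∀ o, o ≠ none → #{v | S.p v = o ∧ v ∈ R} = r := by
  have key : ∀ o, ∃ s : Finset β, o ≠ none → (∀ v ∈ s, S.p v = o ∧ v ∉ E) ∧ #s = r := by
    intro o
    by_cases ho : o = none
    · exact ⟨∅, fun h => absurd ho h⟩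
    · have h1 := h o ho
      have h2 : S.m = #{v ∈ E | S.p v = o} + #{v | S.p v = o ∧ v ∉ E} := by
        rw [← S.card_V o ho, ← Finset.card_filter_add_card_filter_not (fun v => v ∈ E)]
        congr 2 <;> ext v <;> simp [and_comm]
      obtain ⟨s, hs, hsr⟩ := Finset.exists_subset_card_eq
        (show r ≤ #{v | S.p v = o ∧ v ∉ E} by omega)
      exact ⟨s, fun _ => ⟨fun v hv => (Finset.mem_filter.1 (hs hv)).2, hsr⟩⟩
  choose s hs using key
  refine ⟨Finset.univ.filter fun v => S.p v ≠ none ∧ v ∈ s (S.p v), fun v hv => ?_, fun o ho => ?_⟩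
  · obtain ⟨-, hv, hvs⟩ := Finset.mem_filter.1 hv
    exact ⟨hv, (((hs _ hv).1 v hvs)).2⟩
  · rw [← (hs o ho).2]
    congr 1
    ext v
    simp only [Finset.mem_filter, Finset.mem_univ, true_and]
    constructor
    · rintro ⟨rfl, -, hv⟩
      exact hv
    · intro hv
      have := ((hs o ho).1 v hv).1
      exact ⟨this, this ▸ ho, this ▸ hv⟩

lemma fine_of_small {δ θ : ℝ} (hΔ : 1 ≤ S.Δ) (hδ0 : 0 < δ) (hθ0 : 0 < θ) (hθ1 : θ ≤ 1)
    (hm : 1 ≤ S.ε * S.m) (hσ1 : S.σ ≤ 1) (hσ : S.σ ^ 2 = S.ε)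
    (hκ : 16 * S.Δ ^ 2 * S.σ ≤ S.d ^ S.Δ * δ * θ / 64)
    (hmom : 16 * S.Δ ^ 2 * S.σ ≤
      (S.d ^ S.Δ * δ / 16 * (3 / 4 * (S.d ^ S.Δ * (θ * δ / 8)))) ^ 2 / 2)
    (hr : δ / 4 * S.m ≤ S.r) (hr' : S.r ≤ δ / 2 * S.m) :
    S.Fine δ (θ * δ / 8) (S.d ^ S.Δ * δ * θ / 32) (S.d ^ S.Δ * δ / 16) := by
  have hm0 : (0 : ℝ) < S.m := by exact_mod_cast S.m_pos
  have hσ0 := S.σ_pos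
  have hΔ' : (1 : ℝ) ≤ S.Δ := by exact_mod_cast hΔ
  have hεσ : S.ε ≤ S.σ := by rw [← hσ]; nlinarith
  have hΔσ : S.Δ * S.σ ≤ S.Δ ^ 2 * S.σ := mul_le_mul_of_nonneg_right (by nlinarith) hσ0.le
  have hΔε : S.Δ * S.ε ≤ S.Δ * S.σ := mul_le_mul_of_nonneg_left hεσ (by linarith)
  have hpos : 0 < S.Δ ^ 2 * S.σ := by positivity
  have hdivm : 1 / (S.m : ℝ) ≤ S.σ := by
    rw [div_le_iff₀ hm0]
    exact hm.trans (mul_le_mul_of_nonneg_right hεσ hm0.le)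
  have hd0 := S.d_pos
  have hdδ : 0 < S.d ^ S.Δ * δ := by positivity
  have hdδθ : S.d ^ S.Δ * δ * θ ≤ S.d ^ S.Δ * δ := mul_le_of_le_one_right hdδ.le hθ1
  have hθδ : θ * δ ≤ δ := mul_le_of_le_one_left hδ0.le hθ1
  have hdiv : 2 * (S.Δ : ℝ) ^ 2 / S.m ≤ 2 * S.Δ ^ 2 * S.σ := by
    rw [div_eq_mul_one_div]
    exact mul_le_mul_of_nonneg_left hdivm (by positivity)
  refine ⟨by positivity, by positivity, by positivity, by linarith, le_of_eq (by ring), ?_, ?_, hr,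
    hr', ?_, ?_⟩
  all_goals linarith

lemma dense_of_small (hΔ : 1 ≤ S.Δ) (hm : 1 ≤ S.ε * S.m) (hσ1 : S.σ ≤ 1)
    (hσ : S.σ ^ 2 = S.ε) (h : 16 * S.Δ ^ 2 * S.σ ≤ S.d ^ (S.Δ + 1) / 4) :
    S.d ^ (S.Δ + 1) / 4 + S.Δ * (4 * S.ε + S.σ) + S.Δ / S.m ≤ S.d ^ S.Δ * (S.d / 2) := by
  have hm0 : (0 : ℝ) < S.m := by exact_mod_cast S.m_pos
  have hσ0 := S.σ_pos
  have hΔ' : (1 : ℝ) ≤ S.Δ := by exact_mod_cast hΔ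
  have hεσ : S.ε ≤ S.σ := by rw [← hσ]; nlinarith
  have hΔσ : S.Δ * S.σ ≤ S.Δ ^ 2 * S.σ := mul_le_mul_of_nonneg_right (by nlinarith) hσ0.le
  have hΔε : S.Δ * S.ε ≤ S.Δ * S.σ := mul_le_mul_of_nonneg_left hεσ (by linarith)
  have hpos : 0 < S.Δ ^ 2 * S.σ := by positivity
  have hdivm : 1 / (S.m : ℝ) ≤ S.σ := by
    rw [div_le_iff₀ hm0]
    exact hm.trans (mul_le_mul_of_nonneg_right hεσ hm0.le)
  have hdiv : (S.Δ : ℝ) / S.m ≤ S.Δ * S.σ := by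
    rw [div_eq_mul_one_div]
    exact mul_le_mul_of_nonneg_left hdivm (by positivity)
  rw [pow_succ S.d] at h ⊢
  linarith

lemma log_le_of_small {δ θ : ℝ} (hΔ : 1 ≤ S.Δ) (hδ0 : 0 < δ) (hθ0 : 0 < θ)
    (hm : 1 ≤ S.ε * S.m) (hσ : S.σ ^ 2 = S.ε)
    (hκ : 16 * S.Δ ^ 2 * S.σ ≤ S.d ^ S.Δ * δ * θ / 64) :
    Real.log S.m ≤ θ / 4 * δ * S.m := by
  have hm0 : (0 : ℝ) < S.m := by exact_mod_cast S.m_pos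
  have hσ0 := S.σ_pos
  have hΔ' : (1 : ℝ) ≤ S.Δ := by exact_mod_cast hΔ
  have hσΔ : S.σ ≤ S.Δ ^ 2 * S.σ := le_mul_of_one_le_left hσ0.le (one_le_pow₀ hΔ')
  have e1 : Real.log S.m = 2 * Real.log (Real.sqrt S.m) := by
    rw [Real.log_sqrt hm0.le]; ring
  have e2 := Real.log_le_sub_one_of_pos (Real.sqrt_pos.2 hm0)
  have e3 : Real.sqrt S.m * Real.sqrt S.m = S.m := Real.mul_self_sqrt hm0.le
  have e4 : 1 ≤ S.σ * Real.sqrt S.m := by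
    rw [← one_le_sq_iff₀ (by positivity), mul_pow, hσ, Real.sq_sqrt hm0.le]
    exact hm
  have e5 : Real.sqrt S.m ≤ S.σ * S.m := by
    have := mul_le_mul_of_nonneg_right e4 (Real.sqrt_nonneg (S.m : ℝ))
    rw [one_mul, mul_assoc, e3] at this
    exact this
  have e6 : S.d ^ S.Δ * δ * θ ≤ δ * θ := by
    rw [mul_assoc]
    exact mul_le_of_le_one_left (by positivity) (pow_le_one₀ S.d_pos.le S.d_le_one)
  have e7 : 2 * S.σ ≤ θ / 4 * δ := by linarith
  have e8 := mul_le_mul_of_nonneg_right e7 hm0.le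
  linarith

set_option maxHeartbeats 1000000 in
/-- The blow-up lemma for frames, before the choice of the reserved set. -/
theorem exists_blowUp (S : Frame α β ι) {δ ε' K₂ K₃ c : ℝ} (φ : α → β)
    (hΔ : 1 ≤ S.Δ) (hc : S.d + K₂ * S.d ≤ c) (hδ0 : 0 < δ)
    (hδ : 64 * S.Δ * δ ≤ S.d) (hε'0 : 0 < ε') (hε' : 16 * ε' ≤ S.d) (hK₃ : 16 * (K₃ * ε') ≤ S.d)
    (hd : S.d ≤ 1 / 2)
    (hm : 1 ≤ S.ε * S.m) (hσ1 : S.σ ≤ 1) (hσ : S.σ ^ 2 = S.ε)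
    {θ : ℝ} (hθ : θ = (S.d ^ (S.Δ + 1) / 4) ^ S.Δ)
    (h1 : 16 * S.Δ ^ 2 * S.σ ≤ S.d / 16) (h2 : 16 * S.Δ ^ 2 * S.σ ≤ ε' * θ)
    (h3 : 16 * S.Δ ^ 2 * S.σ ≤ δ / 4) (h4 : 16 * S.Δ ^ 2 * S.σ ≤ S.d ^ S.Δ * δ * θ / 64)
    (h5 : 16 * S.Δ ^ 2 * S.σ ≤
      (S.d ^ S.Δ * δ / 16 * (3 / 4 * (S.d ^ S.Δ * (θ * δ / 8)))) ^ 2 / 2)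
    (h6 : 16 * S.Δ ^ 2 * S.σ ≤ S.d ^ (S.Δ + 1) / 4)
    (hφ : ∀ x, S.q x = none → S.p (φ x) = none)
    (hφi : ∀ x, S.q x = none → ∀ y, S.q y = none → φ x = φ y → x = y)
    {I D : Finset α} (hI : S.Sparse I) (hnI : ∀ x, S.q x = none → x ∈ I) (hDI : D ⊆ I)
    (hDq : ∀ x ∈ D, S.q x ≠ none) (hDo : ∀ o, o ≠ none → δ * S.m ≤ #{x ∈ D | S.q x = o})
    (hDN : ∀ o, o ≠ none → (#{z ∈ D.biUnion S.nbr | S.q z = o} : ℝ) ≤ S.d / 16 * S.m)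
    (hLN : ∀ o, o ≠ none → (#{z ∈ (Finset.univ.filter fun x => S.q x = none).biUnion S.nbr |
      S.q z = o} : ℝ) ≤ K₂ * S.d * S.m)
    (hLdeg : ∀ x y, S.q x = none → S.H.Adj x y →
      c * S.m ≤ (#{u | S.p u = S.q y ∧ S.G.Adj (φ x) u} : ℝ))
    (hC8 : ∀ E : Finset β, (∀ v ∈ E, S.p v ≠ none) →
      (∀ o, o ≠ none → (#{v ∈ E | S.p v = o} : ℝ) ≤ ε' * S.m) →
      ∃ (F : Finset α) (f : α → β), F ⊆ I ∧ Disjoint F D ∧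
        (∀ x ∈ F, f x ∈ E ∧ S.p (f x) = S.q x) ∧ Set.InjOn f F ∧ E ⊆ F.image f ∧
        (∀ x ∈ F, ∀ y, S.H.Adj x y →
          (S.d - S.ε) * S.m ≤ (#{u | S.p u = S.q y ∧ S.G.Adj (f x) u} : ℝ)) ∧
        ∀ o, o ≠ none → (#{z ∈ F.biUnion S.nbr | S.q z = o} : ℝ) ≤ K₃ * ε' * S.m) :
    ∃ g : α → β, Function.Injective g ∧ (∀ x y, S.H.Adj x y → S.G.Adj (g x) (g y)) ∧
      (∀ x, S.p (g x) = S.q x) ∧ ∀ x, S.q x = none → g x = φ x := by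
  have hm0 : (0 : ℝ) < S.m := by exact_mod_cast S.m_pos
  have hd0 := S.d_pos
  have hσ0 := S.σ_pos
  have hε0 := S.ε_pos
  have hεσ : S.ε ≤ S.σ := by rw [← hσ]; nlinarith
  have hΔ' : (1 : ℝ) ≤ S.Δ := by exact_mod_cast hΔ
  have hΔσ : S.Δ * S.σ ≤ S.Δ ^ 2 * S.σ := by
    refine mul_le_mul_of_nonneg_right ?_ hσ0.le
    nlinarith
  have hσΔ : S.σ ≤ S.Δ * S.σ := le_mul_of_one_le_left hσ0.le hΔ'
  have hΔε : S.Δ * S.ε ≤ S.Δ * S.σ := mul_le_mul_of_nonneg_left hεσ (by linarith)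
  have hΔε0 : 0 < S.Δ * S.ε := by positivity
  have hdΔ0 : 0 < S.d ^ S.Δ := pow_pos hd0 _
  have hdΔ1 : S.d ^ S.Δ ≤ 1 := pow_le_one₀ hd0.le S.d_le_one
  set ζ := S.d ^ (S.Δ + 1) / 4 with hζ
  have hζ0 : 0 < ζ := by positivity
  have hζ1 : ζ ≤ 1 := by
    have : S.d ^ (S.Δ + 1) ≤ 1 := pow_le_one₀ hd0.le S.d_le_one
    linarith
  have hθ0 : 0 < θ := hθ ▸ pow_pos hζ0 _
  have hθ1 : θ ≤ 1 := hθ ▸ pow_le_one₀ hζ0.le hζ1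
  have hδd : 64 * δ ≤ S.d := by nlinarith
  set L : Finset α := Finset.univ.filter fun x => S.q x = none with hL
  have hLm : ∀ x, x ∈ L ↔ S.q x = none := fun x => by simp [hL]
  have hLI : L ⊆ I := fun x hx => hnI x ((hLm x).1 hx)
  set E : Finset β := Finset.univ.filter fun v => S.p v ≠ none ∧
    θ / 8 * #{x ∈ D | S.q x = S.p v} < (#{x ∈ D | S.q x = S.p v ∧ S.Atyp v x} : ℝ) with hE
  have hEo : ∀ o, o ≠ none → (#{v ∈ E | S.p v = o} : ℝ) ≤ ε' * S.m := by
    intro o ho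
    have h := S.card_exceptional_le (D := D) (fun x hx y => hI.ne_none x (hDI hx) y) (θ / 8) ho
    have : #{v ∈ E | S.p v = o} ≤ #{v | S.p v = o ∧
        θ / 8 * #{x ∈ D | S.q x = o} < (#{x ∈ D | S.q x = o ∧ S.Atyp v x} : ℝ)} := by
      refine Finset.card_le_card fun v hv => ?_
      obtain ⟨hvE, hvo⟩ := Finset.mem_filter.1 hv
      subst hvo
      exact Finset.mem_filter.2 ⟨Finset.mem_univ _, rfl, (Finset.mem_filter.1 hvE).2.2⟩
    have h' : (#{v ∈ E | S.p v = o} : ℝ) ≤ #{v | S.p v = o ∧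
        θ / 8 * #{x ∈ D | S.q x = o} < (#{x ∈ D | S.q x = o ∧ S.Atyp v x} : ℝ)} := by
      exact_mod_cast this
    have h'' := mul_le_mul_of_nonneg_left h' (by positivity : 0 ≤ θ / 8)
    have h7 : S.Δ * S.ε ≤ θ / 8 * ε' := by nlinarith
    have h8 := mul_le_mul_of_nonneg_right h7 hm0.le
    refine le_of_mul_le_mul_left ?_ (by positivity : 0 < θ / 8)
    linarith
  obtain ⟨F, f₀, hFI, hFD, hFf, hFinj, hEF, hFdeg, hFN⟩ :=
    hC8 E (fun v hv => (Finset.mem_filter.1 hv).2.1) hEo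
  have hEp : ∀ v ∈ E, S.p v ≠ none := fun v hv => (Finset.mem_filter.1 hv).2.1
  have hFq : ∀ x ∈ F, S.q x ≠ none := fun x hx => by
    rw [← (hFf x hx).2]; exact hEp _ (hFf x hx).1
  have hFL : Disjoint F L := Finset.disjoint_left.2 fun x hx hx' => hFq x hx ((hLm x).1 hx')
  have hLD : Disjoint L D := Finset.disjoint_left.2 fun x hx hx' => hDq x hx' ((hLm x).1 hx)
  have hFo : ∀ o, o ≠ none → (#{z ∈ F ∪ L | S.q z = o} : ℝ) ≤ ε' * S.m := by
    intro o ho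
    refine le_trans (Nat.cast_le.2 ?_) (hEo o ho)
    refine Finset.card_le_card_of_injOn f₀ (fun z hz => ?_) fun z hz z' hz' => ?_
    · obtain ⟨hz, hzo⟩ := Finset.mem_filter.1 hz
      rcases Finset.mem_union.1 hz with hz | hz
      · exact Finset.mem_filter.2 ⟨(hFf z hz).1, (hFf z hz).2.trans hzo⟩
      · exact absurd (hzo.symm.trans ((hLm z).1 hz)) ho
    · have aux : ∀ z ∈ (↑({z ∈ F ∪ L | S.q z = o} : Finset α) : Set α), z ∈ F := fun z hz => by
        obtain ⟨hz, hzo⟩ := Finset.mem_filter.1 (Finset.mem_coe.1 hz)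
        rcases Finset.mem_union.1 hz with hz | hz
        · exact hz
        · exact absurd (hzo.symm.trans ((hLm z).1 hz)) ho
      exact hFinj (aux z hz) (aux z' hz')
  have hδm : 4 ≤ δ * S.m := by
    have : 4 * S.ε ≤ δ := by linarith
    nlinarith
  set r := ⌊δ / 2 * S.m⌋₊ with hr
  have hr1 : (r : ℝ) ≤ δ / 2 * S.m := Nat.floor_le (by positivity)
  have hr2 : δ / 4 * S.m ≤ r := by
    have := (Nat.lt_floor_add_one (δ / 2 * S.m)).le
    rw [← hr] at this
    linarith
  have hrd : δ / 2 * S.m ≤ S.d / 128 * S.m := mul_le_mul_of_nonneg_right (by linarith) hm0.le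
  have hε'd : ε' * S.m ≤ S.d / 16 * S.m := mul_le_mul_of_nonneg_right (by linarith) hm0.le
  have hdm : S.d * S.m ≤ 1 / 2 * S.m := mul_le_mul_of_nonneg_right hd hm0.le
  obtain ⟨R, hRE, hRr⟩ := S.exists_reserved (E := E) (r := r) (fun o ho => by
    have : (#{v ∈ E | S.p v = o} + r : ℝ) ≤ S.m := by
      have := hEo o ho
      linarith
    exact_mod_cast this)
  let S' : Frame α β ι := { S with R := R, r := r, card_R := hRr }
  let f : α → β := fun x => if S.q x = none then φ x else f₀ x
  have hfL : ∀ x ∈ L, f x = φ x := fun x hx => if_pos ((hLm x).1 hx)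
  have hfF : ∀ x ∈ F, f x = f₀ x := fun x hx => if_neg (hFq x hx)
  have hpf : ∀ x ∈ F ∪ L, S.p (f x) = S.q x := by
    intro x hx
    rcases Finset.mem_union.1 hx with hx | hx
    · rw [hfF x hx, (hFf x hx).2]
    · rw [hfL x hx, (hLm x).1 hx]
      exact hφ x ((hLm x).1 hx)
  have hW : S'.Sparse (F ∪ L ∪ D) := by
    have := hI.mono (Finset.union_subset (Finset.union_subset hFI hLI) hDI)
    exact ⟨this.not_adj, this.eq_of_common, this.eq_of_adj, this.ne_none⟩
  set κ := S.d ^ S.Δ * δ * θ / 32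
  set τ := S.d ^ S.Δ * δ / 16
  set ω := θ * δ / 8 with hω
  have hV : S'.Valid (F ∪ L) κ ∅ f := by
    refine ⟨Finset.disjoint_empty_left _, ?_, fun w hw => absurd hw (Finset.notMem_empty _), ?_, ?_,
      ?_, fun w hw => absurd hw (Finset.notMem_empty _)⟩
    · rw [Finset.empty_union]
      intro x hx y hy hxy
      have hx := Finset.mem_coe.1 hx
      have hy := Finset.mem_coe.1 hy
      have hq : S.q x = S.q y := by rw [← hpf x hx, ← hpf y hy, hxy]
      rcases Finset.mem_union.1 hx with hx' | hx' <;> rcases Finset.mem_union.1 hy with hy' | hy'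
      · rw [hfF x hx', hfF y hy'] at hxy
        exact hFinj hx' hy' hxy
      · exact absurd (hq.trans ((hLm y).1 hy')) (hFq x hx')
      · exact absurd (hq.symm.trans ((hLm x).1 hx')) (hFq y hy')
      · rw [hfL x hx', hfL y hy'] at hxy
        exact hφi x ((hLm x).1 hx') y ((hLm y).1 hy') hxy
    · rw [Finset.empty_union]
      exact hpf
    · rw [Finset.empty_union]
      intro y hy z hz hyz
      exact absurd hyz (hW.not_adj y (Finset.mem_union_left _ hy) z (Finset.mem_union_left _ hz))
    · intro x hx hxR
      obtain ⟨h7, h8⟩ := hRE _ hxR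
      rcases Finset.mem_union.1 hx with hx' | hx'
      · rw [hfF x hx'] at h8
        exact h8 (hFf x hx').1
      · exact h7 ((hpf x hx).trans ((hLm x).1 hx'))
  have hF : S'.Fine δ ω κ τ := fine_of_small (S := S') hΔ hδ0 hθ0 hθ1 hm hσ1 hσ h4 h5 hr2 hr1
  have hζD : S'.Dense ζ := ⟨hζ0, hζ1, dense_of_small hΔ hm hσ1 hσ h6⟩
  have hlog : Real.log S.m ≤ θ / 4 * δ * S.m := log_le_of_small hΔ hδ0 hθ0 hm hσ h4
  obtain ⟨g, hg1, hg2, hg3, hg4⟩ :=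
    Frame.Valid.exists_embedding (S := S') (F := F) (L := L) (D := D)
    (E := E) hV hW hF hζD hFL (Finset.disjoint_union_left.2 ⟨hFD, hLD⟩)
    (fun x hx => Finset.mem_union_right _ ((hLm x).2 hx)) hDo hDq
    (by change S.ε ≤ S.d / 4; linarith)
    (by change ω ≤ ζ ^ S.Δ / 8 * δ; rw [← hθ, hω]; linarith)
    (by change Real.log S.m ≤ ζ ^ S.Δ / 4 * δ * S.m; rw [← hθ]; exact hlog)
    (fun v hv => by
      obtain ⟨x, hx, rfl⟩ := Finset.mem_image.1 (hEF hv)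
      exact Finset.mem_image.2 ⟨x, Finset.mem_union_left _ hx, hfF x hx⟩)
    (fun v hv hpv => by
      change (#{x ∈ D | S.q x = S.p v ∧ S.Atyp v x} : ℝ) ≤
        ζ ^ S.Δ / 8 * #{x ∈ D | S.q x = S.p v}
      rw [← hθ]
      by_contra! hlt
      exact hv (Finset.mem_filter.2 ⟨Finset.mem_univ _, hpv, hlt⟩))
    (fun x hx => by
      change ∃ v, S.p v = S.q x ∧ v ∉ E ∧ ¬ S.Atyp v x
      by_contra! hall
      have e1 := S.card_atyp_le (hDq x hx) (hI.ne_none x (hDI hx))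
      have e2 := hEo _ (hDq x hx)
      have e3 : #{v | S.p v = S.q x} ≤ #{v ∈ E | S.p v = S.q x} +
          #{v | S.p v = S.q x ∧ S.Atyp v x} := by
        refine le_trans (Finset.card_le_card fun v hv => ?_) (Finset.card_union_le _ _)
        have hv := (Finset.mem_filter.1 hv).2
        by_cases hvE : v ∈ E
        · exact Finset.mem_union_left _ (Finset.mem_filter.2 ⟨hvE, hv⟩)
        · exact Finset.mem_union_right _
            (Finset.mem_filter.2 ⟨Finset.mem_univ _, hv, hall v hv hvE⟩)
      rw [S.card_V _ (hDq x hx)] at e3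
      have e4 : (S.m : ℝ) ≤ #{v ∈ E | S.p v = S.q x} +
          #{v | S.p v = S.q x ∧ S.Atyp v x} := by exact_mod_cast e3
      have e5 : S.Δ * S.ε * S.m ≤ S.d / 16 * S.m :=
        mul_le_mul_of_nonneg_right (by linarith) hm0.le
      linarith)
    (fun o ho => by
      change (#{z ∈ (F ∪ D).biUnion S.nbr | S.q z = o} +
        #{z ∈ F ∪ L | S.q z = o} + r : ℝ) ≤ S.d / 4 * S.m
      have e1 : #{z ∈ (F ∪ D).biUnion S.nbr | S.q z = o} ≤
          #{z ∈ F.biUnion S.nbr | S.q z = o} + #{z ∈ D.biUnion S.nbr | S.q z = o} := by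
        rw [Finset.union_biUnion, Finset.filter_union]
        exact Finset.card_union_le _ _
      have e2 : (#{z ∈ (F ∪ D).biUnion S.nbr | S.q z = o} : ℝ) ≤
          #{z ∈ F.biUnion S.nbr | S.q z = o} + #{z ∈ D.biUnion S.nbr | S.q z = o} := by
        exact_mod_cast e1
      have e3 := hFN o ho
      have e4 := hDN o ho
      have e5 := hFo o ho
      have e6 : K₃ * ε' * S.m ≤ S.d / 16 * S.m :=
        mul_le_mul_of_nonneg_right (by linarith) hm0.le
      linarith)
    (fun x hx y hy => by
      rw [hfF x hx]
      refine le_trans ?_ (hFdeg x hx y hy)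
      change 3 / 4 * S.d * S.m ≤ _
      exact mul_le_mul_of_nonneg_right (by linarith) hm0.le)
    (fun x hx y hy => by
      rw [hfL x hx]
      refine le_trans ?_ (hLdeg x y ((hLm x).1 hx) hy)
      change S.d / 2 * S.m + (#{z ∈ (L ∪ (F ∪ D)).biUnion S.nbr | S.q z = S.q y} +
        #{z ∈ F ∪ L | S.q z = S.q y} + (r : ℝ)) ≤ _
      have ho := hI.ne_none x (hLI hx) y hy
      have e1 : #{z ∈ (L ∪ (F ∪ D)).biUnion S.nbr | S.q z = S.q y} ≤
          #{z ∈ L.biUnion S.nbr | S.q z = S.q y} + (#{z ∈ F.biUnion S.nbr | S.q z = S.q y} +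
            #{z ∈ D.biUnion S.nbr | S.q z = S.q y}) := by
        rw [Finset.union_biUnion, Finset.union_biUnion, Finset.filter_union, Finset.filter_union]
        exact (Finset.card_union_le _ _).trans
          (Nat.add_le_add_left (Finset.card_union_le _ _) _)
      have e2 : (#{z ∈ (L ∪ (F ∪ D)).biUnion S.nbr | S.q z = S.q y} : ℝ) ≤
          #{z ∈ L.biUnion S.nbr | S.q z = S.q y} + (#{z ∈ F.biUnion S.nbr | S.q z = S.q y} +
            #{z ∈ D.biUnion S.nbr | S.q z = S.q y}) := by exact_mod_cast e1
      have e3 := hFN _ ho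
      have e4 := hDN _ ho
      have e5 := hFo _ ho
      have e6 : K₃ * ε' * S.m ≤ S.d / 16 * S.m :=
        mul_le_mul_of_nonneg_right (by linarith) hm0.le
      have e7 := hLN _ ho
      have e8 := mul_le_mul_of_nonneg_right hc hm0.le
      have e9 : 0 < S.d * S.m := by positivity
      linarith)
  refine ⟨g, hg1, hg2, hg3, fun x hx => ?_⟩
  have hxL := (hLm x).2 hx
  rw [hg4 x (Finset.mem_union_right _ hxL), hfL x hxL]

end Frame

end BlowUp

namespace ArxivOG

section

open scoped Finset Classical

lemma ncard_eq_card_filter {α : Type*} [Fintype α] {s : Set α} {p : α → Prop}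
    (h : ∀ x, x ∈ s ↔ p x) : s.ncard = #{x | p x} := by
  rw [← Set.ncard_coe_finset]
  congr 1
  ext x
  simp [h]

lemma eCnt_coe {α : Type*} (G : α → α → Prop) (A B : Finset α) :
    eCnt G A B = ∑ u ∈ A, #{v ∈ B | G u v} := by
  have : {p : α × α | p.1 ∈ (A : Set α) ∧ p.2 ∈ (B : Set α) ∧ G p.1 p.2} =
      ((A ×ˢ B).filter fun p : α × α => G p.1 p.2 : Finset (α × α)) := by
    ext p
    simp [and_assoc]
  rw [eCnt, this, Set.ncard_coe_finset, Finset.card_filter, Finset.sum_product]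
  exact Finset.sum_congr rfl fun u _ => (Finset.card_filter _ _).symm

/-- In a regular pair, the number of edges between large subsets is close to the expected one. -/
lemma EpsRegular.abs_sum_sub_lt {α : Type*} {ε d : ℝ} {G : α → α → Prop} {V W : Set α} {m : ℕ}
    (h : EpsRegular ε G V W) (hd : dens G V W = d) (hε : 0 ≤ ε) (hV : V.ncard = m)
    (hW : W.ncard = m) {A B : Finset α} (hA : ∀ a ∈ A, a ∈ V) (hB : ∀ b ∈ B, b ∈ W)
    (hAm : ε * m < #A) (hBm : ε * m < #B) :
    |((∑ u ∈ A, #{v ∈ B | G u v} : ℕ) : ℝ) - d * (#A * #B)| < ε * (#A * #B) := by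
  have hm : 0 ≤ ε * m := mul_nonneg hε (Nat.cast_nonneg _)
  have hpos : (0 : ℝ) < #A * #B := mul_pos (hm.trans_lt hAm) (hm.trans_lt hBm)
  have h1 := h (A : Set α) hA (B : Set α) hB (by simpa [hV] using hAm) (by simpa [hW] using hBm)
  rw [hd, dens, eCnt_coe, Set.ncard_coe_finset, Set.ncard_coe_finset] at h1
  have h2 := mul_lt_mul_of_pos_right h1 hpos
  rw [← abs_of_pos hpos, ← abs_mul, abs_of_pos hpos] at h2
  rwa [sub_mul, div_mul_cancel₀ _ hpos.ne'] at h2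

lemma EpsRegular.card_low_le {α : Type*} [Fintype α] {ε d : ℝ} {G : α → α → Prop} {V W : Set α}
    {m : ℕ} (h : EpsRegular ε G V W) (hd : dens G V W = d) (hd1 : d ≤ 1) (hε : 0 ≤ ε)
    (hV : V.ncard = m) (hW : W.ncard = m) {X : Finset α} (hX : ∀ v ∈ X, v ∈ W) :
    (#{u | u ∈ V ∧ (#{v ∈ X | G u v} : ℝ) < d * #X - ε * m} : ℝ) ≤ ε * m := by
  have hm : 0 ≤ ε * m := mul_nonneg hε (Nat.cast_nonneg _)
  have hXm : (#X : ℝ) ≤ m := by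
    rw [← hW, ← Set.ncard_coe_finset X]
    exact_mod_cast Set.ncard_le_ncard hX (Set.toFinite W)
  by_contra! hlt
  set A : Finset α := Finset.univ.filter fun u => u ∈ V ∧ (#{v ∈ X | G u v} : ℝ) < d * #X - ε * m
  have hA : ∀ a ∈ A, a ∈ V ∧ (#{v ∈ X | G a v} : ℝ) < d * #X - ε * m := fun a ha =>
    (Finset.mem_filter.1 ha).2
  have hA0 : (0 : ℝ) < #A := hm.trans_lt hlt
  obtain ⟨a, ha⟩ : A.Nonempty := by
    rw [← Finset.card_pos]; exact_mod_cast hA0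
  have hXε : ε * m < #X := by
    have h1 := (hA a ha).2
    have h2 : (0 : ℝ) ≤ #{v ∈ X | G a v} := Nat.cast_nonneg _
    have h3 : d * #X ≤ #X := mul_le_of_le_one_left (Nat.cast_nonneg _) hd1
    linarith
  have h1 := (abs_lt.1 (h.abs_sum_sub_lt hd hε hV hW (fun a ha => (hA a ha).1) hX hlt hXε)).1
  have h2 : ((∑ u ∈ A, #{v ∈ X | G u v} : ℕ) : ℝ) ≤ #A * (d * #X - ε * m) := by
    rw [← nsmul_eq_mul]
    push_cast
    exact Finset.sum_le_card_nsmul _ _ _ fun u hu => (hA u hu).2.le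
  have h3 := mul_le_mul_of_nonneg_left (mul_le_mul_of_nonneg_left hXm hε) hA0.le
  linarith

lemma EpsRegular.card_high_le {α : Type*} [Fintype α] {ε d : ℝ} {G : α → α → Prop} {V W : Set α}
    {m : ℕ} (h : EpsRegular ε G V W) (hd : dens G V W = d) (hd0 : 0 < d)
    (hε : 0 ≤ ε) (hV : V.ncard = m) (hW : W.ncard = m) {X : Finset α} (hX : ∀ v ∈ X, v ∈ W) :
    (#{u | u ∈ V ∧ d * #X + ε * m < (#{v ∈ X | G u v} : ℝ)} : ℝ) ≤ ε * m := by
  have hm : 0 ≤ ε * m := mul_nonneg hε (Nat.cast_nonneg _)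
  have hXm : (#X : ℝ) ≤ m := by
    rw [← hW, ← Set.ncard_coe_finset X]
    exact_mod_cast Set.ncard_le_ncard hX (Set.toFinite W)
  by_contra! hlt
  set A : Finset α := Finset.univ.filter fun u => u ∈ V ∧ d * #X + ε * m < (#{v ∈ X | G u v} : ℝ)
  have hA : ∀ a ∈ A, a ∈ V ∧ d * #X + ε * m < (#{v ∈ X | G a v} : ℝ) := fun a ha =>
    (Finset.mem_filter.1 ha).2
  have hA0 : (0 : ℝ) < #A := hm.trans_lt hlt
  obtain ⟨a, ha⟩ : A.Nonempty := by
    rw [← Finset.card_pos]; exact_mod_cast hA0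
  have hXε : ε * m < #X := by
    have h1 := (hA a ha).2
    have h2 : (#{v ∈ X | G a v} : ℝ) ≤ #X := Nat.cast_le.2 (Finset.card_filter_le _ _)
    have h3 : 0 ≤ d * #X := mul_nonneg hd0.le (Nat.cast_nonneg _)
    linarith
  have h1 := (abs_lt.1 (h.abs_sum_sub_lt hd hε hV hW (fun a ha => (hA a ha).1) hX hlt hXε)).2
  have h2 : #A * (d * #X + ε * m) ≤ ((∑ u ∈ A, #{v ∈ X | G u v} : ℕ) : ℝ) := by
    rw [← nsmul_eq_mul]
    push_cast
    exact Finset.card_nsmul_le_sum _ _ _ fun u hu => (hA u hu).2.le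
  have h3 := mul_le_mul_of_nonneg_left (mul_le_mul_of_nonneg_left hXm hε) hA0.le
  linarith

/-- A regular pair whose density is bounded away from `0` and `1` is large. -/
lemma EpsRegular.one_le_mul {α : Type*} {ε d : ℝ} {G : α → α → Prop} {V W : Set α}
    {m : ℕ} (h : EpsRegular ε G V W) (hd : dens G V W = d) (hd1 : ε ≤ d) (hd2 : ε ≤ 1 - d)
    (hε : 0 ≤ ε) (hV : V.ncard = m) (hW : W.ncard = m) (hm : 0 < m) : 1 ≤ ε * m := by
  by_contra! hlt
  obtain ⟨v, hv⟩ : V.Nonempty := Set.nonempty_of_ncard_ne_zero (by omega)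
  obtain ⟨w, hw⟩ : W.Nonempty := Set.nonempty_of_ncard_ne_zero (by omega)
  have h1 := h.abs_sum_sub_lt hd hε hV hW (A := {v}) (B := {w}) (by simpa using hv)
    (by simpa using hw) (by simpa using hlt) (by simpa using hlt)
  by_cases hvw : G v w
  · rw [Finset.sum_singleton, Finset.filter_singleton, if_pos hvw] at h1
    simp only [Finset.card_singleton, Nat.cast_one, mul_one] at h1
    have := (abs_lt.1 h1).2
    linarith
  · rw [Finset.sum_singleton, Finset.filter_singleton, if_neg hvw] at h1
    simp only [Finset.card_singleton, Nat.cast_one, mul_one, Finset.card_empty, Nat.cast_zero]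
      at h1
    have := (abs_lt.1 h1).1
    linarith

lemma exists_sqrt_small {b C : ℝ} (hb : 0 < b) (hC : 0 < C) :
    ∃ ε₂ : ℝ, 0 < ε₂ ∧ ∀ ε : ℝ, 0 < ε → ε ≤ ε₂ → √ε ≤ 1 ∧ C * √ε ≤ b := by
  refine ⟨min 1 ((b / C) ^ 2), by positivity, fun ε _ hε => ⟨?_, ?_⟩⟩
  · exact Real.sqrt_le_one.2 (hε.trans (min_le_left _ _))
  · have : √ε ≤ b / C := Real.sqrt_le_iff.2 ⟨by positivity, hε.trans (min_le_right _ _)⟩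
    rw [mul_comm]
    exact (le_div_iff₀ hC).1 this

section

variable {n k m : ℕ} {G H : SimpleGraph (Fin n)} {P Q : Fin n → Option (Fin k)}
  {φ : Fin n → Fin n} {I : Set (Fin n)}

/-- Vertices at pairwise distance at least `4` are not joined by short paths. -/
lemma sparse_of_four_le_length (hI : ∀ x ∈ I, ∀ y ∈ I, x ≠ y → ∀ p : H.Walk x y, 4 ≤ p.length) :
    (∀ x ∈ I, ∀ y ∈ I, ¬ H.Adj x y) ∧
    (∀ x ∈ I, ∀ x' ∈ I, ∀ y, H.Adj x y → H.Adj x' y → x = x') ∧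
    (∀ x ∈ I, ∀ x' ∈ I, ∀ y z, H.Adj x y → H.Adj x' z → H.Adj y z → x = x') := by
  refine ⟨fun x hx y hy hxy => ?_, fun x hx x' hx' y h1 h2 => ?_,
    fun x hx x' hx' y z h1 h2 h3 => ?_⟩
  · have := hI x hx y hy hxy.ne (.cons hxy .nil)
    simp at this
  · by_contra hne
    have := hI x hx x' hx' hne (.cons h1 (.cons h2.symm .nil))
    simp at this
  · by_contra hne
    have := hI x hx x' hx' hne (.cons h1 (.cons h3 (.cons h2.symm .nil)))
    simp at this

lemma image_cluster_eq (hQ : ∀ i, (cluster Q i).ncard = m) (hP : ∀ i, (cluster P i).ncard = m)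
    {f : Fin n → Fin n} (hf : Function.Injective f) (hPQ : ∀ x, P (f x) = Q x) (i : Fin k) :
    f '' cluster Q i = cluster P i := by
  refine Set.eq_of_subset_of_ncard_le ?_ ?_ (Set.toFinite _)
  · rintro _ ⟨x, hx, rfl⟩
    exact (hPQ x).trans hx
  · rw [Set.ncard_image_of_injective _ hf, hQ, hP]

/-- The blow-up lemma when no guest edge joins two clusters. -/
lemma exists_embedding_of_star (hQ : ∀ i, (cluster Q i).ncard = m)
    (hP : ∀ i, (cluster P i).ncard = m) (hφ : Set.BijOn φ (cluster0 Q) (cluster0 P))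
    (hI : ∀ x ∈ I, ∀ y ∈ I, x ≠ y → ∀ p : H.Walk x y, 4 ≤ p.length) (hQI : cluster0 Q ⊆ I)
    {c b : ℝ} (hbc : b ≤ c)
    (hN : ∀ i : Fin k, ((outNSet H.Adj (cluster0 Q) ∩ cluster Q i).ncard : ℝ) ≤ b * m)
    (hdeg : ∀ x y : Fin n, H.Adj x y → Q x = none → ∀ j : Fin k, Q y = some j →
      c * m ≤ ((G.neighborSet (φ x) ∩ cluster P j).ncard : ℝ))
    (hstar : ∀ x y, H.Adj x y → Q x = none ∨ Q y = none) :
    ∃ f : Fin n → Fin n, Function.Injective f ∧ (∀ x y, H.Adj x y → G.Adj (f x) (f y)) ∧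
      (∀ x, P (f x) = Q x) ∧ ∀ x ∈ cluster0 Q, f x = φ x := by
  obtain ⟨hI1, hI2, -⟩ := sparse_of_four_le_length hI
  let A : Finset (Fin n) := Finset.univ.filter fun y => Q y ≠ none
  let t : Fin n → Finset (Fin n) := fun y => Finset.univ.filter fun v =>
    P v = Q y ∧ ∀ x, Q x = none → H.Adj x y → G.Adj (φ x) v
  have hA : ∀ y, y ∈ A ↔ Q y ≠ none := fun y => by simp [A]
  have ht : ∀ y v, v ∈ t y ↔ P v = Q y ∧ ∀ x, Q x = none → H.Adj x y → G.Adj (φ x) v :=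
    fun y v => by simp [t]
  obtain ⟨f, hf1, hf2, hf3⟩ := BlowUp.exists_injOn_of_hall_fiberwise φ A t Q P
    (fun x _ v hv => ((ht x v).1 hv).1) (by
    intro o s hsA hso
    rcases s.eq_empty_or_nonempty with rfl | ⟨y₀, hy₀⟩
    · simp
    obtain ⟨j, rfl⟩ := Option.ne_none_iff_exists'.1 (hso y₀ hy₀ ▸ (hA y₀).1 (hsA hy₀))
    have hsm : ∀ y ∈ s, y ∈ cluster Q j := hso
    by_cases hall : ∃ y ∈ s, ∀ x, Q x = none → ¬ H.Adj x y
    · obtain ⟨y, hy, hyn⟩ := hall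
      calc #s = (s : Set (Fin n)).ncard := (Set.ncard_coe_finset s).symm
        _ ≤ (cluster Q j).ncard := Set.ncard_le_ncard hsm (Set.toFinite _)
        _ = (cluster P j).ncard := by rw [hQ, hP]
        _ ≤ (↑(s.biUnion t) : Set (Fin n)).ncard := by
          refine Set.ncard_le_ncard (fun v hv => ?_) (Set.toFinite _)
          exact Finset.mem_coe.2 (Finset.mem_biUnion.2 ⟨y, hy, (ht y v).2
            ⟨(hv : P v = some j).trans (hso y hy).symm, fun x hx hxy => absurd hxy (hyn x hx)⟩⟩)
        _ = #(s.biUnion t) := Set.ncard_coe_finset _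
    · push Not at hall
      have h1 : #s ≤ (outNSet H.Adj (cluster0 Q) ∩ cluster Q j).ncard := by
        rw [← Set.ncard_coe_finset s]
        refine Set.ncard_le_ncard (fun y hy => ⟨?_, hsm y hy⟩) (Set.toFinite _)
        obtain ⟨x, hx, hxy⟩ := hall y hy
        exact ⟨x, hx, hxy⟩
      obtain ⟨x₀, hx₀, hxy₀⟩ := hall y₀ hy₀
      have h2 : (G.neighborSet (φ x₀) ∩ cluster P j).ncard ≤ #(s.biUnion t) := by
        rw [← Set.ncard_coe_finset (s.biUnion t)]
        refine Set.ncard_le_ncard (fun v hv => ?_) (Set.toFinite _)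
        refine Finset.mem_coe.2 (Finset.mem_biUnion.2 ⟨y₀, hy₀, (ht y₀ v).2
          ⟨(hv.2 : P v = some j).trans (hso y₀ hy₀).symm, fun x hx hxy => ?_⟩⟩)
        rw [hI2 x (hQI hx) x₀ (hQI hx₀) y₀ hxy hxy₀]
        exact hv.1
      have h3 := hdeg x₀ y₀ hxy₀ hx₀ j (hso y₀ hy₀)
      have h4 := hN j
      have h5 := mul_le_mul_of_nonneg_right hbc (Nat.cast_nonneg m : (0 : ℝ) ≤ m)
      have h6 : (#s : ℝ) ≤ (outNSet H.Adj (cluster0 Q) ∩ cluster Q j).ncard := by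
        exact_mod_cast h1
      have h7 : ((G.neighborSet (φ x₀) ∩ cluster P j).ncard : ℝ) ≤ #(s.biUnion t) := by
        exact_mod_cast h2
      have : (#s : ℝ) ≤ #(s.biUnion t) := by linarith
      exact_mod_cast this)
  have hf0 : ∀ x, Q x = none → f x = φ x := fun x hx => hf3 x fun h => (hA x).1 h hx
  have hfA : ∀ x, Q x ≠ none → f x ∈ t x := fun x hx => hf2 x ((hA x).2 hx)
  have hPQ : ∀ x, P (f x) = Q x := by
    intro x
    by_cases hx : Q x = none
    · rw [hf0 x hx, hx]
      exact hφ.mapsTo hx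
    · exact ((ht x _).1 (hfA x hx)).1
  have hadj : ∀ x y, H.Adj x y → Q x = none → G.Adj (f x) (f y) := by
    intro x y hxy hx
    rw [hf0 x hx]
    have hy : Q y ≠ none := fun hy => hI1 x (hQI hx) y (hQI hy) hxy
    exact ((ht y _).1 (hfA y hy)).2 x hx hxy
  refine ⟨f, fun x y hxy => ?_, fun x y hxy => ?_, hPQ, hf0⟩
  · have hq : Q x = Q y := by rw [← hPQ, ← hPQ, hxy]
    by_cases hx : Q x = none
    · rw [hf0 x hx, hf0 y (hq ▸ hx)] at hxy
      exact hφ.injOn hx (show Q y = none from hq ▸ hx) hxy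
    · exact hf1 ((hA x).2 hx) ((hA y).2 (hq ▸ hx)) hxy
  · rcases hstar x y hxy with h | h
    · exact hadj x y hxy h
    · exact (hadj y x hxy.symm h).symm

end
section

variable {n k m : ℕ} {G H : SimpleGraph (Fin n)} {P Q : Fin n → Option (Fin k)}
  {φ : Fin n → Fin n} {I : Set (Fin n)} {d ε : ℝ} {Δ : ℕ}

lemma card_filter_cluster {P : Fin n → Option (Fin k)} (hP : ∀ i, (cluster P i).ncard = m)
    (o : Option (Fin k)) (ho : o ≠ none) : #{v | P v = o} = m := by
  obtain ⟨i, rfl⟩ := Option.ne_none_iff_exists'.1 ho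
  rw [← hP i, ncard_eq_card_filter (s := cluster P i) (p := fun v => P v = some i)
    fun _ => Iff.rfl]
  congr

/-- The blow-up problem given by regular pairs, with an empty reserved set. -/
noncomputable def frame (hm : 0 < m) (hd0 : 0 < d) (hd1 : d ≤ 1) (hε : 0 < ε)
    (hQ : ∀ i, (cluster Q i).ncard = m) (hP : ∀ i, (cluster P i).ncard = m)
    (hΔ : ∀ v, (H.neighborSet v).ncard ≤ Δ)
    (hreg : ∀ x y : Fin n, H.Adj x y → ∀ i j : Fin k, Q x = some i → Q y = some j →
      EpsRegular ε G.Adj (cluster P i) (cluster P j) ∧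
      dens G.Adj (cluster P i) (cluster P j) = d) : BlowUp.Frame (Fin n) (Fin n) (Fin k) where
  G := G
  H := H
  p := P
  q := Q
  m := m
  Δ := Δ
  d := d
  ε := ε
  σ := √ε
  R := ∅
  r := 0
  m_pos := hm
  d_pos := hd0
  d_le_one := hd1
  ε_pos := hε
  σ_pos := Real.sqrt_pos.2 hε
  ε_le := (Real.sq_sqrt hε.le).ge
  card_L := card_filter_cluster hQ
  card_V := card_filter_cluster hP
  card_R o _ := by simp
  deg_le z := by
    rw [← ncard_eq_card_filter (s := H.neighborSet z) (p := fun y => H.Adj z y) fun _ => Iff.rfl]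
    exact hΔ z
  reg_low w z hwz hw hz X hX := by
    obtain ⟨i, hi⟩ := Option.ne_none_iff_exists'.1 hw
    obtain ⟨j, hj⟩ := Option.ne_none_iff_exists'.1 hz
    obtain ⟨h1, h2⟩ := hreg w z hwz i j hi hj
    refine le_trans (Nat.cast_le.2 (Finset.card_le_card fun u hu => ?_))
      (h1.card_low_le h2 hd1 hε.le (hP i) (hP j) (X := X) fun v hv => (hX v hv).trans hj)
    obtain ⟨-, hu, hu'⟩ := Finset.mem_filter.1 hu
    exact Finset.mem_filter.2 ⟨Finset.mem_univ _, hu.trans hi, hu'⟩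
  reg_high w z hwz hw hz X hX := by
    obtain ⟨i, hi⟩ := Option.ne_none_iff_exists'.1 hw
    obtain ⟨j, hj⟩ := Option.ne_none_iff_exists'.1 hz
    obtain ⟨h1, h2⟩ := hreg w z hwz i j hi hj
    refine le_trans (Nat.cast_le.2 (Finset.card_le_card fun u hu => ?_))
      (h1.card_high_le h2 hd0 hε.le (hP i) (hP j) (X := X) fun v hv => (hX v hv).trans hj)
    obtain ⟨-, hu, hu'⟩ := Finset.mem_filter.1 hu
    exact Finset.mem_filter.2 ⟨Finset.mem_univ _, hu.trans hi, hu'⟩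

lemma card_filter_biUnion_nbr (S : BlowUp.Frame (Fin n) (Fin n) (Fin k)) {A : Finset (Fin n)}
    {B : Set (Fin n)} (hAB : ∀ x, x ∈ A ↔ x ∈ B) {o : Option (Fin k)} {i : Fin k}
    (ho : o = some i) :
    #{z ∈ A.biUnion S.nbr | S.q z = o} = (outNSet S.H.Adj B ∩ cluster S.q i).ncard := by
  subst ho
  rw [← Set.ncard_coe_finset]
  congr 1
  ext z
  simp [outNSet, cluster, BlowUp.Frame.mem_nbr, hAB]

lemma sum_card_filter_some_le (Q : Fin n → Option (Fin k)) (A : Finset (Fin n)) :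
    ∑ i, #{z ∈ A | Q z = some i} ≤ #A := by
  have h : #A = ∑ o : Option (Fin k), #{z ∈ A | Q z = o} :=
    Finset.card_eq_sum_card_fiberwise fun x _ => Finset.mem_coe.2 (Finset.mem_univ _)
  rw [h, Fintype.sum_option]
  exact Nat.le_add_left _ _

/-- Neighbourhoods of a balanced set which meet all clusters almost equally are small. -/
lemma card_filter_biUnion_nbr_le (S : BlowUp.Frame (Fin n) (Fin n) (Fin k)) {D : Finset (Fin n)}
    {t : ℕ} {η : ℝ} (hη : 0 ≤ η) (hDq : ∀ x ∈ D, S.q x ≠ none)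
    (hD : ∀ i, #{x ∈ D | S.q x = some i} = t)
    (hb : ∀ i j, i ≠ j → |(#{z ∈ D.biUnion S.nbr | S.q z = some i} : ℝ) -
      #{z ∈ D.biUnion S.nbr | S.q z = some j}| < η) (i : Fin k) :
    (#{z ∈ D.biUnion S.nbr | S.q z = some i} : ℝ) ≤ S.Δ * t + η := by
  have h1 : #D = k * t := by
    have h : #D = ∑ o : Option (Fin k), #{z ∈ D | S.q z = o} :=
      Finset.card_eq_sum_card_fiberwise fun x _ => Finset.mem_coe.2 (Finset.mem_univ _)
    have h0 : #{z ∈ D | S.q z = none} = 0 := by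
      rw [Finset.card_eq_zero]
      exact Finset.filter_eq_empty_iff.2 hDq
    rw [h, Fintype.sum_option, h0]
    simp [hD]
  have h2 : ∑ j, #{z ∈ D.biUnion S.nbr | S.q z = some j} ≤ ∑ _j : Fin k, S.Δ * t := by
    refine (sum_card_filter_some_le _ _).trans ?_
    refine (Finset.card_biUnion_le_card_mul _ _ S.Δ fun x _ => S.deg_le x).trans ?_
    rw [h1, Finset.sum_const, Finset.card_univ, Fintype.card_fin, smul_eq_mul]
    exact le_of_eq (by ring)
  obtain ⟨j, -, hj⟩ := Finset.exists_le_of_sum_le ⟨i, Finset.mem_univ i⟩ h2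
  have hj' : (#{z ∈ D.biUnion S.nbr | S.q z = some j} : ℝ) ≤ S.Δ * t := by exact_mod_cast hj
  rcases eq_or_ne i j with rfl | hij
  · linarith
  · have := (abs_lt.1 (hb i j hij)).2
    linarith

/-- The covering condition for exceptional vertices, expressed with a single partial embedding. -/
lemma exists_cover {K : ℝ} (Ds : Fin k → Set (Fin n)) {ε' : ℝ}
    (hI1 : ∀ x ∈ I, ∀ y ∈ I, ¬ H.Adj x y) (hQI : cluster0 Q ⊆ I)
    (h : ∀ Es : Fin k → Set (Fin n), (∀ i, Es i ⊆ cluster P i) →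
      (∀ i, ((Es i).ncard : ℝ) ≤ ε' * m) →
      ∃ (Fs : Fin k → Set (Fin n)) (ψ : Fin k → Fin n → Fin n),
        (∀ i, Fs i ⊆ cluster Q i ∩ (I \ ⋃ l, Ds l)) ∧
        (∀ i, Set.BijOn (ψ i) (Es i) (Fs i)) ∧
        (∀ i, ∀ v ∈ Es i, ∀ j : Fin k,
          (H.neighborSet (ψ i v) ∩ cluster Q j).Nonempty →
          (d - ε) * m ≤ ((G.neighborSet v ∩ cluster P j).ncard : ℝ)) ∧
        (∀ i : Fin k,
          ((outNSet H.Adj (⋃ l, Fs l) ∩ cluster Q i).ncard : ℝ) ≤ K * ε' * m))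
    (E : Finset (Fin n)) (hE : ∀ v ∈ E, P v ≠ none)
    (hEm : ∀ o, o ≠ none → (#{v ∈ E | P v = o} : ℝ) ≤ ε' * m) :
    ∃ (F : Finset (Fin n)) (f : Fin n → Fin n), (∀ x ∈ F, x ∈ I ∧ x ∉ ⋃ l, Ds l) ∧
      (∀ x ∈ F, f x ∈ E ∧ P (f x) = Q x) ∧ Set.InjOn f F ∧ E ⊆ F.image f ∧
      (∀ x ∈ F, ∀ y, H.Adj x y →
        (d - ε) * m ≤ (#{u | P u = Q y ∧ G.Adj (f x) u} : ℝ)) ∧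
      ∀ i, ((outNSet H.Adj (F : Set (Fin n)) ∩ cluster Q i).ncard : ℝ) ≤ K * ε' * m := by
  obtain ⟨Fs, ψ, h1, h2, h3, h4⟩ := h (fun i => {v | v ∈ E ∧ P v = some i}) (fun i v hv => hv.2)
    fun i => by
      refine le_trans (le_of_eq ?_) (hEm (some i) (Option.some_ne_none i))
      rw [← Set.ncard_coe_finset]
      congr 2
      ext v
      simp
  have hinv : ∀ x, ∃ v, ∀ i, x ∈ Fs i → (v ∈ E ∧ P v = some i) ∧ ψ i v = x := by
    intro x
    by_cases hx : ∃ i, x ∈ Fs i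
    · obtain ⟨i, hi⟩ := hx
      obtain ⟨v, hv, hvx⟩ := (h2 i).surjOn hi
      refine ⟨v, fun j hj => ?_⟩
      have : some i = some j := ((h1 i hi).1 : Q x = some i).symm.trans (h1 j hj).1
      obtain rfl := Option.some.inj this
      exact ⟨hv, hvx⟩
    · exact ⟨x, fun i hi => absurd ⟨i, hi⟩ hx⟩
  choose f hf using hinv
  let F : Finset (Fin n) := Finset.univ.filter fun x => ∃ i, x ∈ Fs i
  have hF : ∀ x, x ∈ F ↔ ∃ i, x ∈ Fs i := fun x => by simp [F]
  have hFs : (F : Set (Fin n)) = ⋃ l, Fs l := by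
    ext x
    simp [F]
  refine ⟨F, f, fun x hx => ?_, fun x hx => ?_, fun x hx y hy hxy => ?_, fun v hv => ?_,
    fun x hx y hxy => ?_, fun i => ?_⟩
  · obtain ⟨i, hi⟩ := (hF x).1 hx
    exact (h1 i hi).2
  · obtain ⟨i, hi⟩ := (hF x).1 hx
    exact ⟨(hf x i hi).1.1, (hf x i hi).1.2.trans ((h1 i hi).1 : Q x = some i).symm⟩
  · obtain ⟨i, hi⟩ := (hF x).1 hx
    obtain ⟨j, hj⟩ := (hF y).1 hy
    have : some i = some j := by rw [← (hf x i hi).1.2, ← (hf y j hj).1.2, hxy]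
    obtain rfl := Option.some.inj this
    rw [← (hf x i hi).2, ← (hf y i hj).2, hxy]
  · obtain ⟨i, hi⟩ := Option.ne_none_iff_exists'.1 (hE v hv)
    have hvi : ψ i v ∈ Fs i := (h2 i).mapsTo ⟨hv, hi⟩
    refine Finset.mem_image.2 ⟨ψ i v, (hF _).2 ⟨i, hvi⟩, ?_⟩
    exact (h2 i).injOn (hf _ i hvi).1 ⟨hv, hi⟩ (hf _ i hvi).2
  · obtain ⟨i, hi⟩ := (hF x).1 hx
    have hy : Q y ≠ none := fun hy => hI1 x (h1 i hi).2.1 y (hQI hy) hxy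
    obtain ⟨j, hj⟩ := Option.ne_none_iff_exists'.1 hy
    have h5 := h3 i (f x) (hf x i hi).1 j ⟨y, by rw [(hf x i hi).2]; exact ⟨hxy, hj⟩⟩
    refine h5.trans (le_of_eq ?_)
    rw [hj, ncard_eq_card_filter (s := G.neighborSet (f x) ∩ cluster P j)
      (p := fun u => P u = some j ∧ G.Adj (f x) u) fun u => and_comm]
    congr!
  · rw [hFs]
    exact h4 i

end

section

variable {n k m : ℕ} {G H : SimpleGraph (Fin n)} {P Q : Fin n → Option (Fin k)}
  {φ : Fin n → Fin n} {I : Set (Fin n)} {d ε : ℝ} {Δ : ℕ}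

/-- The blow-up lemma when some guest edge joins two clusters, with explicit constants. -/
lemma exists_embedding_of_edge {δ ε' K₂ K₃ c θ : ℝ} (hΔ0 : 1 ≤ Δ) (hd0 : 0 < d) (hd : d ≤ 1 / 2)
    (hc : d + K₂ * d ≤ c) (hδ0 : 0 < δ) (hδ : 64 * Δ * δ ≤ d) (hε'0 : 0 < ε')
    (hε' : 16 * ε' ≤ d) (hK₃ : 16 * (K₃ * ε') ≤ d) (hε : 0 < ε) (hσ1 : √ε ≤ 1)
    (hθ : θ = (d ^ (Δ + 1) / 4) ^ Δ)
    (h1 : 16 * Δ ^ 2 * √ε ≤ d / 16) (h2 : 16 * Δ ^ 2 * √ε ≤ ε' * θ)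
    (h3 : 16 * Δ ^ 2 * √ε ≤ δ / 4) (h4 : 16 * Δ ^ 2 * √ε ≤ d ^ Δ * δ * θ / 64)
    (h5 : 16 * Δ ^ 2 * √ε ≤ (d ^ Δ * δ / 16 * (3 / 4 * (d ^ Δ * (θ * δ / 8)))) ^ 2 / 2)
    (h6 : 16 * Δ ^ 2 * √ε ≤ d ^ (Δ + 1) / 4)
    (hQ : ∀ i, (cluster Q i).ncard = m) (hP : ∀ i, (cluster P i).ncard = m)
    (hΔ : ∀ v, (H.neighborSet v).ncard ≤ Δ) (hφ : Set.BijOn φ (cluster0 Q) (cluster0 P))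
    (hI : ∀ x ∈ I, ∀ y ∈ I, x ≠ y → ∀ p : H.Walk x y, 4 ≤ p.length) {Ds : Fin k → Set (Fin n)}
    (hQI : cluster0 Q ⊆ I)
    (hC4 : ∀ i : Fin k, ((outNSet H.Adj (cluster0 Q) ∩ cluster Q i).ncard : ℝ) ≤ K₂ * d * m)
    (hD : ∀ i : Fin k, Ds i ⊆ I ∩ cluster Q i ∧ (Ds i).ncard = ⌈δ * (m : ℝ)⌉₊)
    (hDN : ∀ i j : Fin k, i ≠ j →
      |((outNSet H.Adj (⋃ l, Ds l) ∩ cluster Q i).ncard : ℝ) -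
        ((outNSet H.Adj (⋃ l, Ds l) ∩ cluster Q j).ncard : ℝ)| < ε * m)
    (hreg : ∀ x y : Fin n, H.Adj x y → ∀ i j : Fin k, Q x = some i → Q y = some j →
      EpsRegular ε G.Adj (cluster P i) (cluster P j) ∧
      dens G.Adj (cluster P i) (cluster P j) = d)
    (hC7 : ∀ x y : Fin n, H.Adj x y → Q x = none → ∀ j : Fin k, Q y = some j →
      c * m ≤ ((G.neighborSet (φ x) ∩ cluster P j).ncard : ℝ))
    (hC8 : ∀ Es : Fin k → Set (Fin n), (∀ i, Es i ⊆ cluster P i) →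
      (∀ i, ((Es i).ncard : ℝ) ≤ ε' * m) →
      ∃ (Fs : Fin k → Set (Fin n)) (ψ : Fin k → Fin n → Fin n),
        (∀ i, Fs i ⊆ cluster Q i ∩ (I \ ⋃ l, Ds l)) ∧
        (∀ i, Set.BijOn (ψ i) (Es i) (Fs i)) ∧
        (∀ i, ∀ v ∈ Es i, ∀ j : Fin k,
          (H.neighborSet (ψ i v) ∩ cluster Q j).Nonempty →
          (d - ε) * m ≤ ((G.neighborSet v ∩ cluster P j).ncard : ℝ)) ∧
        (∀ i : Fin k,
          ((outNSet H.Adj (⋃ l, Fs l) ∩ cluster Q i).ncard : ℝ) ≤ K₃ * ε' * m))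
    (hedge : ∃ x y, H.Adj x y ∧ Q x ≠ none ∧ Q y ≠ none) :
    ∃ f : Fin n → Fin n, Function.Injective f ∧ (∀ x y, H.Adj x y → G.Adj (f x) (f y)) ∧
      (∀ x, P (f x) = Q x) ∧ ∀ x ∈ cluster0 Q, f x = φ x := by
  have hΔ' : (1 : ℝ) ≤ Δ := by exact_mod_cast hΔ0
  have hσ0 : 0 < √ε := Real.sqrt_pos.2 hε
  have hσ : √ε ^ 2 = ε := Real.sq_sqrt hε.le
  have hεσ : ε ≤ √ε := by nlinarith
  have hΔσ : Δ * √ε ≤ Δ ^ 2 * √ε := mul_le_mul_of_nonneg_right (by nlinarith) hσ0.le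
  have hσΔ : √ε ≤ Δ * √ε := le_mul_of_one_le_left hσ0.le hΔ'
  have hΔε : Δ * ε ≤ Δ * √ε := mul_le_mul_of_nonneg_left hεσ (by linarith)
  have hεm : 1 ≤ ε * m ∧ 0 < m := by
    obtain ⟨x, y, hxy, hx, hy⟩ := hedge
    obtain ⟨i, hi⟩ := Option.ne_none_iff_exists'.1 hx
    obtain ⟨j, hj⟩ := Option.ne_none_iff_exists'.1 hy
    have hm : 0 < m := by
      rw [← hQ i, Set.ncard_pos]
      exact ⟨x, hi⟩
    obtain ⟨h7, h8⟩ := hreg x y hxy i j hi hj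
    exact ⟨h7.one_le_mul h8 (by linarith) (by linarith) hε.le (hP i) (hP j) hm, hm⟩
  obtain ⟨hεm, hm⟩ := hεm
  have hm0 : (0 : ℝ) < m := by exact_mod_cast hm
  obtain ⟨hI1, hI2, hI3⟩ := sparse_of_four_le_length hI
  let S := frame (G := G) (H := H) (P := P) (Q := Q) hm hd0 (by linarith : d ≤ 1) hε hQ hP hΔ hreg
  let I' : Finset (Fin n) := Finset.univ.filter fun x => x ∈ I
  let D : Finset (Fin n) := Finset.univ.filter fun x => x ∈ ⋃ l, Ds l
  have hI' : ∀ x, x ∈ I' ↔ x ∈ I := fun x => by simp [I']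
  have hDm : ∀ x, x ∈ D ↔ x ∈ ⋃ l, Ds l := fun x => by simp [D]
  have hDx : ∀ x, x ∈ D ↔ ∃ l, x ∈ Ds l := fun x => (hDm x).trans Set.mem_iUnion
  have hsp : S.Sparse I' :=
    ⟨fun x hx y hy => hI1 x ((hI' x).1 hx) y ((hI' y).1 hy),
      fun x hx y hy => hI2 x ((hI' x).1 hx) y ((hI' y).1 hy),
      fun x hx y hy => hI3 x ((hI' x).1 hx) y ((hI' y).1 hy),
      fun x hx y hxy hy => hI1 x ((hI' x).1 hx) y (hQI hy) hxy⟩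
  have hDq : ∀ x ∈ D, S.q x ≠ none := fun x hx => by
    obtain ⟨l, hl⟩ := (hDx x).1 hx
    have : Q x = some l := ((hD l).1 hl).2
    exact fun h => Option.some_ne_none l (this.symm.trans h)
  have hDi : ∀ i, #{x ∈ D | S.q x = some i} = ⌈δ * (m : ℝ)⌉₊ := by
    intro i
    rw [← (hD i).2, ← Set.ncard_coe_finset]
    congr 1
    ext x
    simp only [Finset.coe_filter, Set.mem_ofPred_eq, hDx]
    constructor
    · rintro ⟨⟨l, hl⟩, hx⟩
      have : some l = some i := (((hD l).1 hl).2 : Q x = some l).symm.trans hx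
      obtain rfl := Option.some.inj this
      exact hl
    · exact fun hx => ⟨⟨i, hx⟩, ((hD i).1 hx).2⟩
  have hεm' : ε * m ≤ √ε * m := mul_le_mul_of_nonneg_right hεσ hm0.le
  obtain ⟨g, hg1, hg2, hg3, hg4⟩ := S.exists_blowUp φ hΔ0 hc hδ0 hδ hε'0 hε' hK₃ hd hεm hσ1 hσ hθ
    h1 h2 h3 h4 h5 h6 (fun x hx => hφ.mapsTo hx) (fun x hx y hy hxy => hφ.injOn hx hy hxy) hsp
    (fun x hx => (hI' x).2 (hQI hx)) (D := D)
    (fun x hx => by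
      obtain ⟨l, hl⟩ := (hDx x).1 hx
      exact (hI' x).2 ((hD l).1 hl).1) hDq
    (fun o ho => by
      obtain ⟨i, rfl⟩ := Option.ne_none_iff_exists'.1 ho
      rw [hDi]
      exact Nat.le_ceil _)
    (fun o ho => by
      obtain ⟨i, rfl⟩ := Option.ne_none_iff_exists'.1 ho
      have h7 := card_filter_biUnion_nbr_le S (η := ε * m) (by positivity) hDq hDi
        (fun i j hij => by
          rw [card_filter_biUnion_nbr S hDm (i := i) rfl,
            card_filter_biUnion_nbr S hDm (i := j) rfl]
          exact hDN i j hij) i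
      have h8 : (⌈δ * (m : ℝ)⌉₊ : ℝ) ≤ δ * m + 1 :=
        (Nat.ceil_lt_add_one (by positivity)).le
      have h9 : (Δ : ℝ) * ⌈δ * (m : ℝ)⌉₊ ≤ Δ * (δ * m + ε * m) :=
        mul_le_mul_of_nonneg_left (by linarith) (by linarith)
      have h10 : Δ * δ + Δ * ε + ε ≤ d / 16 := by linarith
      have h11 := mul_le_mul_of_nonneg_right h10 hm0.le
      refine h7.trans ?_
      change (Δ : ℝ) * ⌈δ * (m : ℝ)⌉₊ + ε * m ≤ d / 16 * m
      linarith)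
    (fun o ho => by
      obtain ⟨i, rfl⟩ := Option.ne_none_iff_exists'.1 ho
      rw [card_filter_biUnion_nbr S (B := cluster0 Q) (fun x => by simp [cluster0]; rfl)
        (i := i) rfl]
      exact hC4 i)
    (fun x y hx hxy => by
      have hy : Q y ≠ none := fun hy => hI1 x (hQI hx) y (hQI hy) hxy
      obtain ⟨j, hj⟩ := Option.ne_none_iff_exists'.1 hy
      refine (hC7 x y hxy hx j hj).trans (le_of_eq ?_)
      change _ = ((#{u | P u = Q y ∧ G.Adj (φ x) u} : ℕ) : ℝ)
      rw [hj, ncard_eq_card_filter (s := G.neighborSet (φ x) ∩ cluster P j)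
        (p := fun u => P u = some j ∧ G.Adj (φ x) u) fun u => and_comm]
      congr!)
    (fun E hE hEm => by
      obtain ⟨F, f, hF1, hF2, hF3, hF4, hF5, hF6⟩ := exists_cover Ds hI1 hQI hC8 E hE hEm
      refine ⟨F, f, fun x hx => (hI' x).2 (hF1 x hx).1, Finset.disjoint_left.2 fun x hx hx' =>
        (hF1 x hx).2 ((hDm x).1 hx'), hF2, hF3, hF4, hF5, fun o ho => ?_⟩
      obtain ⟨i, rfl⟩ := Option.ne_none_iff_exists'.1 ho
      rw [card_filter_biUnion_nbr S (B := (F : Set (Fin n))) (fun x => Iff.rfl) (i := i) rfl]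
      exact hF6 i)
  exact ⟨g, hg1, hg2, hg3, hg4⟩

end

end

/-- **Lemma 7 (Blow-up Lemma, Csaba's version).**
For all `Δ, K₁, K₂, K₃` and every positive `c` there is `N` such that, under the hierarchy
`0 < ε ≪ ε' ≪ δ' ≪ d ≪ 1/Δ, 1/K₁, 1/K₂, 1/K₃, c`, the following holds. Let `G'` be a graph
on `n ≥ N` vertices with vertex partition `V₀, V₁, …, V_k` (encoded by `P`) whose pairs
`(V_i,V_j)` are `ε`-regular of density `0` or `d`; let `H` be a graph on `n` vertices with
`Δ(H) ≤ Δ` and vertex partition `L₀, L₁, …, L_k` (encoded by `Q`) with `|L_i| = |V_i| = m`;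
suppose `φ : L₀ → V₀` is a bijection and `I ⊆ V(H)` is a set of vertices at pairwise
distance at least `4` satisfying (C1)–(C9). Then `G'` contains a copy of `H` mapping each
`L_i` onto `V_i` and each `x ∈ L₀` to `φ(x)`. -/
theorem blow_up_lemma_csaba :
    ∀ (Δ : ℕ) (K₁ K₂ K₃ c : ℝ), 0 < Δ → 0 < K₁ → 0 < K₂ → 0 < K₃ → 0 < c →
    ∃ N : ℕ,
    ∃ d₀ : ℝ, 0 < d₀ ∧ ∀ d : ℝ, 0 < d → d ≤ d₀ →
    ∃ δ₀ : ℝ, 0 < δ₀ ∧ ∀ δ' : ℝ, 0 < δ' → δ' ≤ δ₀ →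
    ∃ ε₁ : ℝ, 0 < ε₁ ∧ ∀ ε' : ℝ, 0 < ε' → ε' ≤ ε₁ →
    ∃ ε₂ : ℝ, 0 < ε₂ ∧ ∀ ε : ℝ, 0 < ε → ε ≤ ε₂ →
    ∀ n : ℕ, N ≤ n →
    ∀ k : ℕ,
    ∀ G' : SimpleGraph (Fin n),
    ∀ P : Fin n → Option (Fin k),
    (∀ i j : Fin k, i ≠ j →
      EpsRegular ε G'.Adj (cluster P i) (cluster P j) ∧
      (dens G'.Adj (cluster P i) (cluster P j) = 0 ∨
        dens G'.Adj (cluster P i) (cluster P j) = d)) →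
    ∀ H : SimpleGraph (Fin n),
    (∀ v, (H.neighborSet v).ncard ≤ Δ) →
    ∀ Q : Fin n → Option (Fin k),
    ∀ m : ℕ,
    (∀ i : Fin k, (cluster Q i).ncard = m ∧ (cluster P i).ncard = m) →
    ∀ φ : Fin n → Fin n, Set.BijOn φ (cluster0 Q) (cluster0 P) →
    ∀ I : Set (Fin n),
    -- the vertices of `I` are at pairwise distance at least 4 in `H`
    (∀ x ∈ I, ∀ y ∈ I, x ≠ y → ∀ p : H.Walk x y, 4 ≤ p.length) →
    ∀ Ds : Fin k → Set (Fin n),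
    -- (C1)
    ((cluster0 Q).ncard : ℝ) ≤ K₁ * d * n →
    -- (C2)
    cluster0 Q ⊆ I →
    -- (C3)
    (∀ i : Fin k, ∀ x ∈ cluster Q i, ∀ y ∈ cluster Q i, ¬ H.Adj x y) →
    -- (C4)
    (∀ i : Fin k,
      ((outNSet H.Adj (cluster0 Q) ∩ cluster Q i).ncard : ℝ) ≤ K₂ * d * m) →
    -- (C5)
    (∀ i : Fin k, Ds i ⊆ I ∩ cluster Q i ∧ (Ds i).ncard = ⌈δ' * (m : ℝ)⌉₊) →
    (∀ i j : Fin k, i ≠ j →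
      |((outNSet H.Adj (⋃ l, Ds l) ∩ cluster Q i).ncard : ℝ) -
        ((outNSet H.Adj (⋃ l, Ds l) ∩ cluster Q j).ncard : ℝ)| < ε * m) →
    -- (C6)
    (∀ x y : Fin n, H.Adj x y → ∀ i j : Fin k, Q x = some i → Q y = some j →
      EpsRegular ε G'.Adj (cluster P i) (cluster P j) ∧
      dens G'.Adj (cluster P i) (cluster P j) = d) →
    -- (C7)
    (∀ x y : Fin n, H.Adj x y → Q x = none → ∀ j : Fin k, Q y = some j →
      c * m ≤ ((G'.neighborSet (φ x) ∩ cluster P j).ncard : ℝ)) →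
    -- (C8) and (C9)
    (∀ Es : Fin k → Set (Fin n), (∀ i, Es i ⊆ cluster P i) →
      (∀ i, ((Es i).ncard : ℝ) ≤ ε' * m) →
      ∃ (Fs : Fin k → Set (Fin n)) (ψ : Fin k → Fin n → Fin n),
        (∀ i, Fs i ⊆ cluster Q i ∩ (I \ ⋃ l, Ds l)) ∧
        (∀ i, Set.BijOn (ψ i) (Es i) (Fs i)) ∧
        (∀ i, ∀ v ∈ Es i, ∀ j : Fin k,
          (H.neighborSet (ψ i v) ∩ cluster Q j).Nonempty →
          (d - ε) * m ≤ ((G'.neighborSet v ∩ cluster P j).ncard : ℝ)) ∧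
        (∀ i : Fin k,
          ((outNSet H.Adj (⋃ l, Fs l) ∩ cluster Q i).ncard : ℝ) ≤ K₃ * ε' * m)) →
    ∃ f : Fin n → Fin n,
      Function.Injective f ∧
      (∀ x y, H.Adj x y → G'.Adj (f x) (f y)) ∧
      (∀ i : Fin k, f '' cluster Q i = cluster P i) ∧
      (∀ x ∈ cluster0 Q, f x = φ x) := by
  intro Δ K₁ K₂ K₃ c hΔ _ hK₂ hK₃ hc
  refine ⟨0, min (1 / 2) (c / (1 + K₂)), by positivity, fun d hd hd₀ => ?_⟩
  have hΔ' : (0 : ℝ) < Δ := by exact_mod_cast hΔ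
  have hdc : d + K₂ * d ≤ c := by
    have := (le_div_iff₀ (by positivity)).1 (hd₀.trans (min_le_right _ _))
    linarith
  refine ⟨d / (64 * Δ), by positivity, fun δ' hδ hδ₀ => ?_⟩
  have hδd : 64 * Δ * δ' ≤ d := by
    rw [mul_comm]
    exact (le_div_iff₀ (by positivity)).1 hδ₀
  refine ⟨min (d / 16) (d / (16 * K₃)), by positivity, fun ε' hε' hε₁ => ?_⟩
  have hε'd : 16 * ε' ≤ d := by linarith [hε₁.trans (min_le_left _ _)]
  have hε'K : 16 * (K₃ * ε') ≤ d := by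
    have := (le_div_iff₀ (by positivity)).1 (hε₁.trans (min_le_right _ _))
    linarith
  obtain ⟨θ, hθ⟩ : ∃ θ, θ = (d ^ (Δ + 1) / 4) ^ Δ := ⟨_, rfl⟩
  have hθ0 : 0 < θ := by rw [hθ]; positivity
  obtain ⟨b, hb⟩ : ∃ b, b = min (min (min (d / 16) (ε' * θ)) (min (δ' / 4) (d ^ Δ * δ' * θ / 64)))
      (min ((d ^ Δ * δ' / 16 * (3 / 4 * (d ^ Δ * (θ * δ' / 8)))) ^ 2 / 2) (d ^ (Δ + 1) / 4)) :=
    ⟨_, rfl⟩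
  obtain ⟨ε₂, hε₂, h⟩ := exists_sqrt_small (b := b) (C := 16 * Δ ^ 2) (by rw [hb]; positivity)
    (by positivity)
  refine ⟨ε₂, hε₂, fun ε hε hεε₂ => ?_⟩
  obtain ⟨hσ1, hσb⟩ := h ε hε hεε₂
  rw [hb] at hσb
  simp only [le_min_iff] at hσb
  obtain ⟨⟨⟨h1, h2⟩, h3, h4⟩, h5, h6⟩ := hσb
  intro n _ k G' P _ H hH Q m hm φ hφ I hI Ds _ hC2 _ hC4 hC5 hC5' hC6 hC7 hC8
  have hQm : ∀ i, (cluster Q i).ncard = m := fun i => (hm i).1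
  have hPm : ∀ i, (cluster P i).ncard = m := fun i => (hm i).2
  have key : ∃ f : Fin n → Fin n, Function.Injective f ∧
      (∀ x y, H.Adj x y → G'.Adj (f x) (f y)) ∧ (∀ x, P (f x) = Q x) ∧
      ∀ x ∈ cluster0 Q, f x = φ x := by
    by_cases hedge : ∃ x y, H.Adj x y ∧ Q x ≠ none ∧ Q y ≠ none
    · exact exists_embedding_of_edge hΔ hd (hd₀.trans (min_le_left _ _)) hdc hδ hδd hε' hε'd hε'K
        hε hσ1 hθ h1 h2 h3 h4 h5 h6 hQm hPm hH hφ hI hC2 hC4 hC5 hC5' hC6 hC7 hC8 hedge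
    · push Not at hedge
      exact exists_embedding_of_star hQm hPm hφ hI hC2 (b := K₂ * d) (by linarith) hC4 hC7
        fun x y hxy => or_iff_not_imp_left.2 (hedge x y hxy)
  obtain ⟨f, hf, hadj, hPQ, hfφ⟩ := key
  exact ⟨f, hf, hadj, image_cluster_eq hQm hPm hf hPQ, hfφ⟩

end ArxivOG
end

section
/- There exists n₀ such that the following holds for all n ≥ n₀. Let G be a digraph on n vertices and let V₁, …, V_k (k ≤ n) be disjoint subsets of V(G), each of even size. Then each V_i has a partition into sets A_i and B_i with |A_i| = |B_i| = |V_i|/2 such that for every vertex x of G and every i ∈ [k]: |N⁺(x) ∩ A_i| and |N⁺(x) ∩ B_i| are both within n^{2/3} of |N⁺(x) ∩ V_i|/2, and likewise |N⁻(x) ∩ A_i| and |N⁻(x) ∩ B_i| are both within n^{2/3} of |N⁻(x) ∩ V_i|/2. -/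
open Set

namespace ArxivOG

variable {V : Type*}

/-- The method of conditional expectations for a random halving of `S` that splits a fixed perfect
matching of `S`: the exponential moments of the discrepancies of a family of sets stay bounded. -/
lemma exists_half_sum_cosh_le {α ι : Type*} [DecidableEq α] [Fintype ι] (N : ι → Finset α)
    (t : ℝ) (m : ℕ) (S : Finset α) (hS : S.card = 2 * m) :
    ∃ A ⊆ S, A.card = m ∧
      ∑ j, Real.cosh (t * (2 * ((N j ∩ A).card : ℝ) - ((N j ∩ S).card : ℝ))) ≤
        Fintype.card ι * Real.cosh t ^ m := by
  induction m generalizing S with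
  | zero =>
    obtain rfl : S = ∅ := Finset.card_eq_zero.mp (by omega)
    exact ⟨∅, subset_rfl, rfl, by simp⟩
  | succ m ih =>
    obtain ⟨a, S₁, ha, rfl, hS₁⟩ := Finset.card_eq_succ.mp (show S.card = (2 * m + 1) + 1 by omega)
    obtain ⟨b, S₂, hb, rfl, hS₂⟩ := Finset.card_eq_succ.mp hS₁
    obtain ⟨A, hAS, hA, hsum⟩ := ih S₂ hS₂
    obtain ⟨hab, haS⟩ : a ≠ b ∧ a ∉ S₂ := by simpa using ha
    have haA : a ∉ A := fun h => haS (hAS h)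
    have hbA : b ∉ A := fun h => hb (hAS h)
    have card_insert_inter : ∀ (j : ι) (x : α) (T : Finset α), x ∉ T →
        ((N j ∩ insert x T).card : ℝ) = (if x ∈ N j then 1 else 0) + (N j ∩ T).card := by
      intro j x T hx
      split_ifs with h
      · rw [Finset.inter_insert_of_mem h, Finset.card_insert_of_notMem (by simp [hx])]
        push_cast; ring
      · rw [Finset.inter_insert_of_notMem h]; simp
    have pair : ∀ j : ι,
        Real.cosh (t * (2 * ((N j ∩ insert a A).card : ℝ) -
            ((N j ∩ insert a (insert b S₂)).card : ℝ))) +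
          Real.cosh (t * (2 * ((N j ∩ insert b A).card : ℝ) -
            ((N j ∩ insert a (insert b S₂)).card : ℝ))) ≤
        2 * (Real.cosh (t * (2 * ((N j ∩ A).card : ℝ) - ((N j ∩ S₂).card : ℝ))) *
          Real.cosh t) := by
      intro j
      rw [card_insert_inter j a A haA, card_insert_inter j b A hbA,
        card_insert_inter j a _ ha, card_insert_inter j b _ hb]
      generalize ((N j ∩ A).card : ℝ) = p
      generalize ((N j ∩ S₂).card : ℝ) = q
      have hone := Real.one_le_cosh t
      have hpos := Real.cosh_pos (t * (2 * p - q))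
      have hadd := Real.cosh_add (t * (2 * p - q)) t
      have hsub := Real.cosh_sub (t * (2 * p - q)) t
      split_ifs <;> ring_nf at * <;> nlinarith
    have total := Finset.sum_le_sum fun j (_ : j ∈ Finset.univ) => pair j
    rw [Finset.sum_add_distrib, ← Finset.mul_sum, ← Finset.sum_mul] at total
    have bound : (∑ j, Real.cosh (t * (2 * ((N j ∩ A).card : ℝ) - ((N j ∩ S₂).card : ℝ)))) *
        Real.cosh t ≤ Fintype.card ι * Real.cosh t ^ (m + 1) := by
      rw [pow_succ, ← mul_assoc]
      exact mul_le_mul_of_nonneg_right hsum (Real.cosh_pos t).le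
    rcases le_total
      (∑ j, Real.cosh (t * (2 * ((N j ∩ insert a A).card : ℝ) -
        ((N j ∩ insert a (insert b S₂)).card : ℝ))))
      (∑ j, Real.cosh (t * (2 * ((N j ∩ insert b A).card : ℝ) -
        ((N j ∩ insert a (insert b S₂)).card : ℝ)))) with h | h
    · exact ⟨insert a A, by grind, by rw [Finset.card_insert_of_notMem haA, hA], by linarith⟩
    · exact ⟨insert b A, by grind, by rw [Finset.card_insert_of_notMem hbA, hA], by linarith⟩

/-- A set of even size at most `n` can be halved so that each of `2 * n` given sets
has discrepancy at most `2 * n ^ (2 / 3)`. -/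
lemma exists_half_discrepancy_le {α ι : Type*} [DecidableEq α] [Fintype ι] {n : ℕ}
    (hn : 96 ^ 3 ≤ n) (hι : Fintype.card ι = 2 * n) (N : ι → Finset α) (S : Finset α)
    (hS : Even S.card) (hSn : S.card ≤ n) :
    ∃ A ⊆ S, A.card = S.card / 2 ∧ ∀ j,
      |2 * ((N j ∩ A).card : ℝ) - ((N j ∩ S).card : ℝ)| ≤ 2 * (n : ℝ) ^ ((2 : ℝ) / 3) := by
  obtain ⟨m, hm⟩ := hS
  set u : ℝ := (n : ℝ) ^ ((1 : ℝ) / 3) with hu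
  have hu3 : u ^ 3 = n := by
    rw [hu, ← Real.rpow_natCast, ← Real.rpow_mul (by positivity)]; norm_num
  have hu2 : (n : ℝ) ^ ((2 : ℝ) / 3) = u ^ 2 := by
    rw [hu, ← Real.rpow_natCast, ← Real.rpow_mul (by positivity)]; norm_num
  have hu96 : 96 ≤ u := by
    refine le_of_pow_le_pow_left₀ three_ne_zero (by positivity) ?_
    rw [hu3]; exact_mod_cast hn
  have hu0 : 0 < u := by linarith
  obtain ⟨A, hAS, hA, hsum⟩ := exists_half_sum_cosh_le N u⁻¹ m S (by omega)
  refine ⟨A, hAS, by omega, fun j => ?_⟩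
  rw [hu2]
  set D : ℝ := 2 * ((N j ∩ A).card : ℝ) - ((N j ∩ S).card : ℝ)
  have hterm : Real.cosh (u⁻¹ * D) ≤ 2 * n * Real.cosh u⁻¹ ^ m := by
    refine (Finset.single_le_sum (f := fun j => Real.cosh
      (u⁻¹ * (2 * ((N j ∩ A).card : ℝ) - ((N j ∩ S).card : ℝ))))
      (fun i _ => (Real.cosh_pos _).le) (Finset.mem_univ j)).trans (hsum.trans_eq ?_)
    rw [hι]; push_cast; ring
  have hmn : (m : ℝ) ≤ u ^ 3 / 2 := by
    have : ((2 * m : ℕ) : ℝ) ≤ n := by exact_mod_cast (by omega : 2 * m ≤ n)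
    push_cast at this
    linarith
  have hpow : Real.cosh u⁻¹ ^ m ≤ Real.exp (u / 4) := by
    calc Real.cosh u⁻¹ ^ m ≤ Real.exp (u⁻¹ ^ 2 / 2) ^ m := by
          gcongr
          · exact Real.cosh_le_exp_half_sq _
      _ = Real.exp (m * (u⁻¹ ^ 2 / 2)) := (Real.exp_nat_mul _ _).symm
      _ ≤ Real.exp (u ^ 3 / 2 * (u⁻¹ ^ 2 / 2)) := by gcongr
      _ = Real.exp (u / 4) := by congr 1; field_simp; norm_num
  have hexp : 4 * (n : ℝ) ≤ Real.exp u := by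
    have h := Real.pow_div_factorial_le_exp u hu0.le 4
    norm_num [Nat.factorial] at h
    rw [← hu3]
    nlinarith [mul_le_mul_of_nonneg_right hu96 (pow_nonneg hu0.le 3)]
  have habs : Real.exp |u⁻¹ * D| ≤ 2 * Real.cosh (u⁻¹ * D) := by
    rw [← Real.cosh_abs, Real.cosh_eq]
    linarith [Real.exp_pos (-|u⁻¹ * D|)]
  have hfinal : Real.exp |u⁻¹ * D| ≤ Real.exp (u + u / 4) := by
    rw [Real.exp_add]
    calc Real.exp |u⁻¹ * D| ≤ 4 * n * Real.cosh u⁻¹ ^ m := by linarith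
      _ ≤ Real.exp u * Real.exp (u / 4) := by
          gcongr
  rw [Real.exp_le_exp, abs_mul, abs_of_pos (inv_pos.mpr hu0), inv_mul_le_iff₀ hu0] at hfinal
  nlinarith

/-- **Claim 1.1 (random splitting of clusters).**
For all sufficiently large `n`: given a digraph `G` on `n` vertices and disjoint vertex sets
`V₁, …, V_k` (`k ≤ n`) of even size, each `V_i` can be split into halves `A_i, B_i` so that
for every vertex `x` the out- and inneighbourhoods of `x` in `A_i` and `B_i` each have size
within `n^{2/3}` of half the corresponding neighbourhood in `V_i`. -/
theorem random_split_of_clusters :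
    ∃ n₀ : ℕ, ∀ n : ℕ, n₀ ≤ n →
    ∀ G : Fin n → Fin n → Prop, (∀ x, ¬ G x x) →
    ∀ k : ℕ, k ≤ n →
    ∀ Vs : Fin k → Set (Fin n),
    (∀ i j : Fin k, i ≠ j → Disjoint (Vs i) (Vs j)) →
    (∀ i, Even (Vs i).ncard) →
    ∃ A B : Fin k → Set (Fin n),
      (∀ i : Fin k, A i ∪ B i = Vs i ∧ Disjoint (A i) (B i) ∧
        (A i).ncard = (Vs i).ncard / 2 ∧ (B i).ncard = (Vs i).ncard / 2) ∧
      (∀ x : Fin n, ∀ i : Fin k,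
        |((outN G x ∩ A i).ncard : ℝ) - ((outN G x ∩ Vs i).ncard : ℝ) / 2| ≤
          (n : ℝ) ^ ((2 : ℝ) / 3) ∧
        |((outN G x ∩ B i).ncard : ℝ) - ((outN G x ∩ Vs i).ncard : ℝ) / 2| ≤
          (n : ℝ) ^ ((2 : ℝ) / 3) ∧
        |((inN G x ∩ A i).ncard : ℝ) - ((inN G x ∩ Vs i).ncard : ℝ) / 2| ≤
          (n : ℝ) ^ ((2 : ℝ) / 3) ∧
        |((inN G x ∩ B i).ncard : ℝ) - ((inN G x ∩ Vs i).ncard : ℝ) / 2| ≤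
          (n : ℝ) ^ ((2 : ℝ) / 3)) := by
  classical
  refine ⟨96 ^ 3, fun n hn G _ k _ Vs _ heven => ?_⟩
  have half : ∀ i, ∃ A ⊆ Vs i, A.ncard = (Vs i).ncard / 2 ∧
      ∀ j : Fin n ⊕ Fin n,
        |2 * ((Sum.elim (outN G) (inN G) j ∩ A).ncard : ℝ) -
          ((Sum.elim (outN G) (inN G) j ∩ Vs i).ncard : ℝ)| ≤ 2 * (n : ℝ) ^ ((2 : ℝ) / 3) := by
    intro i
    have hcard := Set.ncard_eq_toFinset_card' (Vs i)
    obtain ⟨A, hAS, hA, hD⟩ := exists_half_discrepancy_le hn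
      (by simp [two_mul] : Fintype.card (Fin n ⊕ Fin n) = 2 * n)
      (fun j => (Sum.elim (outN G) (inN G) j).toFinset) (Vs i).toFinset
      (hcard ▸ heven i) (by simpa using Finset.card_le_univ (Vs i).toFinset)
    refine ⟨A, by simpa [← Finset.coe_subset] using hAS, by
      rw [Set.ncard_coe_finset, hA, hcard], fun j => ?_⟩
    have h := hD j
    rw [← Set.ncard_coe_finset, ← Set.ncard_coe_finset] at h
    simpa using h
  choose A hAS hA hD using half
  refine ⟨A, fun i => Vs i \ A i, fun i => ⟨Set.union_sdiff_cancel (hAS i), disjoint_sdiff_right,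
    hA i, ?_⟩, fun x i => ?_⟩
  · rw [Set.ncard_sdiff (hAS i), hA i]
    obtain ⟨m, hm⟩ := heven i
    omega
  · have split : ∀ N : Set (Fin n),
        ((N ∩ (Vs i \ A i)).ncard : ℝ) = (N ∩ Vs i).ncard - (N ∩ A i).ncard := by
      intro N
      have h := Set.ncard_sdiff_add_ncard_of_subset
        (Set.inter_subset_inter_right N (hAS i))
      rw [← Set.inter_sdiff_distrib_left] at h
      rw [← h]; push_cast; ring
    have hout := abs_le.mp (hD i (Sum.inl x))
    have hin := abs_le.mp (hD i (Sum.inr x))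
    simp only [Sum.elim_inl, Sum.elim_inr] at hout hin
    simp only [split, abs_le]
    refine ⟨⟨?_, ?_⟩, ⟨?_, ?_⟩, ⟨?_, ?_⟩, ⟨?_, ?_⟩⟩ <;> linarith

end ArxivOG
end
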